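/- arXiv:1503.03604 — 4 statements merged into one kernel-verified Lean document; each statement's English description precedes it below -/
import Mathlib

section
/- The group Cl₂(𝕜) is isomorphic to ℤ/2ℤ × ℤ/2ℤ × ℤ/2ℤ and is generated by the ideal classes of the prime ideals H₀, H₁ and H₂. -/
open NumberField IntermediateField

theorem isSquare_of_sq_add_prime_mul {R F : Type*} [CommRing R] [IsDomain R] [WfDvdMonoid R]
    [Field F] (φ : R →+* F) {π : R} (hπ : Prime π) (hφ : ∀ z, φ z = 0 ↔ π ∣ z)
    {A B C D y : R} (hC : C ≠ 0) (hD : φ D ≠ 0)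
    (h : A ^ 2 + π * D * B ^ 2 = y * C ^ 2) : IsSquare (φ y) := by
  obtain ⟨n, hn⟩ := FiniteMultiplicity.of_prime_left hπ hC
  have hD' : ¬ π ∣ D := fun hd => hD ((hφ D).2 hd)
  induction n generalizing A B C with
  | zero =>
    have hC' : φ C ≠ 0 := fun h0 => hn (by simpa using (hφ C).1 h0)
    have hp : φ π = 0 := (hφ π).2 dvd_rfl
    have := congrArg φ h
    simp only [map_add, map_mul, map_pow, hp, zero_mul, add_zero] at this
    exact ⟨φ A / φ C, by field_simp; linear_combination -this⟩
  | succ n ih =>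
    by_cases hc : π ∣ C
    · obtain ⟨C, rfl⟩ := hc
      have hA : π ∣ A := hπ.dvd_of_dvd_pow (n := 2)
        ⟨y * π * C ^ 2 - D * B ^ 2, by linear_combination h⟩
      obtain ⟨A, rfl⟩ := hA
      have h1 : π * A ^ 2 + D * B ^ 2 = y * π * C ^ 2 :=
        mul_left_cancel₀ hπ.ne_zero (by linear_combination h)
      have hB : π ∣ B := by
        have : π ∣ D * B ^ 2 := ⟨y * C ^ 2 - A ^ 2, by linear_combination h1⟩
        exact hπ.dvd_of_dvd_pow ((hπ.dvd_or_dvd this).resolve_left hD')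
      obtain ⟨B, rfl⟩ := hB
      refine ih (A := A) (B := B) (C := C) (right_ne_zero_of_mul hC) ?_ ?_
      · exact mul_left_cancel₀ hπ.ne_zero (by linear_combination h1)
      · intro hd
        exact hn (by rw [pow_succ' π (n + 1)]; exact mul_dvd_mul_left _ hd)
    · have hC' : φ C ≠ 0 := fun h0 => hc ((hφ C).1 h0)
      have hp : φ π = 0 := (hφ π).2 dvd_rfl
      have := congrArg φ h
      simp only [map_add, map_mul, map_pow, hp, zero_mul, add_zero] at this
      exact ⟨φ A / φ C, by field_simp; linear_combination -this⟩

theorem isSquare_of_sq_add_prime_mul_eq_prime_mul {R F : Type*} [CommRing R] [IsDomain R]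
    [WfDvdMonoid R] [Field F] (φ : R →+* F) {π : R} (hπ : Prime π) (hφ : ∀ z, φ z = 0 ↔ π ∣ z)
    {A B C D y : R} (hC : C ≠ 0) (hD : φ D ≠ 0)
    (h : A ^ 2 + π * D * B ^ 2 = π * y * C ^ 2) : IsSquare (φ (D * y)) := by
  have hA : π ∣ A := hπ.dvd_of_dvd_pow (n := 2)
    ⟨y * C ^ 2 - D * B ^ 2, by linear_combination h⟩
  obtain ⟨A, rfl⟩ := hA
  have hD0 : D ≠ 0 := by rintro rfl; simp at hD
  have h1 : π * A ^ 2 + D * B ^ 2 = y * C ^ 2 :=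
    mul_left_cancel₀ hπ.ne_zero (by linear_combination h)
  exact isSquare_of_sq_add_prime_mul φ hπ hφ (A := D * B) (B := A) hC hD
    (by linear_combination D * h1)

namespace GaussianInt

theorem prime_of_natAbs_norm_prime {π : GaussianInt} (h : π.norm.natAbs.Prime) : Prime π := by
  refine Irreducible.prime ⟨?_, fun a b hab => ?_⟩
  · rw [← Zsqrtd.norm_eq_one_iff]
    exact h.one_lt.ne'
  · rw [hab, Zsqrtd.norm_mul, Int.natAbs_mul] at h
    rw [← Zsqrtd.norm_eq_one_iff, ← Zsqrtd.norm_eq_one_iff]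
    rcases Nat.prime_mul_iff.1 h with h | h
    exacts [Or.inr h.2, Or.inl h.2]

theorem exists_ringHom_zmod {p : ℕ} (hp : p.Prime) (hm : p % 8 = 5) {e f : ℤ}
    (hef : (p : ℤ) = e ^ 2 + 4 * f ^ 2) :
    Prime (⟨e, 2 * f⟩ : GaussianInt) ∧
      ∃ φ : GaussianInt →+* ZMod p, ∀ z, φ z = 0 ↔ (⟨e, 2 * f⟩ : GaussianInt) ∣ z := by
  have := Fact.mk hp
  have hn : (⟨e, 2 * f⟩ : GaussianInt).norm = p := by rw [Zsqrtd.norm_def, hef]; ring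
  have hprime : Prime (⟨e, 2 * f⟩ : GaussianInt) :=
    prime_of_natAbs_norm_prime (by rwa [hn, Int.natAbs_natCast])
  have hf : (2 * f : ZMod p) ≠ 0 := by
    intro h0
    have h1 : (p : ℤ) ∣ 2 * f := by
      rw [← ZMod.intCast_zmod_eq_zero_iff_dvd]; push_cast; exact h0
    have h2 : (p : ℤ) ∣ e := by
      refine (Nat.prime_iff_prime_int.1 hp).dvd_of_dvd_pow (n := 2) ?_
      have : e ^ 2 = p - (2 * f) ^ 2 := by rw [hef]; ring
      rw [this]
      exact dvd_sub dvd_rfl (dvd_pow h1 two_ne_zero)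
    obtain ⟨a, ha⟩ := h1
    obtain ⟨b, hb⟩ := h2
    have h3 : (p : ℤ) = p * (p * (a ^ 2 + b ^ 2)) := by
      nth_rw 1 [hef]
      rw [hb]
      linear_combination (2 * f + p * a) * ha
    have hp0 : (p : ℤ) ≠ 0 := by exact_mod_cast hp.ne_zero
    have h4 : (1 : ℤ) = p * (a ^ 2 + b ^ 2) := mul_left_cancel₀ hp0 (by linear_combination h3)
    have := Int.eq_one_or_neg_one_of_mul_eq_one h4.symm
    have h5 := hp.two_le
    omega
  have hef' : (e : ZMod p) ^ 2 + 4 * f ^ 2 = 0 := by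
    have := congrArg (Int.cast : ℤ → ZMod p) hef
    push_cast at this
    rw [← this]; simp
  have hr : (-(e : ZMod p) / (2 * f)) * (-(e : ZMod p) / (2 * f)) = ((-1 : ℤ) : ZMod p) := by
    push_cast
    have h4 : (f : ZMod p) ≠ 0 := right_ne_zero_of_mul hf
    have h5 : (2 : ZMod p) ≠ 0 := left_ne_zero_of_mul hf
    field_simp
    linear_combination hef'
  refine ⟨hprime, Zsqrtd.lift ⟨_, hr⟩, ?_⟩
  set φ : GaussianInt →+* ZMod p := Zsqrtd.lift ⟨_, hr⟩ with hφ
  have hφπ : φ ⟨e, 2 * f⟩ = 0 := by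
    simp only [hφ, Zsqrtd.lift_apply_apply]
    push_cast
    rw [mul_div_cancel₀ _ hf]
    ring
  have hmax : (Ideal.span {(⟨e, 2 * f⟩ : GaussianInt)}).IsMaximal :=
    PrincipalIdealRing.isMaximal_of_irreducible hprime.irreducible
  have := hmax.eq_of_le (RingHom.ker_ne_top φ)
    ((Ideal.span_singleton_le_iff_mem _).2 hφπ)
  intro z
  rw [← Ideal.mem_span_singleton, this, RingHom.mem_ker]

end GaussianInt

section QuadraticChar

variable {p : ℕ} [Fact p.Prime]

theorem quadraticChar_neg_one_of_mod_eight (hm : p % 8 = 5) :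
    quadraticChar (ZMod p) (-1) = 1 := by
  have : IsSquare (-1 : ZMod p) := ZMod.exists_sq_eq_neg_one_iff.2 (by omega)
  rwa [quadraticChar_one_iff_isSquare (by simp)]

theorem quadraticChar_two_of_mod_eight (hm : p % 8 = 5) :
    quadraticChar (ZMod p) 2 = -1 := by
  rw [quadraticChar_neg_one_iff_not_isSquare, ZMod.exists_sq_eq_two_iff (by omega)]
  omega

theorem quadraticChar_of_sq_eq_neg_one (hm : p % 8 = 5) {x : ZMod p} (hx : x ^ 2 = -1) :
    quadraticChar (ZMod p) x = -1 := by
  have hx0 : x ≠ 0 := by rintro rfl; simp at hx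
  rw [quadraticChar_neg_one_iff_not_isSquare, ZMod.euler_criterion p hx0]
  have : p / 2 = 2 * (2 * (p / 8) + 1) := by omega
  rw [this, pow_mul, hx, pow_succ, pow_mul]
  simp only [even_two, Even.neg_pow, one_pow, one_mul]
  intro h
  have h2 : (2 : ZMod p) = 0 := by linear_combination -h
  have h3 := (ZMod.natCast_eq_zero_iff 2 p).1 (by exact_mod_cast h2)
  have := Nat.le_of_dvd two_pos h3
  omega

theorem quadraticChar_of_eq_sq_add_four_mul_sq (hm : p % 8 = 5) {e f : ℤ}
    (hef : (p : ℤ) = e ^ 2 + 4 * f ^ 2) : quadraticChar (ZMod p) e = 1 := by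
  have hodd : Odd e.natAbs := by
    rw [Int.natAbs_odd, ← Int.not_even_iff_odd]
    rintro ⟨k, rfl⟩
    have : (p : ℤ) = 2 * (2 * k ^ 2 + 2 * f ^ 2) := by rw [hef]; ring
    omega
  have hgcd : IsCoprime (e : ℤ) p := by
    rw [isCoprime_comm, (Nat.prime_iff_prime_int.1 (Fact.out : p.Prime)).coprime_iff_not_dvd]
    intro h
    have hp := (Nat.prime_iff_prime_int.1 (Fact.out : p.Prime))
    have hlt : |e| < p := by
      rw [← abs_of_nonneg (Int.natCast_nonneg p)]
      apply sq_lt_sq.1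
      have hp2 : (2 : ℤ) ≤ p := by exact_mod_cast (Fact.out : p.Prime).two_le
      nlinarith [sq_nonneg f]
    have := Int.eq_zero_of_abs_lt_dvd h hlt
    subst this
    simp at hodd
  have key : jacobiSym e.natAbs p = 1 := by
    rw [← jacobiSym.quadratic_reciprocity_one_mod_four (by omega) hodd]
    have h1 : ((p : ℕ) : ℤ) % (e.natAbs : ℕ) = (2 * f) ^ 2 % (e.natAbs : ℕ) := by
      rw [Int.natCast_natAbs]
      apply Int.ModEq.symm
      apply (Int.modEq_iff_dvd).2
      rw [abs_dvd]
      exact ⟨e, by rw [hef]; ring⟩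
    rw [jacobiSym.mod_left' h1]
    apply jacobiSym.sq_one'
    have h2 : IsCoprime (2 * f) e := by
      have hc2 : IsCoprime (2 * (2 * f ^ 2)) e := by
        have h3 : IsCoprime e (2 * (2 * f ^ 2) + e * e) := by
          convert hgcd using 1
          rw [hef]; ring
        exact (IsCoprime.of_add_mul_left_right h3).symm
      refine IsCoprime.mul_left hc2.of_mul_left_left ?_
      have := hc2.of_mul_left_right.of_mul_left_right
      exact this.of_isCoprime_of_dvd_left (dvd_pow_self f two_ne_zero)
    have := Int.isCoprime_iff_gcd_eq_one.1 h2
    simpa [Int.gcd, Int.natAbs_abs] using this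
  rw [← jacobiSym.legendreSym.to_jacobiSym] at key
  have h5 : quadraticChar (ZMod p) (e.natAbs : ℤ) = 1 := key
  rcases Int.natAbs_eq e with he | he
  · rw [he]; exact h5
  · rw [he, Int.cast_neg, ← neg_one_mul, map_mul, quadraticChar_neg_one_of_mod_eight hm, h5]
    rfl

end QuadraticChar

namespace GaussianInt

theorem quadraticChar_map_unit {p : ℕ} [Fact p.Prime] (hm : p % 8 = 5)
    (φ : GaussianInt →+* ZMod p) {u : GaussianInt} (hu : u ^ 2 = 1 ∨ u ^ 2 = -1) :
    quadraticChar (ZMod p) (φ u) = (if u ^ 2 = 1 then 1 else -1) := by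
  split_ifs with h
  · rcases mul_self_eq_one_iff.1 ((sq u).symm.trans h) with rfl | rfl
    · simp
    · simpa using quadraticChar_neg_one_of_mod_eight hm
  · refine quadraticChar_of_sq_eq_neg_one hm ?_
    rw [← map_pow, hu.resolve_left h]; simp

theorem map_star_eq_zero_iff {F : Type*} [Field F] {φ : GaussianInt →+* F} {π : GaussianInt}
    (hφ : ∀ z, φ z = 0 ↔ π ∣ z) (z : GaussianInt) :
    φ.comp (starRingEnd GaussianInt) z = 0 ↔ star π ∣ z := by
  rw [RingHom.comp_apply, hφ]
  constructor
  · rintro ⟨c, hc⟩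
    refine ⟨star c, ?_⟩
    rw [starRingEnd_apply] at hc
    rw [← star_star z, hc, star_mul, mul_comm]
  · rintro ⟨c, rfl⟩
    rw [starRingEnd_apply, star_mul, star_star]
    exact dvd_mul_left _ _

theorem prime_star {π : GaussianInt} (h : Prime π) : Prime (star π) := by
  have := (MulEquiv.prime_iff (starRingAut (R := GaussianInt)).toMulEquiv (p := π)).2 h
  exact this

theorem natCast_eq_mul_star {p : ℕ} {e f : ℤ} (hef : (p : ℤ) = e ^ 2 + 4 * f ^ 2) :
    (p : GaussianInt) = ⟨e, 2 * f⟩ * star ⟨e, 2 * f⟩ := by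
  rw [Zsqrtd.mul_star]
  have : (p : GaussianInt) = ((p : ℤ) : GaussianInt) := by simp
  rw [this, hef]
  push_cast
  ring

theorem quadraticChar_map_star {p : ℕ} [Fact p.Prime] (hm : p % 8 = 5) {e f : ℤ}
    (hef : (p : ℤ) = e ^ 2 + 4 * f ^ 2) {φ : GaussianInt →+* ZMod p}
    (hφ : ∀ z, φ z = 0 ↔ (⟨e, 2 * f⟩ : GaussianInt) ∣ z) :
    quadraticChar (ZMod p) (φ (star ⟨e, 2 * f⟩)) = -1 := by
  have h1 : (star ⟨e, 2 * f⟩ : GaussianInt) = (2 : ℕ) * (e : ℤ) - ⟨e, 2 * f⟩ := by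
    ext <;> simp; ring
  rw [h1, map_sub, (hφ _).2 dvd_rfl, sub_zero, map_mul, map_natCast, map_intCast, map_mul,
    quadraticChar_of_eq_sq_add_four_mul_sq hm hef, mul_one]
  exact_mod_cast quadraticChar_two_of_mod_eight hm

theorem quadraticChar_map_eq_one {p : ℕ} [Fact p.Prime] {π D A B C y : GaussianInt}
    (hπ : Prime π) {φ : GaussianInt →+* ZMod p} (hφ : ∀ z, φ z = 0 ↔ π ∣ z)
    (hD : φ D ≠ 0) (hC : C ≠ 0) (hy : φ y ≠ 0)
    (h : A ^ 2 + π * D * B ^ 2 = y * C ^ 2) : quadraticChar (ZMod p) (φ y) = 1 :=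
  (quadraticChar_one_iff_isSquare hy).2 (isSquare_of_sq_add_prime_mul φ hπ hφ hC hD h)

theorem quadraticChar_map_mul_eq_one {p : ℕ} [Fact p.Prime] {π D A B C y : GaussianInt}
    (hπ : Prime π) {φ : GaussianInt →+* ZMod p} (hφ : ∀ z, φ z = 0 ↔ π ∣ z)
    (hD : φ D ≠ 0) (hC : C ≠ 0) (hy : φ y ≠ 0)
    (h : A ^ 2 + π * D * B ^ 2 = π * y * C ^ 2) : quadraticChar (ZMod p) (φ (D * y)) = 1 :=
  (quadraticChar_one_iff_isSquare (by simp [hD, hy])).2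
    (isSquare_of_sq_add_prime_mul_eq_prime_mul φ hπ hφ hC hD h)

theorem exponents_eq_zero_of_signs {k₀ k₁ k₂ : ℕ} {ε s s' t t' a b : ℤ}
    (hk₀ : k₀ < 2) (hk₁ : k₁ < 2) (hk₂ : k₂ < 2) (hs : s = 1 ∨ s = -1)
    (ht : t = 1 ∨ t = -1) (ha : a = 1 ∨ a = -1) (hb : b = 1 ∨ b = -1)
    (hss : s * s' = -1) (htt : t * t' = -1)
    (E₁ : (a * b) ^ k₁ * ε * s ^ k₀ * (-1) ^ k₂ = 1)
    (E₂ : (a * b) ^ k₂ * ε * s' ^ k₀ * (-1) ^ k₁ = 1)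
    (E₃ : ε * t ^ k₀ * a ^ k₁ * b ^ k₂ = 1) (E₄ : ε * t' ^ k₀ * b ^ k₁ * a ^ k₂ = 1) :
    k₀ = 0 ∧ k₁ = 0 ∧ k₂ = 0 ∧ ε = 1 := by
  obtain rfl : s' = -s := by rcases hs with rfl | rfl <;> omega
  obtain rfl : t' = -t := by rcases ht with rfl | rfl <;> omega
  rcases ha with rfl | rfl <;> rcases hb with rfl | rfl <;> interval_cases k₁ <;>
    interval_cases k₂ <;> interval_cases k₀ <;> simp at E₁ E₂ E₃ E₄ ⊢ <;> omega

set_option maxHeartbeats 800000 in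
theorem exponents_eq_zero_of_sq_add_mul_sq {p₁ p₂ : ℕ} (hp₁ : p₁.Prime) (hp₂ : p₂.Prime)
    (hne : p₁ ≠ p₂) (hm₁ : p₁ % 8 = 5) (hm₂ : p₂ % 8 = 5) {e f g h : ℤ}
    (hef : (p₁ : ℤ) = e ^ 2 + 4 * f ^ 2) (hgh : (p₂ : ℤ) = g ^ 2 + 4 * h ^ 2)
    {A B C u : GaussianInt} (hC : C ≠ 0) (hu : u ^ 2 = 1 ∨ u ^ 2 = -1) {k₀ k₁ k₂ : ℕ}
    (hk₀ : k₀ < 2) (hk₁ : k₁ < 2) (hk₂ : k₂ < 2)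
    (hABC : A ^ 2 + ⟨0, 1⟩ * (p₁ * p₂) * B ^ 2 =
      u * ⟨1, 1⟩ ^ k₀ * ⟨e, 2 * f⟩ ^ k₁ * (star ⟨e, 2 * f⟩) ^ k₂ * C ^ 2) :
    k₀ = 0 ∧ k₁ = 0 ∧ k₂ = 0 ∧ u ^ 2 = 1 := by
  have := Fact.mk hp₁
  have := Fact.mk hp₂
  obtain ⟨hπ₁, φ₁, hφ₁⟩ := exists_ringHom_zmod hp₁ hm₁ hef
  obtain ⟨hπ₃, φ₃, hφ₃⟩ := exists_ringHom_zmod hp₂ hm₂ hgh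
  have hπ₂ := prime_star hπ₁
  have hπ₄ := prime_star hπ₃
  have hφ₂ := map_star_eq_zero_iff hφ₁
  have hφ₄ := map_star_eq_zero_iff hφ₃
  have hP₁ := natCast_eq_mul_star hef
  have hP₂ := natCast_eq_mul_star hgh
  have hs₁ := quadraticChar_map_star hm₁ hef hφ₁
  have hs₃ := quadraticChar_map_star hm₂ hgh hφ₃
  have hu₁ := quadraticChar_map_unit hm₁ φ₁ hu
  have hu₂ := quadraticChar_map_unit hm₁ (φ₁.comp (starRingEnd GaussianInt)) hu
  have hu₃ := quadraticChar_map_unit hm₂ φ₃ hu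
  have hu₄ := quadraticChar_map_unit hm₂ (φ₃.comp (starRingEnd GaussianInt)) hu
  have hI : (⟨0, 1⟩ : GaussianInt) ^ 2 = -1 := by decide
  have hI₁ := quadraticChar_map_unit hm₁ φ₁ (Or.inr hI)
  have hI₂ := quadraticChar_map_unit hm₁ (φ₁.comp (starRingEnd GaussianInt)) (Or.inr hI)
  set I : GaussianInt := ⟨0, 1⟩
  have hne1 : I ^ 2 ≠ 1 := by decide
  rw [if_neg hne1] at hI₁ hI₂
  set π₁ : GaussianInt := ⟨e, 2 * f⟩
  set π₃ : GaussianInt := ⟨g, 2 * h⟩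
  set J : GaussianInt := ⟨1, 1⟩
  have hJ : J * star J = ((2 : ℕ) : GaussianInt) := by decide
  have hJ₁ : quadraticChar (ZMod p₁) (φ₁ J) * quadraticChar (ZMod p₁) (φ₁ (star J)) = -1 := by
    rw [← map_mul, ← map_mul, hJ, map_natCast]
    exact_mod_cast quadraticChar_two_of_mod_eight hm₁
  have hJ₃ : quadraticChar (ZMod p₂) (φ₃ J) * quadraticChar (ZMod p₂) (φ₃ (star J)) = -1 := by
    rw [← map_mul, ← map_mul, hJ, map_natCast]
    exact_mod_cast quadraticChar_two_of_mod_eight hm₂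
  have hr : quadraticChar (ZMod p₂) (φ₃ π₁) * quadraticChar (ZMod p₂) (φ₃ (star π₁)) =
      quadraticChar (ZMod p₁) (φ₁ p₂) := by
    rw [← map_mul, ← map_mul, ← hP₁, map_natCast φ₃, map_natCast φ₁]
    have := legendreSym.quadratic_reciprocity_one_mod_four (p := p₁) (q := p₂)
      (by omega) (by omega)
    simpa [legendreSym] using this
  have hne0 : ∀ {p : ℕ} [Fact p.Prime] {z : ZMod p}, quadraticChar (ZMod p) z ≠ 0 → z ≠ 0 :=
    fun hz => quadraticChar_eq_zero_iff.not.1 hz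
  have hpm : ∀ {p : ℕ} [Fact p.Prime] {z : ZMod p}, quadraticChar (ZMod p) z ≠ 0 →
    quadraticChar (ZMod p) z = 1 ∨ quadraticChar (ZMod p) z = -1 :=
    fun hz => quadraticChar_dichotomy (hne0 hz)
  have hp₂₁ : φ₁ p₂ ≠ 0 := by
    rw [Ne, map_natCast, ZMod.natCast_eq_zero_iff, Nat.prime_dvd_prime_iff_eq hp₁ hp₂]
    exact hne
  have hp₁₂ : φ₃ p₁ ≠ 0 := by
    rw [Ne, map_natCast, ZMod.natCast_eq_zero_iff, Nat.prime_dvd_prime_iff_eq hp₂ hp₁]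
    exact hne.symm
  have hr' := quadraticChar_dichotomy hp₂₁
  have hI0 : ∀ {p : ℕ} [Fact p.Prime] (φ : GaussianInt →+* ZMod p), φ I ≠ 0 := by
    intro p _ φ h0
    have := congrArg φ hI
    simp [h0] at this
  have hu0 : ∀ {p : ℕ} [Fact p.Prime] (φ : GaussianInt →+* ZMod p), φ u ≠ 0 := by
    intro p _ φ h0
    rcases hu with hu | hu <;> simpa [h0] using congrArg φ hu
  have hstar : ∀ {p : ℕ} (φ : GaussianInt →+* ZMod p) (z : GaussianInt),
    (φ.comp (starRingEnd GaussianInt)) z = φ (star z) := fun _ _ => rfl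
  have hJ₁' := hpm (left_ne_zero_of_mul (hJ₁.trans_ne (by decide)))
  have hJ₃' := hpm (left_ne_zero_of_mul (hJ₃.trans_ne (by decide)))
  have hrne : quadraticChar (ZMod p₁) (φ₁ p₂) ≠ 0 := quadraticChar_eq_zero_iff.not.2 hp₂₁
  have ha' := hpm (left_ne_zero_of_mul (hr.trans_ne hrne))
  have hb' := hpm (right_ne_zero_of_mul (hr.trans_ne hrne))
  have hs₁0 := hne0 (hs₁.trans_ne (by decide))
  have hs₃0 := hne0 (hs₃.trans_ne (by decide))
  have hJ₁0 := hne0 (left_ne_zero_of_mul (hJ₁.trans_ne (by decide)))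
  have hJ₁s0 := hne0 (right_ne_zero_of_mul (hJ₁.trans_ne (by decide)))
  have hJ₃0 := hne0 (left_ne_zero_of_mul (hJ₃.trans_ne (by decide)))
  have hJ₃s0 := hne0 (right_ne_zero_of_mul (hJ₃.trans_ne (by decide)))
  have ha0 := hne0 (left_ne_zero_of_mul (hr.trans_ne hrne))
  have hb0 := hne0 (right_ne_zero_of_mul (hr.trans_ne hrne))
  have ha0' : φ₃ (star (star π₁)) ≠ 0 := by rwa [star_star]
  rw [hP₁, hP₂] at hABC
  have hp₂₁' := hp₂₁
  have hp₁₂' := hp₁₂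
  rw [map_natCast] at hp₁₂'
  clear_value I π₁ π₃ J
  rw [hP₂, map_mul] at hp₂₁
  rw [hP₁, map_mul] at hp₁₂
  have hpn (φ : GaussianInt →+* ZMod p₁) : φ (π₃ * star π₃) = φ₁ p₂ := by
    rw [← hP₂, map_natCast, map_natCast]
  generalize hε : (if u ^ 2 = 1 then (1 : ℤ) else -1) = ε at hu₁ hu₂ hu₃ hu₄
  have E₁ : quadraticChar (ZMod p₁) (φ₁ p₂) ^ k₁ * ε * quadraticChar (ZMod p₁) (φ₁ J) ^ k₀ *
      (-1) ^ k₂ = 1 := by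
    interval_cases k₁
    · have := quadraticChar_map_eq_one hπ₁ hφ₁ (A := A) (B := B) (C := C)
        (D := I * star π₁ * (π₃ * star π₃)) (y := u * J ^ k₀ * star π₁ ^ k₂)
        (by simp only [map_mul]; exact mul_ne_zero (mul_ne_zero (hI0 _) hs₁0) hp₂₁)
        hC (by simp only [map_mul, map_pow]; exact mul_ne_zero (mul_ne_zero (hu0 _) (pow_ne_zero _ hJ₁0)) (pow_ne_zero _ hs₁0))
        (by linear_combination hABC)
      simpa only [map_mul, map_pow, hu₁, hs₁, pow_zero, one_mul] using this
    · have := quadraticChar_map_mul_eq_one hπ₁ hφ₁ (A := A) (B := B) (C := C)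
        (D := I * star π₁ * (π₃ * star π₃)) (y := u * J ^ k₀ * star π₁ ^ k₂)
        (by simp only [map_mul]; exact mul_ne_zero (mul_ne_zero (hI0 _) hs₁0) hp₂₁)
        hC (by simp only [map_mul, map_pow]; exact mul_ne_zero (mul_ne_zero (hu0 _) (pow_ne_zero _ hJ₁0)) (pow_ne_zero _ hs₁0))
        (by linear_combination hABC)
      rw [map_mul, map_mul, map_mul, hpn] at this
      simp only [map_mul, map_pow, hu₁, hs₁, hI₁] at this
      linear_combination this
  have E₂ : quadraticChar (ZMod p₁) (φ₁ p₂) ^ k₂ * ε *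
      quadraticChar (ZMod p₁) (φ₁ (star J)) ^ k₀ * (-1) ^ k₁ = 1 := by
    interval_cases k₂
    · have := quadraticChar_map_eq_one hπ₂ hφ₂ (A := A) (B := B) (C := C)
        (D := I * π₁ * (π₃ * star π₃)) (y := u * J ^ k₀ * π₁ ^ k₁)
        (by
          rw [map_mul, map_mul, hpn]
          exact mul_ne_zero (mul_ne_zero (hI0 _) hs₁0) hp₂₁')
        hC (by simp only [map_mul, map_pow]; exact mul_ne_zero (mul_ne_zero (hu0 _) (pow_ne_zero _ hJ₁s0)) (pow_ne_zero _ hs₁0))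
        (by linear_combination hABC)
      simp only [map_mul, map_pow, hu₂] at this
      simpa only [hstar, hs₁, pow_zero, one_mul] using this
    · have := quadraticChar_map_mul_eq_one hπ₂ hφ₂ (A := A) (B := B) (C := C)
        (D := I * π₁ * (π₃ * star π₃)) (y := u * J ^ k₀ * π₁ ^ k₁)
        (by
          rw [map_mul, map_mul, hpn]
          exact mul_ne_zero (mul_ne_zero (hI0 _) hs₁0) hp₂₁')
        hC (by simp only [map_mul, map_pow]; exact mul_ne_zero (mul_ne_zero (hu0 _) (pow_ne_zero _ hJ₁s0)) (pow_ne_zero _ hs₁0))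
        (by linear_combination hABC)
      rw [map_mul, map_mul, map_mul, hpn] at this
      simp only [map_mul, map_pow, hu₂, hI₂] at this
      simp only [hstar, hs₁] at this
      linear_combination this
  have E₃ : ε * quadraticChar (ZMod p₂) (φ₃ J) ^ k₀ * quadraticChar (ZMod p₂) (φ₃ π₁) ^ k₁ *
      quadraticChar (ZMod p₂) (φ₃ (star π₁)) ^ k₂ = 1 := by
    have := quadraticChar_map_eq_one hπ₃ hφ₃ (A := A) (B := B) (C := C)
      (D := I * star π₃ * (π₁ * star π₁)) (y := u * J ^ k₀ * π₁ ^ k₁ * star π₁ ^ k₂)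
      (by simp only [map_mul]; exact mul_ne_zero (mul_ne_zero (hI0 _) hs₃0) hp₁₂)
      hC (by
        simp only [map_mul, map_pow]
        exact mul_ne_zero (mul_ne_zero (mul_ne_zero (hu0 _) (pow_ne_zero _ hJ₃0)) (pow_ne_zero _ ha0))
          (pow_ne_zero _ hb0))
      (by linear_combination hABC)
    simpa only [map_mul, map_pow, hu₃] using this
  have E₄ : ε * quadraticChar (ZMod p₂) (φ₃ (star J)) ^ k₀ *
      quadraticChar (ZMod p₂) (φ₃ (star π₁)) ^ k₁ * quadraticChar (ZMod p₂) (φ₃ π₁) ^ k₂ = 1 := by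
    have := quadraticChar_map_eq_one hπ₄ hφ₄ (A := A) (B := B) (C := C)
      (D := I * π₃ * (π₁ * star π₁)) (y := u * J ^ k₀ * π₁ ^ k₁ * star π₁ ^ k₂)
      (by
        rw [map_mul, map_mul, ← hP₁, map_natCast]
        exact mul_ne_zero (mul_ne_zero (hI0 _) hs₃0) hp₁₂')
      hC (by
        simp only [map_mul, map_pow]
        exact mul_ne_zero (mul_ne_zero (mul_ne_zero (hu0 _) (pow_ne_zero _ hJ₃s0)) (pow_ne_zero _ hb0))
          (pow_ne_zero _ ha0'))
      (by linear_combination hABC)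
    simp only [map_mul, map_pow, hu₄] at this
    simpa only [hstar, star_star] using this
  have hε' : u ^ 2 = 1 ∨ ε = -1 := by
    rw [← hε]; split_ifs with h1 <;> simp [h1]
  obtain ⟨h₀, h₁, h₂, h₃⟩ :=
    exponents_eq_zero_of_signs hk₀ hk₁ hk₂ hJ₁' hJ₃' ha' hb' hJ₁ hJ₃
      (by rwa [hr]) (by rwa [hr]) E₃ E₄
  exact ⟨h₀, h₁, h₂, hε'.resolve_right (by rw [h₃]; decide)⟩

end GaussianInt

theorem dvd_of_dvd_add_of_sq_dvd_mul {S : Type*} [CommRing S] [IsDomain S] [IsIntegrallyClosed S]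
    {z w n : S} (h₁ : n ∣ z + w) (h₂ : n ^ 2 ∣ z * w) : n ∣ z := by
  obtain ⟨t, ht⟩ := h₁
  obtain ⟨m, hm⟩ := h₂
  by_cases hn : n = 0
  · subst hn
    have : z ^ 2 = 0 := by linear_combination z * ht - hm
    rw [pow_eq_zero_iff two_ne_zero] at this
    rw [this]
  obtain ⟨K, _, _, _⟩ : ∃ (K : Type _) (_ : Field K) (_ : Algebra S K), IsFractionRing S K :=
    ⟨FractionRing S, inferInstance, inferInstance, inferInstance⟩
  have hnK : algebraMap S K n ≠ 0 := by
    simpa using hn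
  have ht' := congrArg (algebraMap S K) ht
  have hm' := congrArg (algebraMap S K) hm
  simp only [map_add, map_mul, map_pow] at ht' hm'
  have hzn : IsIntegral S (algebraMap S K z / algebraMap S K n) := by
    refine ⟨Polynomial.X ^ 2 + (-Polynomial.C t * Polynomial.X + Polynomial.C m), ?_, ?_⟩
    · monicity!
    · simp only [Polynomial.eval₂_add, Polynomial.eval₂_mul, Polynomial.eval₂_pow,
        Polynomial.eval₂_neg, Polynomial.eval₂_X, Polynomial.eval₂_C]
      field_simp
      linear_combination algebraMap S K z * ht' - hm'
  obtain ⟨y, hy⟩ := IsIntegrallyClosed.isIntegral_iff.1 hzn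
  refine ⟨y, IsFractionRing.injective S K ?_⟩
  rw [map_mul, hy]
  field_simp

section Involution

variable {R S : Type*} [CommRing R] [CommRing S] [Algebra R S] {σ : S ≃ₐ[R] S}

theorem dvd_of_algebraMap_dvd_algebraMap [IsDomain S] [FaithfulSMul R S]
    (hfix : ∀ z, σ z = z → ∃ r, algebraMap R S r = z)
    {n r : R} (h : algebraMap R S n ∣ algebraMap R S r) : n ∣ r := by
  have hinj := FaithfulSMul.algebraMap_injective R S
  obtain ⟨w, hw⟩ := h
  by_cases hn : n = 0
  · subst hn
    have : r = 0 := hinj (by simpa using hw)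
    rw [this]
  have hnS : algebraMap R S n ≠ 0 := fun h0 => hn (hinj (by rw [h0, map_zero]))
  obtain ⟨s, hs⟩ := hfix w (by
    have := congrArg σ hw
    rw [map_mul, AlgEquiv.commutes, AlgEquiv.commutes, hw] at this
    exact (mul_left_cancel₀ hnS this).symm)
  exact ⟨s, hinj (by rw [hw, map_mul, hs])⟩

theorem Ideal.map_map_of_involutive (hσ : ∀ z, σ (σ z) = z) (I : Ideal S) :
    (I.map σ).map σ = I := by
  ext z
  simp only [Ideal.mem_map_of_equiv]
  constructor
  · rintro ⟨_, ⟨y, hy, rfl⟩, rfl⟩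
    rwa [hσ]
  · intro hz
    exact ⟨_, ⟨z, hz, rfl⟩, hσ z⟩

theorem Ideal.map_eq_self_of_le (hσ : ∀ z, σ (σ z) = z) {I : Ideal S} (h : ∀ z ∈ I, σ z ∈ I) :
    I.map σ = I := by
  ext z
  rw [Ideal.mem_map_of_equiv]
  constructor
  · rintro ⟨y, hy, rfl⟩
    exact h y hy
  · exact fun hz => ⟨_, h z hz, hσ z⟩

theorem Ideal.apply_mem_of_map_eq_self {I : Ideal S} (h : I.map σ = I) {z : S} (hz : z ∈ I) :
    σ z ∈ I := by
  rw [← h]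
  exact Ideal.mem_map_of_mem σ hz

variable [IsPrincipalIdealRing R]

theorem Ideal.exists_mul_map_eq_span [IsDomain S] [IsIntegrallyClosed S] (hσ : ∀ z, σ (σ z) = z)
    (hfix : ∀ z, σ z = z → ∃ r, algebraMap R S r = z) (I : Ideal S) :
    ∃ n : R, I * I.map σ = Ideal.span {algebraMap R S n} := by
  obtain ⟨n, hn⟩ := IsPrincipalIdealRing.principal ((I * I.map σ).comap (algebraMap R S))
  rw [← Ideal.span] at hn
  have hmem : ∀ z ∈ I * I.map σ, σ z = z → algebraMap R S n ∣ z := by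
    intro z hz h
    obtain ⟨r, rfl⟩ := hfix z h
    have : r ∈ (I * I.map σ).comap (algebraMap R S) := hz
    rw [hn, Ideal.mem_span_singleton] at this
    exact map_dvd _ this
  refine ⟨n, le_antisymm ?_ ?_⟩
  · rw [Ideal.mul_le]
    intro a ha b hb
    obtain ⟨b, hb', rfl⟩ := (Ideal.mem_map_of_equiv σ b).1 hb
    clear hb
    rename b ∈ I => hb
    rw [Ideal.mem_span_singleton]
    have key : ∀ {x y}, x ∈ I → y ∈ I → x * σ y ∈ I * I.map σ := fun hx hy =>
      Ideal.mul_mem_mul hx ((Ideal.mem_map_of_equiv σ _).2 ⟨_, hy, rfl⟩)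
    refine dvd_of_dvd_add_of_sq_dvd_mul (w := b * σ a) ?_ ?_
    · refine hmem _ (add_mem (key ha hb) (key hb ha)) ?_
      simp only [map_add, map_mul, hσ]
      ring
    · have h₁ := hmem _ (key ha ha) (by simp only [map_mul, hσ]; ring)
      have h₂ := hmem _ (key hb hb) (by simp only [map_mul, hσ]; ring)
      calc algebraMap R S n ^ 2 = algebraMap R S n * algebraMap R S n := sq _
        _ ∣ (a * σ a) * (b * σ b) := mul_dvd_mul h₁ h₂
        _ = a * σ b * (b * σ a) := by ring
  · rw [Ideal.span_singleton_le_iff_mem]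
    have : n ∈ Ideal.span {n} := Ideal.mem_span_singleton_self n
    rwa [← hn] at this

variable [IsDedekindDomain S] [FaithfulSMul R S]

theorem Ideal.sq_eq_span_of_ramified [IsDomain R] (hσ : ∀ z, σ (σ z) = z)
    (hfix : ∀ z, σ z = z → ∃ r, algebraMap R S r = z) {π : R} (hπ : Prime π) {H : Ideal S}
    (hH : H.IsPrime) (hπH : algebraMap R S π ∈ H) (hram : ∀ z, z - σ z ∈ H) {τ : S}
    (hτ : algebraMap R S π ∣ τ ^ 2) (hτ' : ¬ algebraMap R S π ∣ τ) :
    H.map σ = H ∧ H ^ 2 = Ideal.span {algebraMap R S π} := by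
  have hinj := FaithfulSMul.algebraMap_injective R S
  have hmap : H.map σ = H := Ideal.map_eq_self_of_le hσ fun z hz => by
    have := H.sub_mem hz (hram z)
    rwa [sub_sub_cancel] at this
  refine ⟨hmap, ?_⟩
  obtain ⟨n, hn⟩ := Ideal.exists_mul_map_eq_span hσ hfix H
  rw [hmap, ← sq] at hn
  have hnπ : n ∣ π ^ 2 := by
    refine dvd_of_algebraMap_dvd_algebraMap hfix ?_
    rw [← Ideal.mem_span_singleton, ← hn, map_pow]
    exact Ideal.pow_mem_pow hπH 2
  obtain ⟨i, hi, hin⟩ := (dvd_prime_pow hπ 2).1 hnπ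
  have hn' : H ^ 2 = Ideal.span {algebraMap R S π} ^ i := by
    rw [hn, Ideal.span_singleton_pow, Ideal.span_singleton_eq_span_singleton, ← map_pow]
    exact hin.map (algebraMap R S)
  interval_cases i
  · rw [pow_zero] at hn'
    exact absurd (Ideal.eq_top_iff_one _ |>.2
      (Ideal.pow_le_self two_ne_zero (hn' ▸ (Ideal.one_eq_top (R := S) ▸ trivial)))) hH.ne_top
  · rw [hn', pow_one]
  · have h1 : H = Ideal.span {algebraMap R S π} := pow_left_injective two_ne_zero hn'
    refine absurd ?_ hτ'
    rw [← Ideal.mem_span_singleton, ← h1]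
    exact hH.mem_of_pow_mem 2 (H.mem_of_dvd hτ hπH)

theorem Ideal.eq_span_or_mem_of_map_eq_self (hσ : ∀ z, σ (σ z) = z)
    (hfix : ∀ z, σ z = z → ∃ r, algebraMap R S r = z) {θ : S} (hθ : σ θ = -θ) {Q : Ideal S}
    (hQ : Q.IsPrime) (hQ0 : Q ≠ ⊥) (hmap : Q.map σ = Q) :
    (∃ m : R, Q = Ideal.span {algebraMap R S m}) ∨ 2 * θ ∈ Q := by
  have hinj := FaithfulSMul.algebraMap_injective R S
  have hQp : Prime Q := Ideal.prime_of_isPrime hQ0 hQ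
  obtain ⟨n, hn⟩ := Ideal.exists_mul_map_eq_span hσ hfix Q
  rw [hmap, ← sq] at hn
  have hunit : ∀ {m : R}, Ideal.span {algebraMap R S m} = 1 → IsUnit m := fun {m} h => by
    rw [Ideal.one_eq_top, Ideal.span_singleton_eq_top] at h
    exact isUnit_iff_dvd_one.2 (dvd_of_algebraMap_dvd_algebraMap hfix
      (by rw [map_one]; exact isUnit_iff_dvd_one.1 h))
  have hnQ : algebraMap R S n ∈ Q :=
    Ideal.pow_le_self two_ne_zero (hn ▸ Ideal.mem_span_singleton_self _)
  by_cases hirr : Irreducible n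
  · right
    have hmax := PrincipalIdealRing.isMaximal_of_irreducible hirr
    have hcomap : Ideal.span {n} = Q.comap (algebraMap R S) :=
      hmax.eq_of_le (hQ.comap (algebraMap R S)).ne_top
        ((Ideal.span_singleton_le_iff_mem _).2 hnQ)
    have hmem : ∀ z ∈ Q, σ z = z → z ∈ Q ^ 2 := by
      intro z hz h
      obtain ⟨r, rfl⟩ := hfix z h
      have : r ∈ Q.comap (algebraMap R S) := hz
      rw [← hcomap, Ideal.mem_span_singleton] at this
      rw [hn, Ideal.mem_span_singleton]
      exact map_dvd _ this
    have hle : Ideal.span {2 * θ} * Q ≤ Q ^ 2 := by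
      rw [Ideal.span_singleton_mul_le_iff]
      intro z hz
      have hσz := Ideal.apply_mem_of_map_eq_self hmap hz
      have h1 := hmem (z + σ z) (add_mem hz hσz) (by rw [map_add, hσ, add_comm])
      have h2 := hmem (θ * (z - σ z)) (Q.mul_mem_left θ (sub_mem hz hσz))
        (by rw [map_mul, map_sub, hσ, hθ]; ring)
      have : 2 * θ * z = θ * (z + σ z) + θ * (z - σ z) := by ring
      rw [this]
      exact add_mem ((Q ^ 2).mul_mem_left _ h1) h2
    rw [← Ideal.span_singleton_le_iff_mem, ← Ideal.dvd_iff_le]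
    rw [← Ideal.dvd_iff_le, sq] at hle
    exact (mul_dvd_mul_iff_right hQ0).1 hle
  · left
    have hn0 : n ≠ 0 := by
      rintro rfl
      rw [map_zero, Ideal.span_singleton_zero] at hn
      exact pow_ne_zero 2 hQ0 hn
    have hnu : ¬ IsUnit n := fun h =>
      hQ.ne_top (Q.eq_top_of_isUnit_mem hnQ (h.map (algebraMap R S)))
    rw [irreducible_iff] at hirr
    push Not at hirr
    obtain ⟨a, b, rfl, ha, hb⟩ := hirr hnu
    rw [map_mul, ← Ideal.span_singleton_mul_span_singleton] at hn
    obtain ⟨i, hi, hia⟩ := (dvd_prime_pow hQp 2).1 (Dvd.intro _ hn.symm)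
    rw [associated_iff_eq] at hia
    interval_cases i
    · exact absurd (hunit (by simpa using hia)) ha
    · exact ⟨a, by simpa using hia.symm⟩
    · refine absurd (hunit ?_) hb
      rw [hia] at hn
      exact (mul_eq_left₀ (pow_ne_zero 2 hQ0)).1 hn.symm

theorem Ideal.exists_eq_span_mul_prod {ι : Type*} [DecidableEq ι] (hσ : ∀ z, σ (σ z) = z)
    (hfix : ∀ z, σ z = z → ∃ r, algebraMap R S r = z) {θ : S} (hθ : σ θ = -θ)
    {H : ι → Ideal S} {ϖ : ι → R} (hH : ∀ i, H i ^ 2 = Ideal.span {algebraMap R S (ϖ i)})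
    (hQ : ∀ Q : Ideal S, Q.IsPrime → 2 * θ ∈ Q → ∃ i, Q = H i)
    (J : Ideal S) (hJ : J.map σ = J) (hJ0 : J ≠ ⊥) :
    ∃ (m : R) (s : Finset ι), J = Ideal.span {algebraMap R S m} * ∏ i ∈ s, H i := by
  induction J using WellFoundedGT.induction with
  | ind J ih =>
  by_cases htop : J = ⊤
  · exact ⟨1, ∅, by simp [htop]⟩
  obtain ⟨Q, hQmax, hJQ⟩ := Ideal.exists_le_maximal J htop
  have hQ0 : Q ≠ ⊥ := fun h => hJ0 (le_bot_iff.1 (h ▸ hJQ))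
  have hQp : Prime Q := Ideal.prime_of_isPrime hQ0 hQmax.isPrime
  have step : ∀ A B : Ideal S, A ≤ Q → A.map σ = A → J = A * B →
      ∃ (m : R) (s : Finset ι), B = Ideal.span {algebraMap R S m} * ∏ i ∈ s, H i := by
    intro A B hA hAσ hAB
    have hA0 : A ≠ 0 := by rintro rfl; exact hJ0 (by simpa using hAB)
    have hB0 : B ≠ 0 := by rintro rfl; exact hJ0 (by simpa using hAB)
    refine ih B ?_ ?_ hB0
    · refine lt_of_le_of_ne (hAB ▸ Ideal.mul_le_right) fun h => ?_
      rw [h] at hAB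
      have : A = 1 := (mul_eq_right₀ hB0).1 hAB.symm
      rw [this, Ideal.one_eq_top] at hA
      exact hQmax.ne_top (top_le_iff.1 hA)
    · have := hJ
      rw [hAB, Ideal.map_mul, hAσ] at this
      exact mul_left_cancel₀ hA0 this
  by_cases hQσ : Q.map σ = Q
  · obtain ⟨B, hB⟩ := Ideal.dvd_iff_le.2 hJQ
    obtain ⟨m, s, hms⟩ := step Q B le_rfl hQσ hB
    rcases Ideal.eq_span_or_mem_of_map_eq_self hσ hfix hθ hQmax.isPrime hQ0 hQσ with ⟨a, ha⟩ | h
    · refine ⟨a * m, s, ?_⟩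
      rw [hB, hms, ha, map_mul, ← Ideal.span_singleton_mul_span_singleton, mul_assoc]
    · obtain ⟨j, rfl⟩ := hQ Q hQmax.isPrime h
      by_cases hj : j ∈ s
      · refine ⟨ϖ j * m, s.erase j, ?_⟩
        rw [hB, hms, map_mul, ← Ideal.span_singleton_mul_span_singleton, ← hH,
          ← Finset.mul_prod_erase s H hj]
        ring
      · refine ⟨m, insert j s, ?_⟩
        rw [hB, hms, Finset.prod_insert hj]
        ring
  · have hQσp : (Q.map σ).IsPrime := by
      have := hQmax.isPrime
      exact Ideal.map_isPrime_of_equiv σ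
    have hQσ0 : Q.map σ ≠ ⊥ := by
      intro h
      rw [Ideal.map_eq_bot_iff_of_injective σ.injective] at h
      exact hQ0 h
    have hdvd : Q * Q.map σ ∣ J := by
      refine IsCoprime.mul_dvd ?_ (Ideal.dvd_iff_le.2 hJQ)
        (Ideal.dvd_iff_le.2 (hJ ▸ Ideal.map_mono hJQ))
      rw [Ideal.isCoprime_iff_sup_eq]
      exact hQmax.coprime_of_ne (hQσp.isMaximal hQσ0) (Ne.symm hQσ)
    obtain ⟨B, hB⟩ := hdvd
    obtain ⟨m, s, hms⟩ := step (Q * Q.map σ) B Ideal.mul_le_left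
      (by rw [Ideal.map_mul, Ideal.map_map_of_involutive hσ, mul_comm]) hB
    obtain ⟨n, hn⟩ := Ideal.exists_mul_map_eq_span hσ hfix Q
    refine ⟨n * m, s, ?_⟩
    rw [hB, hms, hn, map_mul, ← Ideal.span_singleton_mul_span_singleton, mul_assoc]

omit [IsPrincipalIdealRing R] in
theorem exists_unit_mul_eq_of_span_eq (hfix : ∀ z, σ z = z → ∃ r, algebraMap R S r = z)
    {a b : R} (h : Ideal.span {algebraMap R S a} = Ideal.span {algebraMap R S b}) :
    ∃ u : R, IsUnit u ∧ a = u * b := by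
  rw [Ideal.span_singleton_eq_span_singleton] at h
  have h1 := dvd_of_algebraMap_dvd_algebraMap hfix h.dvd
  have h2 := dvd_of_algebraMap_dvd_algebraMap hfix h.symm.dvd
  have := (FaithfulSMul.algebraMap_injective R S).isDomain
  obtain ⟨u, hu⟩ := (associated_of_dvd_dvd h1 h2).symm
  exact ⟨u, u.isUnit, by rw [← hu, mul_comm]⟩

omit [IsPrincipalIdealRing R] [FaithfulSMul R S] in
theorem exists_algebraMap_eq_mul_apply (hσ : ∀ z, σ (σ z) = z)
    (hfix : ∀ z, σ z = z → ∃ r, algebraMap R S r = z) {x : S} (hx : x ≠ 0) :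
    ∃ a : R, a ≠ 0 ∧ algebraMap R S a = x * σ x := by
  obtain ⟨a, ha⟩ := hfix (x * σ x) (by rw [map_mul, hσ, mul_comm])
  refine ⟨a, ?_, ha⟩
  rintro rfl
  rw [map_zero] at ha
  exact mul_ne_zero hx (by simpa using hx) ha.symm

omit [IsPrincipalIdealRing R] [IsDedekindDomain S] [FaithfulSMul R S] in
theorem Ideal.map_span_singleton_apply (x : S) :
    (Ideal.span {x}).map σ = Ideal.span {σ x} := by
  rw [Ideal.map_span, Set.image_singleton]

omit [FaithfulSMul R S] in
theorem Ideal.exists_mul_map_eq_span_ne_zero (hσ : ∀ z, σ (σ z) = z)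
    (hfix : ∀ z, σ z = z → ∃ r, algebraMap R S r = z) {I : Ideal S} (hI : I ≠ ⊥) :
    ∃ n : R, n ≠ 0 ∧ I * I.map σ = Ideal.span {algebraMap R S n} := by
  obtain ⟨n, hn⟩ := Ideal.exists_mul_map_eq_span hσ hfix I
  refine ⟨n, ?_, hn⟩
  rintro rfl
  rw [map_zero, Ideal.span_singleton_zero, Ideal.mul_eq_bot] at hn
  rcases hn with h | h
  · exact hI h
  · rw [Ideal.map_eq_bot_iff_of_injective σ.injective] at h
    exact hI h

theorem Ideal.exists_span_mul_map_eq_self (hσ : ∀ z, σ (σ z) = z)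
    (hfix : ∀ z, σ z = z → ∃ r, algebraMap R S r = z) {ι : R} (hι : ι ^ 2 = -1)
    (hN : ∀ (z : S) (u C : R), IsUnit u → C ≠ 0 → z * σ z = algebraMap R S (u * C ^ 2) →
      u ^ 2 = 1)
    {I : Ideal S} (hI : I ≠ ⊥) {x y : S} (hx : x ≠ 0) (hy : y ≠ 0)
    (hxy : Ideal.span {x} * I = Ideal.span {y} * I.map σ) :
    ∃ γ : S, γ ≠ 0 ∧ (Ideal.span {γ} * I).map σ = Ideal.span {γ} * I := by
  have := (FaithfulSMul.algebraMap_injective R S).isDomain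
  obtain ⟨n, hn0, hn⟩ := Ideal.exists_mul_map_eq_span_ne_zero hσ hfix hI
  obtain ⟨a, ha0, ha⟩ := exists_algebraMap_eq_mul_apply hσ hfix hx
  obtain ⟨b, hb0, hb⟩ := exists_algebraMap_eq_mul_apply hσ hfix hy
  have hnn : Ideal.span {algebraMap R S n} ≠ 0 := by
    simpa [Ideal.span_singleton_eq_bot] using hn0
  have hxy' := congrArg (Ideal.map σ) hxy
  rw [Ideal.map_mul, Ideal.map_mul, Ideal.map_map_of_involutive hσ,
    Ideal.map_span_singleton_apply, Ideal.map_span_singleton_apply] at hxy'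
  have hspan : Ideal.span {algebraMap R S b} = Ideal.span {algebraMap R S a} := by
    refine mul_right_cancel₀ hnn ?_
    rw [ha, hb, ← hn, ← Ideal.span_singleton_mul_span_singleton,
      ← Ideal.span_singleton_mul_span_singleton]
    calc Ideal.span {y} * Ideal.span {σ y} * (I * I.map σ)
        = (Ideal.span {y} * I.map σ) * (Ideal.span {σ y} * I) := by ring
      _ = (Ideal.span {x} * I) * (Ideal.span {σ x} * I.map σ) := by rw [hxy, hxy']
      _ = _ := by ring
  obtain ⟨u, hu, hbu⟩ := exists_unit_mul_eq_of_span_eq hfix hspan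
  have hu1 := hN (y * σ x) u a hu ha0 (by
    rw [map_mul, hσ, map_mul, map_pow, ha]
    have : y * σ y = algebraMap R S u * (x * σ x) := by rw [← hb, hbu, map_mul, ha]
    linear_combination x * σ x * this)
  have key : ∀ y : S, y * σ y = x * σ x → Ideal.span {x} * I = Ideal.span {y} * I.map σ →
      ∃ γ : S, γ ≠ 0 ∧ (Ideal.span {γ} * I).map σ = Ideal.span {γ} * I := by
    intro y hy hxy
    by_cases h0 : x + y = 0
    · refine ⟨1, one_ne_zero, ?_⟩
      have : Ideal.span {y} = Ideal.span {x} := by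
        rw [← neg_eq_of_add_eq_zero_right h0, Ideal.span_singleton_neg]
      rw [this] at hxy
      rw [Ideal.span_singleton_one, Ideal.top_mul]
      exact (mul_left_cancel₀ (by simpa [Ideal.span_singleton_eq_bot] using hx) hxy).symm
    · have h1 : σ x + σ y ≠ 0 := by
        rw [← map_add]
        exact (map_ne_zero_iff σ σ.injective).2 h0
      refine ⟨x * (σ x + σ y), mul_ne_zero hx h1, ?_⟩
      have h2 : σ (x * (σ x + σ y)) = y * (σ x + σ y) := by
        rw [map_mul, map_add, hσ, hσ]
        linear_combination -hy
      rw [Ideal.map_mul, Ideal.map_span_singleton_apply, h2,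
        ← Ideal.span_singleton_mul_span_singleton, ← Ideal.span_singleton_mul_span_singleton,
        mul_right_comm, ← hxy, mul_right_comm]
  rcases sq_eq_one_iff.1 hu1 with rfl | rfl
  · exact key y (by rw [← hb, hbu, one_mul, ha]) hxy
  · refine key (algebraMap R S ι * y) ?_ ?_
    · have h1 : algebraMap R S ι ^ 2 = -1 := by rw [← map_pow, hι, map_neg, map_one]
      have h2 : y * σ y = -(x * σ x) := by
        rw [← hb, hbu, map_mul, ha, map_neg, map_one, neg_one_mul]
      rw [map_mul, AlgEquiv.commutes]
      linear_combination algebraMap R S ι ^ 2 * h2 - x * σ x * h1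
    · rw [hxy, Ideal.span_singleton_mul_left_unit]
      refine IsUnit.map _ (IsUnit.of_mul_eq_one (-ι) ?_)
      linear_combination -hι

end Involution

theorem ClassGroup.mk0_eq_prod_of_eq_span_mul_prod {ι : Type*} {S : Type*} [CommRing S]
    [IsDedekindDomain S] {H : ι → Ideal S} (hH0 : ∀ i, H i ≠ 0) {J : Ideal S}
    (hJ : J ≠ 0) {m : S} {s : Finset ι} (hJs : J = Ideal.span {m} * ∏ i ∈ s, H i) :
    ClassGroup.mk0 ⟨J, mem_nonZeroDivisors_of_ne_zero hJ⟩ =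
      ∏ i ∈ s, ClassGroup.mk0 ⟨H i, mem_nonZeroDivisors_of_ne_zero (hH0 i)⟩ := by
  rw [← map_prod, ClassGroup.mk0_eq_mk0_iff]
  have hm : m ≠ 0 := by
    rintro rfl
    rw [Ideal.span_singleton_zero, Ideal.bot_mul] at hJs
    exact hJ hJs
  refine ⟨1, m, one_ne_zero, hm, ?_⟩
  rw [Ideal.span_singleton_one, Ideal.top_mul, Submonoid.coe_finsetProd]
  exact hJs

theorem Ideal.prod_mul_prod_eq_span_mul_prod_symmDiff {ι : Type*} [DecidableEq ι] {R S : Type*}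
    [CommRing R] [CommRing S] [Algebra R S] {H : ι → Ideal S} {ϖ : ι → R}
    (hH : ∀ i, H i ^ 2 = Ideal.span {algebraMap R S (ϖ i)}) (s t : Finset ι) :
    (∏ i ∈ s, H i) * ∏ i ∈ t, H i =
      Ideal.span {algebraMap R S (∏ i ∈ s ∩ t, ϖ i)} * ∏ i ∈ symmDiff s t, H i := by
  have hd : Disjoint (symmDiff s t) (s ∩ t) := by
    simpa using disjoint_symmDiff_inf s t
  have hu : s ∪ t = (symmDiff s t).disjUnion (s ∩ t) hd := by
    rw [Finset.disjUnion_eq_union]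
    simpa using (symmDiff_sup_inf s t).symm
  rw [← Finset.prod_union_inter, hu, Finset.prod_disjUnion, mul_assoc, ← Finset.prod_mul_distrib,
    map_prod, ← Ideal.prod_span_singleton, mul_comm]
  simp_rw [← sq, hH]

section Involution

variable {R S : Type*} [CommRing R] [CommRing S] [Algebra R S] {σ : S ≃ₐ[R] S}
  [IsPrincipalIdealRing R] [IsDedekindDomain S] [FaithfulSMul R S]
  {ι : Type*} [DecidableEq ι] {H : ι → Ideal S} {ϖ : ι → R} {T : Finset ι} {I : R} {θ : S}

theorem ClassGroup.exists_eq_prod_of_sq_eq_one (hσ : ∀ z, σ (σ z) = z)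
    (hfix : ∀ z, σ z = z → ∃ r, algebraMap R S r = z) (hI : I ^ 2 = -1)
    (hN : ∀ (z : S) (u C : R) (s : Finset ι), s ⊆ T → IsUnit u → C ≠ 0 →
      z * σ z = algebraMap R S (u * (∏ i ∈ s, ϖ i) * C ^ 2) → s = ∅ ∧ u ^ 2 = 1)
    (hθ : σ θ = -θ) (hH : ∀ i, H i ^ 2 = Ideal.span {algebraMap R S (ϖ i)})
    (hH0 : ∀ i, H i ≠ 0) (hQ : ∀ Q : Ideal S, Q.IsPrime → 2 * θ ∈ Q → ∃ i, Q = H i)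
    {c : ClassGroup S} (hc : c ^ 2 = 1) :
    ∃ s : Finset ι, c = ∏ i ∈ s, ClassGroup.mk0 ⟨H i, mem_nonZeroDivisors_of_ne_zero (hH0 i)⟩ := by
  obtain ⟨⟨J, hJ⟩, rfl⟩ := ClassGroup.mk0_surjective c
  have hJ0 : J ≠ ⊥ := nonZeroDivisors.ne_zero hJ
  have hJσ : J.map σ ≠ 0 := by
    rw [Ne, Ideal.zero_eq_bot, Ideal.map_eq_bot_iff_of_injective σ.injective]
    exact hJ0
  obtain ⟨n, hn0, hn⟩ := Ideal.exists_mul_map_eq_span_ne_zero hσ hfix hJ0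
  have h1 : ClassGroup.mk0 ⟨J, hJ⟩ *
      ClassGroup.mk0 ⟨J.map σ, mem_nonZeroDivisors_of_ne_zero hJσ⟩ = 1 := by
    rw [← map_mul, ClassGroup.mk0_eq_one_iff]
    change (J * J.map σ).IsPrincipal
    rw [hn]
    exact ⟨_, rfl⟩
  rw [sq] at hc
  obtain ⟨x, y, hx, hy, hxy⟩ := (ClassGroup.mk0_eq_mk0_iff (R := S)).1
    (mul_left_cancel (hc.trans h1.symm))
  obtain ⟨γ, hγ, hinv⟩ := Ideal.exists_span_mul_map_eq_self hσ hfix hI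
    (fun z u C hu hC h => (hN z u C ∅ (Finset.empty_subset _) hu hC (by simpa using h)).2)
    hJ0 hx hy hxy
  have hγJ : Ideal.span {γ} * J ≠ 0 :=
    mul_ne_zero (by simpa [Ideal.span_singleton_eq_bot] using hγ) hJ0
  obtain ⟨m, s, hms⟩ := Ideal.exists_eq_span_mul_prod hσ hfix hθ hH hQ _ hinv hγJ
  refine ⟨s, ?_⟩
  rw [← ClassGroup.mk0_eq_prod_of_eq_span_mul_prod hH0 hγJ hms, ClassGroup.mk0_eq_mk0_iff]
  exact ⟨γ, 1, hγ, one_ne_zero, by rw [Ideal.span_singleton_one, Ideal.top_mul]⟩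

omit [IsPrincipalIdealRing R] [IsDedekindDomain S] [FaithfulSMul R S] [DecidableEq ι] in
theorem Ideal.map_prod_eq_self {s : Finset ι} (hHσ : ∀ i, (H i).map σ = H i) :
    (∏ i ∈ s, H i).map σ = ∏ i ∈ s, H i := by
  have := map_prod (Ideal.mapHom (σ : S →+* S)) H s
  exact this.trans (Finset.prod_congr rfl fun i _ => hHσ i)

omit [DecidableEq ι] in
theorem eq_empty_of_sq_eq_prod (hσ : ∀ z, σ (σ z) = z)
    (hfix : ∀ z, σ z = z → ∃ r, algebraMap R S r = z)
    (hN : ∀ (z : S) (u C : R) (s : Finset ι), s ⊆ T → IsUnit u → C ≠ 0 →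
      z * σ z = algebraMap R S (u * (∏ i ∈ s, ϖ i) * C ^ 2) → s = ∅ ∧ u ^ 2 = 1)
    (hH : ∀ i, H i ^ 2 = Ideal.span {algebraMap R S (ϖ i)})
    (hHσ : ∀ i, (H i).map σ = H i)
    (hH0 : ∀ i, H i ≠ 0) {c : ClassGroup S} {s : Finset ι} (hs : s ⊆ T)
    (hc : c ^ 2 = ∏ i ∈ s, ClassGroup.mk0 ⟨H i, mem_nonZeroDivisors_of_ne_zero (hH0 i)⟩) :
    s = ∅ := by
  have := (FaithfulSMul.algebraMap_injective R S).isDomain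
  obtain ⟨⟨J, hJ⟩, rfl⟩ := ClassGroup.mk0_surjective c
  have hJ0 : J ≠ ⊥ := nonZeroDivisors.ne_zero hJ
  obtain ⟨n, hn0, hn⟩ := Ideal.exists_mul_map_eq_span_ne_zero hσ hfix hJ0
  rw [← map_pow, ← map_prod, ClassGroup.mk0_eq_mk0_iff, Submonoid.coe_finsetProd] at hc
  obtain ⟨x, y, hx, hy, hxy⟩ := hc
  change Ideal.span {x} * J ^ 2 = Ideal.span {y} * ∏ i ∈ s, H i at hxy
  have hxy' := congrArg (Ideal.map σ) hxy
  rw [Ideal.map_mul, Ideal.map_mul, Ideal.map_pow, Ideal.map_prod_eq_self hHσ,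
    Ideal.map_span_singleton_apply, Ideal.map_span_singleton_apply] at hxy'
  obtain ⟨a, ha0, ha⟩ := exists_algebraMap_eq_mul_apply hσ hfix hx
  obtain ⟨b, hb0, hb⟩ := exists_algebraMap_eq_mul_apply hσ hfix hy
  have hspan : Ideal.span {algebraMap R S (b * ∏ i ∈ s, ϖ i)} =
      Ideal.span {algebraMap R S (a * n ^ 2)} := by
    rw [map_mul, map_mul, map_prod, map_pow, ← Ideal.span_singleton_mul_span_singleton,
      ← Ideal.span_singleton_mul_span_singleton, ← Ideal.prod_span_singleton,
      ← Ideal.span_singleton_pow, ← hn, ha, hb, ← Ideal.span_singleton_mul_span_singleton,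
      ← Ideal.span_singleton_mul_span_singleton]
    simp_rw [← hH]
    rw [Finset.prod_pow]
    calc _ = (Ideal.span {y} * ∏ i ∈ s, H i) * (Ideal.span {σ y} * ∏ i ∈ s, H i) := by ring
      _ = (Ideal.span {x} * J ^ 2) * (Ideal.span {σ x} * J.map σ ^ 2) := by rw [hxy, hxy']
      _ = _ := by ring
  obtain ⟨u, hu, hbu⟩ := exists_unit_mul_eq_of_span_eq hfix hspan
  refine (hN (y * algebraMap R S (∏ i ∈ s, ϖ i) * σ x) u (a * n) s hs hu (mul_ne_zero ha0 hn0) ?_).1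
  simp only [map_mul, map_pow, hσ, AlgEquiv.commutes] at hbu ⊢
  have hbu' := congrArg (algebraMap R S) hbu
  simp only [map_mul, map_pow, ha, hb] at hbu' ⊢
  linear_combination x * σ x * algebraMap R S (∏ i ∈ s, ϖ i) * hbu'

omit [IsPrincipalIdealRing R] [DecidableEq ι] in
theorem exists_eq_or_neg_sq_of_span_eq (hσ : ∀ z, σ (σ z) = z)
    (hfix : ∀ z, σ z = z → ∃ r, algebraMap R S r = z)
    (hN : ∀ (z : S) (u C : R) (s : Finset ι), s ⊆ T → IsUnit u → C ≠ 0 →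
      z * σ z = algebraMap R S (u * (∏ i ∈ s, ϖ i) * C ^ 2) → s = ∅ ∧ u ^ 2 = 1)
    (hH : ∀ i, H i ^ 2 = Ideal.span {algebraMap R S (ϖ i)})
    (hHσ : ∀ i, (H i).map σ = H i) {s : Finset ι} (hs : s ⊆ T) {β η ε : S} {m : R} (hβ : β ≠ 0)
    (hβm : Ideal.span {β} = Ideal.span {algebraMap R S m} * ∏ i ∈ s, H i)
    (hε : ε ^ 2 = 1) (hη : η * σ β = ε * β) :
    ∃ v : S, IsUnit v ∧ (η = v ^ 2 ∨ η = -v ^ 2) := by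
  have := (FaithfulSMul.algebraMap_injective R S).isDomain
  obtain ⟨b, hb0, hb⟩ := exists_algebraMap_eq_mul_apply hσ hfix hβ
  have hm : m ≠ 0 := by
    rintro rfl
    rw [map_zero, Ideal.span_singleton_zero, Ideal.bot_mul, Ideal.span_singleton_eq_bot] at hβm
    exact hβ hβm
  have hmS : algebraMap R S m ≠ 0 := by simpa using hm
  have hβm' := congrArg (Ideal.map σ) hβm
  rw [Ideal.map_mul, Ideal.map_prod_eq_self hHσ,
    Ideal.map_span_singleton_apply, Ideal.map_span_singleton_apply, AlgEquiv.commutes] at hβm'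
  have hspan : Ideal.span {algebraMap R S b} =
      Ideal.span {algebraMap R S ((∏ i ∈ s, ϖ i) * m ^ 2)} := by
    rw [hb, map_mul, map_prod, map_pow, ← Ideal.span_singleton_mul_span_singleton,
      ← Ideal.span_singleton_mul_span_singleton, ← Ideal.prod_span_singleton, hβm, hβm',
      ← Ideal.span_singleton_pow]
    simp_rw [← hH]
    rw [Finset.prod_pow]
    ring
  obtain ⟨u, hu, hbu⟩ := exists_unit_mul_eq_of_span_eq hfix hspan
  obtain ⟨rfl, -⟩ := hN β u m s hs hu hm (by rw [← hb, hbu, mul_assoc])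
  rw [Finset.prod_empty, mul_one, Ideal.span_singleton_eq_span_singleton] at hβm
  obtain ⟨v, rfl⟩ := hβm.symm
  obtain ⟨r, hr0, hr⟩ := exists_algebraMap_eq_mul_apply hσ hfix v.ne_zero
  have hru : IsUnit r := by
    have h1 : IsUnit (algebraMap R S r) := hr ▸ v.isUnit.mul (v.isUnit.map σ)
    refine isUnit_iff_dvd_one.2 (dvd_of_algebraMap_dvd_algebraMap hfix ?_)
    rw [map_one]
    exact isUnit_iff_dvd_one.1 h1
  have hr1 := (hN v r 1 ∅ (Finset.empty_subset _) hru one_ne_zero (by simp [← hr])).2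
  refine ⟨v, v.isUnit, sq_eq_sq_iff_eq_or_eq_neg.1 ?_⟩
  have h2 : η * σ v = ε * v := by
    rw [map_mul, AlgEquiv.commutes] at hη
    exact mul_left_cancel₀ hmS (by linear_combination hη)
  have h3 : (v * σ v : S) ^ 2 = 1 := by rw [← hr, ← map_pow, hr1, map_one]
  have h4 : η * (v * σ v) = ε * v ^ 2 := by linear_combination v * h2
  linear_combination (-η ^ 2) * h3 + (η * (v * σ v) + ε * v ^ 2) * h4 + v ^ 4 * hε

theorem exists_prod_eq_one_of_unit (hσ : ∀ z, σ (σ z) = z)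
    (hfix : ∀ z, σ z = z → ∃ r, algebraMap R S r = z) (hI : I ^ 2 = -1)
    (hN : ∀ (z : S) (u C : R) (s : Finset ι), s ⊆ T → IsUnit u → C ≠ 0 →
      z * σ z = algebraMap R S (u * (∏ i ∈ s, ϖ i) * C ^ 2) → s = ∅ ∧ u ^ 2 = 1)
    (hθ : σ θ = -θ) (hH : ∀ i, H i ^ 2 = Ideal.span {algebraMap R S (ϖ i)})
    (hHσ : ∀ i, (H i).map σ = H i)
    (hH0 : ∀ i, H i ≠ 0) (hQ : ∀ Q : Ideal S, Q.IsPrime → 2 * θ ∈ Q → ∃ i, Q = H i)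
    (hθ0 : θ ≠ 0) {U : Finset ι} (hθU : Ideal.span {θ} = ∏ i ∈ U, H i) {ω : S} (hω : IsUnit ω)
    (hω' : ∀ v ε : S, ε ^ 4 = 1 → ω ≠ ε * v ^ 2) :
    ∃ s : Finset ι, ¬ s ⊆ T ∧ ¬ symmDiff s U ⊆ T ∧
      ∏ i ∈ s, ClassGroup.mk0 ⟨H i, mem_nonZeroDivisors_of_ne_zero (hH0 i)⟩ = 1 := by
  have := (FaithfulSMul.algebraMap_injective R S).isDomain
  obtain ⟨r, hr0, hr⟩ := exists_algebraMap_eq_mul_apply hσ hfix hω.ne_zero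
  have hru : IsUnit r := by
    have h1 : IsUnit (algebraMap R S r) := hr ▸ hω.mul (hω.map σ)
    refine isUnit_iff_dvd_one.2 (dvd_of_algebraMap_dvd_algebraMap hfix ?_)
    rw [map_one]
    exact isUnit_iff_dvd_one.1 h1
  have hr1 := (hN ω r 1 ∅ (Finset.empty_subset _) hru one_ne_zero (by simp [← hr])).2
  have hIS : algebraMap R S I ^ 2 = -1 := by rw [← map_pow, hI, map_neg, map_one]
  obtain ⟨η, hη, hη'⟩ : ∃ η : S, η * σ η = 1 ∧ ∀ v ε : S, ε ^ 4 = 1 → η ≠ ε * v ^ 2 := by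
    rcases sq_eq_one_iff.1 hr1 with rfl | rfl
    · exact ⟨ω, by rw [← hr, map_one], hω'⟩
    · refine ⟨algebraMap R S I * ω, ?_, fun v ε hε h => hω' v (-algebraMap R S I * ε) ?_ ?_⟩
      · rw [map_mul, AlgEquiv.commutes]
        rw [map_neg, map_one] at hr
        linear_combination ω * σ ω * hIS + hr
      · linear_combination (algebraMap R S I ^ 2 - 1) * hIS * ε ^ 4 + hε
      · linear_combination -algebraMap R S I * h + ω * hIS
  have hβ0 : 1 + η ≠ 0 := fun h => hη' 1 (-1) (by ring) (by linear_combination h)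
  have hηβ : η * σ (1 + η) = 1 * (1 + η) := by
    rw [map_add, map_one]
    linear_combination hη
  have hηu : IsUnit η := IsUnit.of_mul_eq_one _ hη
  have hinv : (Ideal.span {1 + η}).map σ = Ideal.span {1 + η} := by
    rw [Ideal.map_span_singleton_apply, ← Ideal.span_singleton_mul_left_unit hηu, hηβ, one_mul]
  have hspan0 : Ideal.span {1 + η} ≠ 0 := by
    simpa [Ideal.span_singleton_eq_bot] using hβ0
  obtain ⟨m, s, hms⟩ := Ideal.exists_eq_span_mul_prod hσ hfix hθ hH hQ _ hinv hspan0
  have hcontra : ¬ ∃ v : S, IsUnit v ∧ (η = v ^ 2 ∨ η = -v ^ 2) := by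
    rintro ⟨v, -, h | h⟩
    · exact hη' v 1 (by ring) (by rw [h, one_mul])
    · exact hη' v (-1) (by ring) (by rw [h, neg_one_mul])
  refine ⟨s, fun hs => hcontra ?_, fun hs => hcontra ?_, ?_⟩
  · exact exists_eq_or_neg_sq_of_span_eq hσ hfix hN hH hHσ hs hβ0 hms (one_pow 2) hηβ
  · refine exists_eq_or_neg_sq_of_span_eq hσ hfix hN hH hHσ hs (β := (1 + η) * θ) (ε := -1)
      (m := m * ∏ i ∈ s ∩ U, ϖ i) (mul_ne_zero hβ0 hθ0) ?_ (by ring) ?_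
    · rw [← Ideal.span_singleton_mul_span_singleton, hms, hθU, mul_assoc,
        Ideal.prod_mul_prod_eq_span_mul_prod_symmDiff hH, map_mul,
        ← Ideal.span_singleton_mul_span_singleton, mul_assoc]
    · rw [map_mul, hθ]
      linear_combination -θ * hηβ
  · rw [← ClassGroup.mk0_eq_prod_of_eq_span_mul_prod hH0 hspan0 hms, ClassGroup.mk0_eq_one_iff]
    exact ⟨_, rfl⟩

end Involution

/-- The homomorphism `(ℤ/2)³ → G` determined by three elements of order dividing `2`. -/
noncomputable def zmodTwoPowThreeHom {A : Type*} [AddCommGroup A] {a b c : A}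
    (ha : 2 • a = 0) (hb : 2 • b = 0) (hc : 2 • c = 0) : ZMod 2 × ZMod 2 × ZMod 2 →+ A :=
  (ZMod.lift 2 ⟨zmultiplesHom A a, by simpa [two_zsmul, two_nsmul] using ha⟩).coprod
    ((ZMod.lift 2 ⟨zmultiplesHom A b, by simpa [two_zsmul, two_nsmul] using hb⟩).coprod
      (ZMod.lift 2 ⟨zmultiplesHom A c, by simpa [two_zsmul, two_nsmul] using hc⟩))

theorem zmodTwoPowThreeHom_apply_natCast {A : Type*} [AddCommGroup A] {a b c : A}
    (ha : 2 • a = 0) (hb : 2 • b = 0) (hc : 2 • c = 0) (i j k : ℕ) :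
    zmodTwoPowThreeHom ha hb hc (i, j, k) = i • a + (j • b + k • c) := by
  have h (x : A) (hx) (n : ℕ) : ZMod.lift 2 ⟨zmultiplesHom A x, hx⟩ (n : ZMod 2) = n • x := by
    have h1 := ZMod.lift_coe 2 ⟨zmultiplesHom A x, hx⟩ n
    rw [Int.cast_natCast] at h1
    simpa using h1
  simp only [zmodTwoPowThreeHom, AddMonoidHom.coprod_apply, h]

theorem Subgroup.nonempty_addEquiv_closure_triple {G : Type*} [CommGroup G] {a b c : G}
    (ha : a ^ 2 = 1) (hb : b ^ 2 = 1) (hc : c ^ 2 = 1)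
    (hind : ∀ i < 2, ∀ j < 2, ∀ k < 2, a ^ i * (b ^ j * c ^ k) = 1 → i = 0 ∧ j = 0 ∧ k = 0) :
    Nonempty (Additive (Subgroup.closure {a, b, c}) ≃+ (ZMod 2 × ZMod 2 × ZMod 2)) := by
  set K := Subgroup.closure {a, b, c}
  have haK : a ∈ K := Subgroup.subset_closure (by simp)
  have hbK : b ∈ K := Subgroup.subset_closure (by simp)
  have hcK : c ∈ K := Subgroup.subset_closure (by simp)
  let f : ZMod 2 × ZMod 2 × ZMod 2 →+ Additive K :=
    zmodTwoPowThreeHom (a := Additive.ofMul (⟨a, haK⟩ : K)) (b := Additive.ofMul (⟨b, hbK⟩ : K))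
      (c := Additive.ofMul (⟨c, hcK⟩ : K)) (Subtype.ext ha) (Subtype.ext hb) (Subtype.ext hc)
  have hf : ∀ i j k : ℕ, ((f (i, j, k)).toMul : G) = a ^ i * (b ^ j * c ^ k) := by
    intro i j k
    exact congrArg (fun y : Additive K => (y.toMul : G))
      (zmodTwoPowThreeHom_apply_natCast (A := Additive K) _ _ _ i j k)
  refine ⟨(AddEquiv.ofBijective f ⟨?_, ?_⟩).symm⟩
  · rw [injective_iff_map_eq_zero]
    rintro ⟨i, j, k⟩ h
    have h1 := hf i.val j.val k.val
    rw [ZMod.natCast_zmod_val, ZMod.natCast_zmod_val, ZMod.natCast_zmod_val, h] at h1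
    obtain ⟨h2, h3, h4⟩ := hind _ i.val_lt _ j.val_lt _ k.val_lt h1.symm
    rw [ZMod.val_eq_zero] at h2 h3 h4
    rw [h2, h3, h4]
    rfl
  · intro y
    suffices h : ∀ g (hg : g ∈ K), ∃ x, f x = Additive.ofMul (⟨g, hg⟩ : K) from h _ y.toMul.2
    intro g hg
    induction hg using Subgroup.closure_induction with
    | mem g hg =>
      rcases hg with rfl | rfl | rfl
      · exact ⟨((1 : ℕ), (0 : ℕ), (0 : ℕ)), Subtype.ext ((hf 1 0 0).trans (by simp; rfl))⟩
      · exact ⟨((0 : ℕ), (1 : ℕ), (0 : ℕ)), Subtype.ext ((hf 0 1 0).trans (by simp; rfl))⟩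
      · exact ⟨((0 : ℕ), (0 : ℕ), (1 : ℕ)), Subtype.ext ((hf 0 0 1).trans (by simp; rfl))⟩
    | one => exact ⟨0, map_zero f⟩
    | mul g₁ g₂ _ _ h₁ h₂ =>
      obtain ⟨x₁, h₁⟩ := h₁
      obtain ⟨x₂, h₂⟩ := h₂
      exact ⟨x₁ + x₂, by rw [map_add, h₁, h₂]; rfl⟩
    | inv g _ h =>
      obtain ⟨x, h⟩ := h
      exact ⟨-x, by rw [map_neg, h]; rfl⟩

theorem Sylow.eq_closure_triple {G : Type*} [CommGroup G] [Finite G] {a b c : G}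
    (ha : a ^ 2 = 1) (hb : b ^ 2 = 1) (hc : c ^ 2 = 1)
    (htwo : ∀ g : G, g ^ 2 = 1 → g ∈ Subgroup.closure {a, b, c})
    (hsq : ∀ g : G, (g ^ 2) ^ 2 = 1 → g ^ 2 = 1) (P : Sylow 2 G) :
    (P : Subgroup G) = Subgroup.closure {a, b, c} := by
  apply le_antisymm
  · intro g hg
    obtain ⟨n, hn⟩ := P.isPGroup' ⟨g, hg⟩
    replace hn : g ^ 2 ^ n = 1 := congrArg Subtype.val hn
    refine htwo g ?_
    induction n with
    | zero => rw [pow_zero, pow_one] at hn; rw [hn, one_pow]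
    | succ n ih =>
      cases n with
      | zero => exact hn
      | succ n =>
        refine ih ?_
        rw [pow_succ, pow_succ, pow_mul, pow_mul] at hn
        rw [pow_succ, pow_mul]
        exact hsq _ hn
  · have hP : ∀ g : G, g ^ 2 = 1 → g ∈ P := by
      intro g hg
      have h1 : IsPGroup 2 (Subgroup.zpowers g) := by
        rintro ⟨_, n, rfl⟩
        refine ⟨1, Subtype.ext ?_⟩
        change (g ^ n) ^ 2 ^ 1 = 1
        rw [pow_one, ← zpow_natCast, zpow_comm, zpow_natCast, hg, one_zpow]
      have h2 := P.is_maximal' (P.isPGroup'.to_sup_of_normal_right h1) le_sup_left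
      change g ∈ (P : Subgroup G)
      rw [← h2]
      exact (le_sup_right : _ ≤ (P : Subgroup G) ⊔ _) (Subgroup.mem_zpowers g)
    rw [Subgroup.closure_le]
    rintro g (rfl | rfl | rfl)
    exacts [hP _ ha, hP _ hb, hP _ hc]

theorem Finset.prod_symmDiff_of_sq_eq_one {ι G : Type*} [DecidableEq ι] [CommGroup G] {h : ι → G}
    (hsq : ∀ i, h i ^ 2 = 1) (s t : Finset ι) :
    ∏ i ∈ symmDiff s t, h i = (∏ i ∈ s, h i) * ∏ i ∈ t, h i := by
  have hd : Disjoint (symmDiff s t) (s ∩ t) := by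
    simpa using disjoint_symmDiff_inf s t
  have hu : s ∪ t = (symmDiff s t).disjUnion (s ∩ t) hd := by
    rw [Finset.disjUnion_eq_union]
    simpa using (symmDiff_sup_inf s t).symm
  rw [← Finset.prod_union_inter, hu, Finset.prod_disjUnion, mul_assoc, ← Finset.prod_mul_distrib]
  simp_rw [← sq, hsq]
  simp

theorem ClassGroup.sylow_two_of_involution {R S : Type*} [CommRing R] [CommRing S] [Algebra R S]
    {σ : S ≃ₐ[R] S} [IsPrincipalIdealRing R] [IsDedekindDomain S] [FaithfulSMul R S]
    [Finite (ClassGroup S)] {H : Fin 5 → Ideal S} {ϖ : Fin 5 → R} {I : R} {θ : S}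
    (hσ : ∀ z, σ (σ z) = z) (hfix : ∀ z, σ z = z → ∃ r, algebraMap R S r = z) (hI : I ^ 2 = -1)
    (hN : ∀ (z : S) (u C : R) (s : Finset (Fin 5)), s ⊆ {0, 1, 2} → IsUnit u → C ≠ 0 →
      z * σ z = algebraMap R S (u * (∏ i ∈ s, ϖ i) * C ^ 2) → s = ∅ ∧ u ^ 2 = 1)
    (hθ : σ θ = -θ) (hH : ∀ i, H i ^ 2 = Ideal.span {algebraMap R S (ϖ i)})
    (hHσ : ∀ i, (H i).map σ = H i)
    (hH0 : ∀ i, H i ≠ 0) (hQ : ∀ Q : Ideal S, Q.IsPrime → 2 * θ ∈ Q → ∃ i, Q = H i)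
    (hθ0 : θ ≠ 0) (hθU : Ideal.span {θ} = ∏ i ∈ {1, 2, 3, 4}, H i) {ω : S} (hω : IsUnit ω)
    (hω' : ∀ v ε : S, ε ^ 4 = 1 → ω ≠ ε * v ^ 2) (P : Sylow 2 (ClassGroup S)) :
    Nonempty (Additive P ≃+ (ZMod 2 × ZMod 2 × ZMod 2)) ∧
      (P : Subgroup (ClassGroup S)) = Subgroup.closure
        {ClassGroup.mk0 ⟨H 0, mem_nonZeroDivisors_of_ne_zero (hH0 0)⟩,
         ClassGroup.mk0 ⟨H 1, mem_nonZeroDivisors_of_ne_zero (hH0 1)⟩,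
         ClassGroup.mk0 ⟨H 2, mem_nonZeroDivisors_of_ne_zero (hH0 2)⟩} := by
  have htors := fun c : ClassGroup S =>
    ClassGroup.exists_eq_prod_of_sq_eq_one (c := c) hσ hfix hI hN hθ hH hH0 hQ
  have hind := fun (c : ClassGroup S) (s : Finset (Fin 5)) =>
    eq_empty_of_sq_eq_prod (c := c) (s := s) hσ hfix hN hH hHσ hH0
  obtain ⟨s, hs, hsU, hs1⟩ :=
    exists_prod_eq_one_of_unit hσ hfix hI hN hθ hH hHσ hH0 hQ hθ0 hθU hω hω'
  have hU := ClassGroup.mk0_eq_prod_of_eq_span_mul_prod hH0 (m := (1 : S))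
    (s := ({1, 2, 3, 4} : Finset (Fin 5))) (J := Ideal.span {θ})
    (by simpa [Ideal.span_singleton_eq_bot] using hθ0)
    (by rw [Ideal.span_singleton_one, Ideal.top_mul, hθU])
  rw [(ClassGroup.mk0_eq_one_iff _).2 ⟨_, rfl⟩] at hU
  have hsq : ∀ i, ClassGroup.mk0 ⟨H i, mem_nonZeroDivisors_of_ne_zero (hH0 i)⟩ ^ 2 = 1 := by
    intro i
    rw [← map_pow, ClassGroup.mk0_eq_one_iff]
    change (H i ^ 2).IsPrincipal
    rw [hH]
    exact ⟨_, rfl⟩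
  generalize hh : (fun i => ClassGroup.mk0 ⟨H i, mem_nonZeroDivisors_of_ne_zero (hH0 i)⟩) = h
  have hh' : ∀ i, ClassGroup.mk0 ⟨H i, mem_nonZeroDivisors_of_ne_zero (hH0 i)⟩ = h i :=
    fun i => congrFun hh i
  simp only [hh'] at htors hind hs1 hU hsq ⊢
  set K := Subgroup.closure {h 0, h 1, h 2} with hK
  have hT : ∀ i ∈ ({0, 1, 2} : Finset (Fin 5)), h i ∈ K := by
    intro i hi
    refine Subgroup.subset_closure ?_
    simp only [Finset.mem_insert, Finset.mem_singleton] at hi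
    rcases hi with rfl | rfl | rfl <;> simp
  have hext : ∀ (s : Finset (Fin 5)) (j : Fin 5), j ∈ s → ∏ i ∈ s, h i = 1 →
      (∀ i ∈ s.erase j, h i ∈ K) → h j ∈ K := by
    intro s j hj hs hK
    rw [← Finset.mul_prod_erase s h hj] at hs
    rw [eq_inv_of_mul_eq_one_left hs]
    exact K.inv_mem (K.prod_mem hK)
  have h34 : h 3 ∈ K ∧ h 4 ∈ K := by
    have hcases : (3 ∈ s ∧ s.erase 3 ⊆ {0, 1, 2}) ∨ (4 ∈ s ∧ s.erase 4 ⊆ {0, 1, 2}) := by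
      clear hs1
      revert s
      decide
    rcases hcases with ⟨h3, h3'⟩ | ⟨h4, h4'⟩
    · have h3K := hext s 3 h3 hs1 fun i hi => hT i (h3' hi)
      refine ⟨h3K, hext {1, 2, 3, 4} 4 (by decide) hU.symm fun i hi => ?_⟩
      have : i = 3 ∨ i ∈ ({0, 1, 2} : Finset (Fin 5)) := by revert i; decide
      rcases this with rfl | hi
      exacts [h3K, hT i hi]
    · have h4K := hext s 4 h4 hs1 fun i hi => hT i (h4' hi)
      refine ⟨hext {1, 2, 3, 4} 3 (by decide) hU.symm fun i hi => ?_, h4K⟩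
      have : i = 4 ∨ i ∈ ({0, 1, 2} : Finset (Fin 5)) := by revert i; decide
      rcases this with rfl | hi
      exacts [h4K, hT i hi]
  have hall : ∀ i, h i ∈ K := by
    intro i
    have : i = 3 ∨ i = 4 ∨ i ∈ ({0, 1, 2} : Finset (Fin 5)) := by revert i; decide
    rcases this with rfl | rfl | hi
    exacts [h34.1, h34.2, hT i hi]
  have hform : ∀ g ∈ K, ∃ s : Finset (Fin 5), s ⊆ {0, 1, 2} ∧ g = ∏ i ∈ s, h i := by
    intro g hg
    induction hg using Subgroup.closure_induction with
    | mem g hg =>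
      rcases hg with rfl | rfl | rfl
      exacts [⟨{0}, by decide, by simp⟩, ⟨{1}, by decide, by simp⟩, ⟨{2}, by decide, by simp⟩]
    | one => exact ⟨∅, by decide, by simp⟩
    | mul g₁ g₂ _ _ h₁ h₂ =>
      obtain ⟨s₁, hs₁, rfl⟩ := h₁
      obtain ⟨s₂, hs₂, rfl⟩ := h₂
      refine ⟨symmDiff s₁ s₂, ?_, (Finset.prod_symmDiff_of_sq_eq_one hsq _ _).symm⟩
      intro i hi
      rcases Finset.mem_symmDiff.1 hi with hi | hi
      exacts [hs₁ hi.1, hs₂ hi.1]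
    | inv g _ hg =>
      obtain ⟨s, hs, rfl⟩ := hg
      refine ⟨s, hs, ?_⟩
      rw [inv_eq_iff_mul_eq_one, ← sq, ← Finset.prod_pow]
      exact Finset.prod_eq_one fun i _ => hsq i
  have hPK : (P : Subgroup (ClassGroup S)) = K := by
    refine Sylow.eq_closure_triple (hsq 0) (hsq 1) (hsq 2) ?_ ?_ P
    · intro g hg
      obtain ⟨s, rfl⟩ := htors g hg
      exact K.prod_mem fun i _ => hall i
    · intro g hg
      obtain ⟨s, hs⟩ := htors _ hg
      obtain ⟨t, ht, hgt⟩ := hform (g ^ 2) (hs ▸ K.prod_mem fun i _ => hall i)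
      rw [hgt, hind g t ht hgt, Finset.prod_empty]
  refine ⟨?_, hPK⟩
  have := Subgroup.nonempty_addEquiv_closure_triple (hsq 0) (hsq 1) (hsq 2) ?_
  · rw [← hK, ← hPK] at this
    exact this
  · intro i hi j hj k hk hijk
    have h1 := hind 1 (Finset.univ.filter fun t : Fin 5 => (t = 0 ∧ i = 1) ∨ (t = 1 ∧ j = 1) ∨
      (t = 2 ∧ k = 1)) (by intro t; simp; tauto) (by
        rw [one_pow, ← hijk]
        interval_cases i <;> interval_cases j <;> interval_cases k <;>
          simp [Finset.filter_or, Finset.filter_eq', mul_left_comm])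
    have h2 := Finset.eq_empty_iff_forall_notMem.1 h1
    have h3 := h2 0
    have h4 := h2 1
    have h5 := h2 2
    simp at h3 h4 h5
    omega

namespace GaussianInt

theorem one_add_I_dvd_of_sq_add {P : ℕ} (hP : P % 2 = 1) {A B N : GaussianInt}
    (h : A ^ 2 + ⟨0, 1⟩ * P * B ^ 2 = 4 * N) : (⟨1, 1⟩ : GaussianInt) ∣ B := by
  obtain ⟨a, b⟩ := A
  obtain ⟨c, d⟩ := B
  obtain ⟨n, m⟩ := N
  have h1 := congrArg Zsqrtd.im h
  rw [show (4 : GaussianInt) = ⟨4, 0⟩ from rfl] at h1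
  simp [sq] at h1
  have h2 : (c + d) % 2 = 0 := by
    obtain ⟨k, rfl⟩ : ∃ k, P = 2 * k + 1 := ⟨P / 2, by omega⟩
    have h3 : (c + d) * (c - d) = 2 * (2 * m - a * b - k * (c * c - d * d)) := by
      push_cast at h1
      linear_combination h1
    have h4 := Int.Prime.dvd_mul' Nat.prime_two (Dvd.intro _ h3.symm)
    push_cast at h4
    omega
  refine ⟨⟨(c + d) / 2, (d - c) / 2⟩, ?_⟩
  rw [Zsqrtd.ext_iff]
  simp
  omega

theorem not_one_add_I_sq_dvd {P : ℕ} : ¬ (⟨1, 1⟩ : GaussianInt) ^ 2 ∣ 1 + ⟨0, 1⟩ * P := by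
  rintro ⟨⟨a, b⟩, h⟩
  have h1 := congrArg Zsqrtd.re h
  simp [sq] at h1
  omega

end GaussianInt

section GaussianInvolution

variable {S : Type*} [CommRing S] [IsDedekindDomain S] [Algebra GaussianInt S]
  [FaithfulSMul GaussianInt S] {σ : S ≃ₐ[GaussianInt] S} {θ : S}

omit [IsDedekindDomain S] [FaithfulSMul GaussianInt S] in
theorem exists_apply_eq_sub_of_two_mul_eq (hθ : σ θ = -θ) {z : S} {A B : GaussianInt}
    (h : 2 * z = algebraMap _ S A + algebraMap _ S B * θ) :
    2 * σ z = algebraMap _ S A - algebraMap _ S B * θ := by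
  have := congrArg σ h
  simp only [map_mul, map_add, AlgEquiv.commutes, hθ, map_ofNat] at this
  linear_combination this

omit [IsDedekindDomain S] in
theorem two_ne_zero_of_faithfulSMul_gaussianInt : (2 : S) ≠ 0 := by
  have := (FaithfulSMul.algebraMap_injective GaussianInt S).ne (two_ne_zero (α := GaussianInt))
  rwa [map_ofNat, map_zero] at this

theorem sub_apply_eq_mul (hθ : σ θ = -θ) {z : S} {A B : GaussianInt}
    (h : 2 * z = algebraMap _ S A + algebraMap _ S B * θ) :
    z - σ z = algebraMap _ S B * θ := by
  have h' := exists_apply_eq_sub_of_two_mul_eq hθ h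
  apply mul_left_cancel₀ (two_ne_zero_of_faithfulSMul_gaussianInt (S := S))
  linear_combination h - h'

theorem GaussianInt.sq_eq_one_or_eq_neg_one {u : GaussianInt} (hu : IsUnit u) :
    u ^ 2 = 1 ∨ u ^ 2 = -1 := by
  rw [← Zsqrtd.norm_eq_one_iff, Zsqrtd.norm_def] at hu
  obtain ⟨a, b⟩ := u
  have h1 : a ^ 2 + b ^ 2 = 1 := by
    have h0 := abs_of_nonneg (add_nonneg (sq_nonneg a) (sq_nonneg b))
    have : a * a - -1 * b * b = a ^ 2 + b ^ 2 := by ring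
    rw [Int.abs_eq_natAbs] at h0
    simp only [this] at hu
    omega
  have ha : a ^ 2 ≤ 1 := by nlinarith [sq_nonneg b]
  have hb : b ^ 2 ≤ 1 := by nlinarith [sq_nonneg a]
  have ha' := abs_le.1 (sq_le_one_iff_abs_le_one a |>.1 ha)
  have hb' := abs_le.1 (sq_le_one_iff_abs_le_one b |>.1 hb)
  obtain ⟨ha1, ha2⟩ := ha'
  obtain ⟨hb1, hb2⟩ := hb'
  interval_cases a <;> interval_cases b <;> simp_all [sq, Zsqrtd.ext_iff]

section Ramification

variable {P : ℕ}

theorem map_eq_self_and_sq_eq_span_of_dvd (hσ : ∀ z, σ (σ z) = z)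
    (hfix : ∀ z, σ z = z → ∃ r, algebraMap GaussianInt S r = z) (hθ : σ θ = -θ) (hθ0 : θ ≠ 0)
    (hθ2 : θ ^ 2 = -algebraMap GaussianInt S (⟨0, 1⟩ * P))
    (hrep : ∀ z : S, ∃ A B : GaussianInt, 2 * z = algebraMap _ S A + algebraMap _ S B * θ)
    {π : GaussianInt} (hπ : Prime π) (hπP : π ∣ P) (hπ2 : ¬ π ∣ 2) {Q : Ideal S}
    (hQ : Q.IsPrime) (hπQ : algebraMap _ S π ∈ Q) :
    Q.map σ = Q ∧ Q ^ 2 = Ideal.span {algebraMap _ S π} := by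
  have hdvd : algebraMap _ S π ∣ θ ^ 2 := by
    rw [hθ2, dvd_neg]
    exact map_dvd _ (hπP.mul_left _)
  have hθQ : θ ∈ Q := hQ.mem_of_pow_mem 2 (Q.mem_of_dvd hdvd hπQ)
  refine Ideal.sq_eq_span_of_ramified hσ hfix hπ hQ hπQ (fun z => ?_) hdvd ?_
  · obtain ⟨A, B, h⟩ := hrep z
    rw [sub_apply_eq_mul hθ h]
    exact Q.mul_mem_left _ hθQ
  · rintro ⟨y, hy⟩
    obtain ⟨A, B, h⟩ := hrep y
    have h1 := congrArg σ hy
    rw [map_mul, AlgEquiv.commutes, hθ] at h1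
    have h2 := sub_apply_eq_mul hθ h
    have h3 : algebraMap GaussianInt S (2 - π * B) * θ = 0 := by
      simp only [map_sub, map_mul, map_ofNat]
      linear_combination hy - h1 + algebraMap GaussianInt S π * h2
    rcases mul_eq_zero.1 h3 with h4 | h4
    · rw [FaithfulSMul.algebraMap_eq_zero_iff, sub_eq_zero] at h4
      exact hπ2 ⟨B, h4⟩
    · exact hθ0 h4

theorem map_eq_self_and_sq_eq_span_one_add_I (hP : P % 2 = 1) (hσ : ∀ z, σ (σ z) = z)
    (hfix : ∀ z, σ z = z → ∃ r, algebraMap GaussianInt S r = z) (hθ : σ θ = -θ)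
    (hθ2 : θ ^ 2 = -algebraMap GaussianInt S (⟨0, 1⟩ * P))
    (hrep : ∀ z : S, ∃ A B : GaussianInt, 2 * z = algebraMap _ S A + algebraMap _ S B * θ)
    {Q : Ideal S} (hQ : Q.IsPrime) (hπQ : algebraMap GaussianInt S ⟨1, 1⟩ ∈ Q) :
    Q.map σ = Q ∧ Q ^ 2 = Ideal.span {algebraMap GaussianInt S ⟨1, 1⟩} := by
  have hinj := FaithfulSMul.algebraMap_injective GaussianInt S
  have h2 : (⟨1, 1⟩ : GaussianInt) ∣ 2 := ⟨⟨1, -1⟩, rfl⟩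
  have hπ : Prime (⟨1, 1⟩ : GaussianInt) :=
    GaussianInt.prime_of_natAbs_norm_prime (by norm_num [Zsqrtd.norm_def])
  refine Ideal.sq_eq_span_of_ramified hσ hfix hπ hQ hπQ (fun z => ?_) (τ := θ - 1) ?_ ?_
  · obtain ⟨A, B, h⟩ := hrep z
    obtain ⟨N, hN⟩ := hfix (z * σ z) (by rw [map_mul, hσ, mul_comm])
    have h' := exists_apply_eq_sub_of_two_mul_eq hθ h
    rw [sub_apply_eq_mul hθ h]
    refine Q.mul_mem_right _ (Q.mem_of_dvd (map_dvd _ ?_) hπQ)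
    refine GaussianInt.one_add_I_dvd_of_sq_add hP (A := A) (N := N) (hinj ?_)
    simp only [map_mul, map_add, map_pow, map_ofNat] at hθ2 ⊢
    linear_combination -2 * σ z * h - (algebraMap _ S A + algebraMap _ S B * θ) * h' -
      4 * hN + algebraMap _ S B ^ 2 * hθ2
  · have h3 : (⟨1, 1⟩ : GaussianInt) ∣ 1 - ⟨0, 1⟩ * P := by
      refine ⟨⟨(1 - P) / 2, -(1 + P) / 2⟩, ?_⟩
      rw [Zsqrtd.ext_iff]
      simp
      omega
    have h4 : (θ - 1) ^ 2 = algebraMap GaussianInt S (1 - ⟨0, 1⟩ * P) +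
        algebraMap GaussianInt S 2 * (-θ) := by
      simp only [map_sub, map_one, map_ofNat]
      linear_combination hθ2
    rw [h4]
    exact dvd_add (map_dvd _ h3) ((map_dvd _ h2).mul_right _)
  · rintro ⟨y, hy⟩
    obtain ⟨N, hN⟩ := hfix (y * σ y) (by rw [map_mul, hσ, mul_comm])
    refine GaussianInt.not_one_add_I_sq_dvd (P := P) ⟨N, hinj ?_⟩
    have h1 := congrArg σ hy
    rw [map_mul, AlgEquiv.commutes, map_sub, map_one, hθ] at h1
    simp only [map_mul, map_add, map_pow, map_one, hN] at hθ2 ⊢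
    linear_combination hθ2 + (-θ - 1) * hy + algebraMap GaussianInt S ⟨1, 1⟩ * y * h1

end Ramification

variable {p₁ p₂ : ℕ} {e f g h : ℤ}

omit [IsDedekindDomain S] in
theorem eq_empty_of_mul_apply_eq (hp₁ : p₁.Prime) (hp₂ : p₂.Prime) (hne : p₁ ≠ p₂)
    (hm₁ : p₁ % 8 = 5) (hm₂ : p₂ % 8 = 5)
    (hef : (p₁ : ℤ) = e ^ 2 + 4 * f ^ 2) (hgh : (p₂ : ℤ) = g ^ 2 + 4 * h ^ 2)
    (hθ : σ θ = -θ) (hθ2 : θ ^ 2 = -algebraMap GaussianInt S (⟨0, 1⟩ * (p₁ * p₂ : ℕ)))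
    (hrep : ∀ z : S, ∃ A B : GaussianInt, 2 * z = algebraMap _ S A + algebraMap _ S B * θ)
    {ϖ : Fin 5 → GaussianInt} (hϖ : ϖ = ![⟨1, 1⟩, ⟨e, 2 * f⟩, star ⟨e, 2 * f⟩, ⟨g, 2 * h⟩,
      star ⟨g, 2 * h⟩]) (z : S) (u C : GaussianInt) (s : Finset (Fin 5)) (hs : s ⊆ {0, 1, 2})
    (hu : IsUnit u) (hC : C ≠ 0)
    (hz : z * σ z = algebraMap _ S (u * (∏ i ∈ s, ϖ i) * C ^ 2)) : s = ∅ ∧ u ^ 2 = 1 := by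
  obtain ⟨A, B, hAB⟩ := hrep z
  have hAB' := exists_apply_eq_sub_of_two_mul_eq hθ hAB
  have hprod : ∏ i ∈ s, ϖ i = ⟨1, 1⟩ ^ (if 0 ∈ s then 1 else 0) *
      ⟨e, 2 * f⟩ ^ (if 1 ∈ s then 1 else 0) * star ⟨e, 2 * f⟩ ^ (if 2 ∈ s then 1 else 0) := by
    rw [← Finset.inter_eq_right.2 hs, ← Finset.prod_ite_mem, Finset.prod_insert (by decide),
      Finset.prod_insert (by decide), Finset.prod_singleton, ← mul_assoc]
    simp only [Finset.mem_inter, Finset.mem_insert, Finset.mem_singleton]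
    congr 1
    · congr 1
      · split_ifs <;> simp_all
      · split_ifs <;> simp_all
    · split_ifs <;> simp_all
  obtain ⟨h0, h1, h2, h3⟩ := GaussianInt.exponents_eq_zero_of_sq_add_mul_sq hp₁ hp₂ hne hm₁ hm₂
    hef hgh (A := A) (B := B) (C := 2 * C) (mul_ne_zero two_ne_zero hC)
    (GaussianInt.sq_eq_one_or_eq_neg_one hu)
    (k₀ := if 0 ∈ s then 1 else 0) (k₁ := if 1 ∈ s then 1 else 0) (k₂ := if 2 ∈ s then 1 else 0)
    (by split_ifs <;> simp) (by split_ifs <;> simp) (by split_ifs <;> simp) (by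
      apply FaithfulSMul.algebraMap_injective GaussianInt S
      rw [hprod] at hz
      rw [Nat.cast_mul] at hθ2
      simp only [map_mul, map_add, map_pow, map_ofNat] at hz hθ2 ⊢
      linear_combination -2 * σ z * hAB -
        (algebraMap _ S A + algebraMap _ S B * θ) * hAB' + 4 * hz + algebraMap _ S B ^ 2 * hθ2)
  refine ⟨Finset.eq_empty_iff_forall_notMem.2 fun i hi => ?_, h3⟩
  have := hs hi
  simp only [Finset.mem_insert, Finset.mem_singleton] at this
  rcases this with rfl | rfl | rfl
  · simp [hi] at h0
  · simp [hi] at h1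
  · simp [hi] at h2

theorem ClassGroup.sylow_two_of_gaussianInt_involution [Finite (ClassGroup S)]
    (hp₁ : p₁.Prime) (hp₂ : p₂.Prime) (hne : p₁ ≠ p₂) (hm₁ : p₁ % 8 = 5) (hm₂ : p₂ % 8 = 5)
    (hef : (p₁ : ℤ) = e ^ 2 + 4 * f ^ 2) (hgh : (p₂ : ℤ) = g ^ 2 + 4 * h ^ 2)
    (hσ : ∀ z, σ (σ z) = z) (hfix : ∀ z, σ z = z → ∃ r, algebraMap GaussianInt S r = z)
    (hθ : σ θ = -θ) (hθ2 : θ ^ 2 = -algebraMap GaussianInt S (⟨0, 1⟩ * (p₁ * p₂ : ℕ)))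
    (hrep : ∀ z : S, ∃ A B : GaussianInt, 2 * z = algebraMap _ S A + algebraMap _ S B * θ)
    {ω : S} (hω : IsUnit ω) (hω' : ∀ v ε : S, ε ^ 4 = 1 → ω ≠ ε * v ^ 2)
    {H₀ H₁ H₂ : Ideal S} (hH₀p : H₀.IsPrime) (hH₁p : H₁.IsPrime) (hH₂p : H₂.IsPrime)
    (hH₀ : 2 ∈ H₀) (hH₁ : algebraMap GaussianInt S ⟨e, 2 * f⟩ ∈ H₁)
    (hH₂ : algebraMap GaussianInt S (star ⟨e, 2 * f⟩) ∈ H₂)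
    (h0 : H₀ ≠ 0) (h1 : H₁ ≠ 0) (h2 : H₂ ≠ 0) (P : Sylow 2 (ClassGroup S)) :
    Nonempty (Additive P ≃+ (ZMod 2 × ZMod 2 × ZMod 2)) ∧
      (P : Subgroup (ClassGroup S)) = Subgroup.closure
        {ClassGroup.mk0 ⟨H₀, mem_nonZeroDivisors_of_ne_zero h0⟩,
         ClassGroup.mk0 ⟨H₁, mem_nonZeroDivisors_of_ne_zero h1⟩,
         ClassGroup.mk0 ⟨H₂, mem_nonZeroDivisors_of_ne_zero h2⟩} := by
  set ϖ : Fin 5 → GaussianInt := ![⟨1, 1⟩, ⟨e, 2 * f⟩, star ⟨e, 2 * f⟩, ⟨g, 2 * h⟩,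
      star ⟨g, 2 * h⟩] with hϖ
  have hnorm : ∀ {p : ℕ} {a b : ℤ}, (p : ℤ) = a ^ 2 + 4 * b ^ 2 →
      (⟨a, 2 * b⟩ : GaussianInt).norm = p := by
    intro p a b h
    rw [h, Zsqrtd.norm_def]
    ring
  have hprime : ∀ {p : ℕ} {a b : ℤ}, p.Prime → (p : ℤ) = a ^ 2 + 4 * b ^ 2 →
      Prime (⟨a, 2 * b⟩ : GaussianInt) := by
    intro p a b hp h
    refine GaussianInt.prime_of_natAbs_norm_prime ?_
    rwa [hnorm h, Int.natAbs_natCast]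
  have hodd' : ∀ {p : ℕ} {π : GaussianInt}, p % 8 = 5 → π.norm = p → ¬ π ∣ 2 := by
    rintro p π hp hπ ⟨c, hc⟩
    have h1 := congrArg Zsqrtd.norm hc
    rw [Zsqrtd.norm_mul, hπ, show (2 : GaussianInt).norm = 4 from rfl] at h1
    have h2 : (p : ℤ) ∣ 4 := ⟨_, h1⟩
    have h3 : p ≤ 4 := Nat.le_of_dvd (by norm_num) (by exact_mod_cast h2)
    interval_cases p <;> omega
  have hstar : ∀ {p : ℕ} {π : GaussianInt}, π.norm = p → (star π).norm = p := by
    intro p π h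
    rw [← h, Zsqrtd.norm_conj]
  have hPfac : (((p₁ * p₂ : ℕ) : ℕ) : GaussianInt) = ∏ i ∈ {1, 2, 3, 4}, ϖ i := by
    rw [Nat.cast_mul, GaussianInt.natCast_eq_mul_star hef, GaussianInt.natCast_eq_mul_star hgh]
    rw [Finset.prod_insert (by decide), Finset.prod_insert (by decide),
      Finset.prod_insert (by decide), Finset.prod_singleton, ← mul_assoc, ← mul_assoc, ← mul_assoc]
    rfl
  have hϖp : ∀ i, Prime (ϖ i) := by
    intro i
    fin_cases i
    exacts [GaussianInt.prime_of_natAbs_norm_prime (by norm_num [ϖ, Zsqrtd.norm_def]),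
      hprime hp₁ hef, GaussianInt.prime_star (hprime hp₁ hef), hprime hp₂ hgh,
      GaussianInt.prime_star (hprime hp₂ hgh)]
  have hodd : ∀ i, i ≠ 0 → ¬ ϖ i ∣ 2 := by
    intro i hi
    fin_cases i
    exacts [absurd rfl hi, hodd' hm₁ (hnorm hef), hodd' hm₁ (hstar (hnorm hef)),
      hodd' hm₂ (hnorm hgh), hodd' hm₂ (hstar (hnorm hgh))]
  have hinj := FaithfulSMul.algebraMap_injective GaussianInt S
  have hI : IsUnit (⟨0, 1⟩ : GaussianInt) := IsUnit.of_mul_eq_one ⟨0, -1⟩ rfl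
  have hθ0 : θ ≠ 0 := by
    rintro rfl
    rw [zero_pow two_ne_zero, eq_comm, neg_eq_zero, FaithfulSMul.algebraMap_eq_zero_iff, hPfac,
      mul_eq_zero, Finset.prod_eq_zero_iff] at hθ2
    rcases hθ2 with h | ⟨i, -, h⟩
    exacts [hI.ne_zero h, (hϖp i).ne_zero h]
  have hram : ∀ i, ∀ Q : Ideal S, Q.IsPrime → algebraMap _ S (ϖ i) ∈ Q →
      Q.map σ = Q ∧ Q ^ 2 = Ideal.span {algebraMap _ S (ϖ i)} := by
    intro i Q hQ hiQ
    by_cases hi : i = 0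
    · subst hi
      exact map_eq_self_and_sq_eq_span_one_add_I (P := p₁ * p₂)
        (by rw [Nat.mul_mod]; simp [show p₁ % 2 = 1 by omega, show p₂ % 2 = 1 by omega])
        hσ hfix hθ hθ2 hrep hQ hiQ
    · refine map_eq_self_and_sq_eq_span_of_dvd hσ hfix hθ hθ0 hθ2 hrep (hϖp i) ?_ (hodd i hi)
        hQ hiQ
      rw [hPfac]
      exact Finset.dvd_prod_of_mem _ (by clear hiQ; revert i; decide)
  have hexists : ∀ i, ∃ Q : Ideal S, Q.IsPrime ∧ algebraMap _ S (ϖ i) ∈ Q := by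
    intro i
    have hnu : ¬ IsUnit (algebraMap _ S (ϖ i)) := by
      rintro hu
      refine (hϖp i).not_isUnit (isUnit_of_dvd_one ?_)
      refine dvd_of_algebraMap_dvd_algebraMap hfix (σ := σ) ?_
      rw [map_one]
      exact hu.dvd
    obtain ⟨Q, hQ, hQ'⟩ := Ideal.exists_le_maximal _ (mt Ideal.span_singleton_eq_top.1 hnu)
    exact ⟨Q, hQ.isPrime, hQ' (Ideal.mem_span_singleton_self _)⟩
  have htwo : ∀ Q : Ideal S, Q.IsPrime → 2 ∈ Q → algebraMap _ S (ϖ 0) ∈ Q := by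
    intro Q hQ h2
    refine hQ.mem_of_pow_mem 2 ?_
    have : algebraMap _ S (ϖ 0) ^ 2 = algebraMap GaussianInt S ⟨0, 1⟩ * 2 := by
      rw [← map_pow, ← map_ofNat (algebraMap GaussianInt S) 2, ← map_mul]
      rfl
    rw [this]
    exact Q.mul_mem_left _ h2
  obtain ⟨H₃, hH₃p, hH₃⟩ := hexists 3
  obtain ⟨H₄, hH₄p, hH₄⟩ := hexists 4
  set H : Fin 5 → Ideal S := ![H₀, H₁, H₂, H₃, H₄] with hHdef
  have hHp : ∀ i, (H i).IsPrime := by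
    intro i
    fin_cases i
    exacts [hH₀p, hH₁p, hH₂p, hH₃p, hH₄p]
  have hmem : ∀ i, algebraMap _ S (ϖ i) ∈ H i := by
    intro i
    fin_cases i
    exacts [htwo H₀ hH₀p hH₀, hH₁, hH₂, hH₃, hH₄]
  have hHsq := fun i => (hram i _ (hHp i) (hmem i)).2
  have hunique : ∀ i, ∀ Q : Ideal S, Q.IsPrime → algebraMap _ S (ϖ i) ∈ Q → Q = H i := by
    intro i Q hQ hiQ
    have := (hram i Q hQ hiQ).2
    rw [← hHsq i] at this
    exact pow_left_injective two_ne_zero this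
  have hH0 : ∀ i, H i ≠ 0 := by
    intro i hi
    have := hHsq i
    rw [hi, zero_pow two_ne_zero, eq_comm, Ideal.zero_eq_bot, Ideal.span_singleton_eq_bot,
      FaithfulSMul.algebraMap_eq_zero_iff] at this
    exact (hϖp i).ne_zero this
  have hθfac : Ideal.span {θ ^ 2} = Ideal.span {∏ i ∈ {1, 2, 3, 4}, algebraMap _ S (ϖ i)} := by
    rw [hθ2, Ideal.span_singleton_neg, map_mul, hPfac, map_prod,
      Ideal.span_singleton_mul_left_unit (hI.map _)]
  refine ClassGroup.sylow_two_of_involution (H := H) (ϖ := ϖ) (I := ⟨0, 1⟩) (θ := θ) hσ hfix rfl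
    (fun z u C s hs hu hC hz => eq_empty_of_mul_apply_eq hp₁ hp₂ hne hm₁ hm₂ hef hgh hθ hθ2 hrep
      hϖ z u C s hs hu hC hz) hθ hHsq (fun i => (hram i _ (hHp i) (hmem i)).1) hH0
    (fun Q hQ h2Qθ => ?_) hθ0 ?_ hω hω' P
  · rcases hQ.mem_or_mem h2Qθ with h2Q | hθQ
    · exact ⟨0, hunique 0 Q hQ (htwo Q hQ h2Q)⟩
    · have h3 : Ideal.span {θ ^ 2} ≤ Q := (Ideal.span_singleton_le_iff_mem Q).2
        (Q.pow_mem_of_mem hθQ 2 two_pos)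
      rw [hθfac, Ideal.span_singleton_le_iff_mem, hQ.prod_mem_iff] at h3
      obtain ⟨i, -, hi⟩ := h3
      exact ⟨i, hunique i Q hQ hi⟩
  · refine pow_left_injective two_ne_zero ?_
    simp only [← Finset.prod_pow, hHsq, Ideal.span_singleton_pow]
    rw [hθfac, Ideal.prod_span_singleton]

end GaussianInvolution

theorem NumberField.exists_isUnit_ne_mul_sq (K : Type*) [Field K] [NumberField K]
    (hK : 2 < Module.finrank ℚ K) (n : ℕ) (hn : n ≠ 0) :
    ∃ ω : RingOfIntegers K, IsUnit ω ∧ ∀ v ε : RingOfIntegers K, ε ^ n = 1 → ω ≠ ε * v ^ 2 := by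
  have hrank : 0 < Units.rank K := by
    have h1 := InfinitePlace.card_add_two_mul_card_eq_rank K
    have h2 : Fintype.card (InfinitePlace K) =
        InfinitePlace.nrRealPlaces K + InfinitePlace.nrComplexPlaces K :=
      InfinitePlace.card_eq_nrRealPlaces_add_nrComplexPlaces K
    rw [Units.rank]
    omega
  let i : Fin (Units.rank K) := ⟨0, hrank⟩
  refine ⟨Units.fundSystem K i, Units.isUnit _, fun v ε hε h => ?_⟩
  have hεu : IsUnit ε := IsUnit.of_pow_eq_one hε hn
  have hvu : IsUnit (v ^ 2) := isUnit_of_mul_isUnit_right (h ▸ Units.isUnit _)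
  rw [isUnit_pow_iff two_ne_zero] at hvu
  obtain ⟨ε, rfl⟩ := hεu
  obtain ⟨v, rfl⟩ := hvu
  have h' : Units.fundSystem K i = ε * v ^ 2 := Units.ext h
  have hε' : ε ∈ Units.torsion K := by
    rw [Units.torsion, CommGroup.mem_torsion, isOfFinOrder_iff_pow_eq_one]
    exact ⟨n, Nat.pos_of_ne_zero hn, Units.ext hε⟩
  obtain ⟨⟨ζ, k⟩, hζ, -⟩ := Units.exist_unique_eq_mul_prod K v
  have h1 := (Units.exist_unique_eq_mul_prod K (Units.fundSystem K i)).unique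
    (y₁ := (1, Pi.single i 1)) (y₂ := (⟨ε, hε'⟩ * ζ ^ 2, 2 • k)) ?_ ?_
  · have h2 := congrFun (congrArg Prod.snd h1) i
    simp only [Pi.single_eq_same, Pi.smul_apply, nsmul_eq_mul, Nat.cast_ofNat] at h2
    omega
  · simp only [Subgroup.coe_one, one_mul]
    rw [Finset.prod_eq_single i (fun j _ hj => by simp [hj]) (by simp), Pi.single_eq_same, zpow_one]
  · rw [h', hζ]
    simp only [Subgroup.coe_mul, Subgroup.coe_pow, mul_pow, mul_assoc, Pi.smul_apply,
      ← Finset.prod_pow, nsmul_eq_mul, Nat.cast_ofNat]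
    congr! 4
    rw [mul_comm, zpow_mul, zpow_ofNat]

theorem exists_ringEquiv_neg {R L : Type*} [CommRing R] [Field L] {φ : R →+* L}
    (hφ : Function.Injective φ) {θ : L} {d : R} (hθ : θ ^ 2 = φ d) (h2 : (2 : R) ≠ 0)
    (hind : ∀ a b, φ a + φ b * θ = 0 → b = 0)
    (hgen : ∀ z, ∃ n a b, n ≠ 0 ∧ φ n * z = φ a + φ b * θ) :
    ∃ σ : L ≃+* L, (∀ r, σ (φ r) = φ r) ∧ σ θ = -θ ∧ (∀ z, σ (σ z) = z) ∧
      ∀ z, σ z = z → ∃ n a, n ≠ 0 ∧ φ n * z = φ a := by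
  have h0 : ∀ {n}, n ≠ 0 → φ n ≠ 0 := fun h => (map_ne_zero_iff φ hφ).2 h
  have hR : IsDomain R := hφ.isDomain φ
  choose n a b hn hz using hgen
  let s : L → L := fun z => (φ (a z) - φ (b z) * θ) / φ (n z)
  have key : ∀ {m x y z}, m ≠ 0 → φ m * z = φ x + φ y * θ → φ m * s z = φ x - φ y * θ := by
    intro m x y z hm h
    have h1 : φ (n z * x - m * a z) + φ (n z * y - m * b z) * θ = 0 := by
      simp only [map_sub, map_mul]
      linear_combination φ m * hz z - φ (n z) * h
    have h3 := hind _ _ h1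
    rw [h3, map_zero, zero_mul, add_zero] at h1
    replace h3 := congrArg φ h3
    simp only [map_sub, map_mul, map_zero] at h1 h3
    simp only [s]
    rw [mul_div_assoc', div_eq_iff (h0 (hn z))]
    linear_combination θ * h3 - h1
  have uniq : ∀ {m x y z w}, m ≠ 0 → φ m * z = φ x + φ y * θ → φ m * w = φ x - φ y * θ →
      s z = w := by
    intro m x y z w hm h h'
    exact mul_left_cancel₀ (h0 hm) ((key hm h).trans h'.symm)
  have hs := fun z => key (hn z) (hz z)
  have hinv : ∀ z, s (s z) = z := fun z => by
    refine uniq (hn z) (x := a z) (y := -b z) ?_ ?_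
    · rw [hs, map_neg]
      ring
    · rw [hz, map_neg]
      ring
  have hmul : ∀ z w, s (z * w) = s z * s w := fun z w => by
    refine uniq (m := n z * n w) (x := a z * a w + b z * b w * d) (y := a z * b w + b z * a w)
      (mul_ne_zero (hn z) (hn w)) ?_ ?_
    · simp only [map_add, map_mul, ← hθ]
      linear_combination φ (n w) * w * hz z + (φ (a z) + φ (b z) * θ) * hz w
    · simp only [map_add, map_mul, ← hθ]
      linear_combination φ (n w) * s w * hs z + (φ (a z) - φ (b z) * θ) * hs w
  have hadd : ∀ z w, s (z + w) = s z + s w := fun z w => by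
    refine uniq (m := n z * n w) (x := n w * a z + n z * a w) (y := n w * b z + n z * b w)
      (mul_ne_zero (hn z) (hn w)) ?_ ?_
    · simp only [map_add, map_mul]
      linear_combination φ (n w) * hz z + φ (n z) * hz w
    · simp only [map_add, map_mul]
      linear_combination φ (n w) * hs z + φ (n z) * hs w
  refine ⟨{ toFun := s, invFun := s, left_inv := hinv, right_inv := hinv, map_mul' := hmul,
            map_add' := hadd }, fun r => ?_, ?_, hinv, fun z h => ?_⟩
  · exact uniq (m := 1) (x := r) (y := 0) one_ne_zero (by simp) (by simp)
  · exact uniq (m := 1) (x := 0) (y := 1) one_ne_zero (by simp) (by simp)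
  · have h' : s z = z := h
    have h1 := hs z
    rw [h'] at h1
    refine ⟨n z * 2, a z * 2, mul_ne_zero (hn z) h2, ?_⟩
    simp only [map_mul, map_ofNat]
    linear_combination hz z + h1

namespace GaussianInt

theorem squarefree_natCast {p : ℕ} (hp : p.Prime) (hm : p % 8 = 5) {e f : ℤ}
    (hef : (p : ℤ) = e ^ 2 + 4 * f ^ 2) : Squarefree (p : GaussianInt) := by
  have := Fact.mk hp
  obtain ⟨hπ, φ, hφ⟩ := exists_ringHom_zmod hp hm hef
  rw [natCast_eq_mul_star hef, squarefree_mul_iff]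
  refine ⟨(hπ.irreducible.isRelPrime_iff_not_dvd).2 fun h => ?_, hπ.irreducible.squarefree,
    (prime_star hπ).irreducible.squarefree⟩
  have h1 := quadraticChar_map_star hm hef hφ
  rw [(hφ _).2 h] at h1
  simp at h1

theorem squarefree_natCast_mul {p₁ p₂ : ℕ} (hp₁ : p₁.Prime) (hp₂ : p₂.Prime) (hne : p₁ ≠ p₂)
    (hm₁ : p₁ % 8 = 5) (hm₂ : p₂ % 8 = 5) {e f g h : ℤ}
    (hef : (p₁ : ℤ) = e ^ 2 + 4 * f ^ 2) (hgh : (p₂ : ℤ) = g ^ 2 + 4 * h ^ 2) :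
    Squarefree ((p₁ * p₂ : ℕ) : GaussianInt) := by
  rw [Nat.cast_mul, squarefree_mul_iff]
  refine ⟨?_, squarefree_natCast hp₁ hm₁ hef, squarefree_natCast hp₂ hm₂ hgh⟩
  have h1 := (Nat.isCoprime_iff_coprime.2 ((Nat.coprime_primes hp₁ hp₂).2 hne)).map
    (Int.castRingHom GaussianInt)
  simpa using h1.isRelPrime

theorem eq_zero_of_sq_eq_mul_sq {D a b : GaussianInt} (hD : Squarefree D) (hD' : ¬ IsUnit D)
    (h : a ^ 2 = D * b ^ 2) : b = 0 := by
  by_contra hb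
  obtain ⟨c, rfl⟩ : b ∣ a := by
    rw [← IsIntegrallyClosed.pow_dvd_pow_iff two_ne_zero, h]
    exact dvd_mul_left _ _
  have hc : D = c * c := by
    apply mul_right_cancel₀ (pow_ne_zero 2 hb)
    rw [← h]
    ring
  have hcu := hD c hc.symm.dvd
  exact hD' (hc ▸ hcu.mul hcu)

end GaussianInt

theorem IsIntegrallyClosed.exists_algebraMap_eq_of_mul_eq {R S : Type*} [CommRing R] [IsDomain R]
    [IsIntegrallyClosed R] [CommRing S] [IsDomain S] [Algebra R S] [FaithfulSMul R S] {z : S}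
    (hz : IsIntegral R z) {n a : R} (hn : n ≠ 0) (h : algebraMap R S n * z = algebraMap R S a) :
    ∃ r, algebraMap R S r = z := by
  have hinj : Function.Injective (Algebra.ofId R (FractionRing S)) :=
    FaithfulSMul.algebraMap_injective R (FractionRing S)
  let F : FractionRing R →ₐ[R] FractionRing S := IsFractionRing.liftAlgHom hinj
  have hF : F (algebraMap R _ a / algebraMap R _ n) = algebraMap S (FractionRing S) z := by
    rw [map_div₀, AlgHom.commutes, AlgHom.commutes, div_eq_iff, mul_comm,
      IsScalarTower.algebraMap_apply R S, ← h, map_mul, ← IsScalarTower.algebraMap_apply R S]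
    rwa [Ne, FaithfulSMul.algebraMap_eq_zero_iff]
  have h1 := (isIntegral_algHom_iff F F.injective).1 (hF ▸ hz.algebraMap)
  obtain ⟨r, hr⟩ := IsIntegrallyClosed.isIntegral_iff.1 h1
  refine ⟨r, FaithfulSMul.algebraMap_injective S (FractionRing S) ?_⟩
  rw [← hF, ← hr, AlgHom.commutes, ← IsScalarTower.algebraMap_apply]

section GaussianNumberField

variable {L : Type*} [Field L] [Algebra GaussianInt (RingOfIntegers L)]
  [FaithfulSMul GaussianInt (RingOfIntegers L)] {θ : RingOfIntegers L} {D : GaussianInt}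

theorem eq_zero_of_add_mul_eq_zero (hD : Squarefree D) (hD' : ¬ IsUnit D)
    (hθ : θ ^ 2 = algebraMap GaussianInt (RingOfIntegers L) D) {a b : GaussianInt}
    (h : algebraMap GaussianInt (RingOfIntegers L) a + algebraMap _ _ b * θ = 0) : b = 0 := by
  refine GaussianInt.eq_zero_of_sq_eq_mul_sq hD hD' (a := a)
    (FaithfulSMul.algebraMap_injective GaussianInt (RingOfIntegers L) ?_)
  simp only [map_mul, map_pow]
  linear_combination (algebraMap GaussianInt (RingOfIntegers L) a - algebraMap _ _ b * θ) * h +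
    algebraMap GaussianInt (RingOfIntegers L) b ^ 2 * hθ

theorem exists_algEquiv_neg (hD : Squarefree D) (hD' : ¬ IsUnit D)
    (hθ : θ ^ 2 = algebraMap GaussianInt (RingOfIntegers L) D)
    (hgen : ∀ z : L, ∃ n a b : GaussianInt, n ≠ 0 ∧
      (algebraMap GaussianInt (RingOfIntegers L) n : L) * z =
        (algebraMap GaussianInt (RingOfIntegers L) a : L) +
          (algebraMap GaussianInt (RingOfIntegers L) b : L) * θ) :
    ∃ σ : RingOfIntegers L ≃ₐ[GaussianInt] RingOfIntegers L, σ θ = -θ ∧ (∀ z, σ (σ z) = z) ∧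
      (∀ z, σ z = z → ∃ r, algebraMap GaussianInt (RingOfIntegers L) r = z) ∧
      ∀ z, ∃ A B : GaussianInt, 2 * z = algebraMap _ _ A + algebraMap _ _ B * θ := by
  have hinj := FaithfulSMul.algebraMap_injective GaussianInt (RingOfIntegers L)
  obtain ⟨s, hs, hsθ, hss, hfix⟩ := exists_ringEquiv_neg
    (φ := (algebraMap (RingOfIntegers L) L).comp (algebraMap GaussianInt (RingOfIntegers L)))
    (RingOfIntegers.coe_injective.comp hinj) (θ := (θ : L)) (d := D)
    (by rw [RingHom.comp_apply, ← hθ, map_pow]) two_ne_zero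
    (fun a b hab => eq_zero_of_add_mul_eq_zero hD hD' hθ
      (a := a) (RingOfIntegers.coe_injective (by simpa using hab))) hgen
  let σ : RingOfIntegers L ≃ₐ[GaussianInt] RingOfIntegers L :=
    AlgEquiv.ofRingEquiv (f := RingOfIntegers.mapRingEquiv s) fun r =>
      RingOfIntegers.coe_injective (hs r)
  have hσ : ∀ z, ((σ z : RingOfIntegers L) : L) = s z := fun z => rfl
  have hσσ : ∀ z, σ (σ z) = z := fun z => RingOfIntegers.coe_injective (hss z)
  have hσθ : σ θ = -θ := RingOfIntegers.coe_injective ((hσ θ).trans (hsθ.trans (map_neg _ θ).symm))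
  have hσfix : ∀ z, σ z = z → ∃ r, algebraMap GaussianInt (RingOfIntegers L) r = z := by
    intro z hz
    obtain ⟨n, a, hn, h⟩ := hfix z (by rw [← hσ, hz])
    refine IsIntegrallyClosed.exists_algebraMap_eq_of_mul_eq
      (RingOfIntegers.isIntegral z).tower_top hn (a := a) (RingOfIntegers.coe_injective ?_)
    rw [map_mul]
    exact h
  refine ⟨σ, hσθ, hσσ, hσfix, fun z => ?_⟩
  obtain ⟨A, hA⟩ := hσfix (z + σ z) (by rw [map_add, hσσ, add_comm])
  obtain ⟨r, hr⟩ := hσfix ((z - σ z) ^ 2) (by rw [map_pow, map_sub, hσσ]; ring)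
  obtain ⟨g, hg⟩ := hσfix ((z - σ z) * θ) (by rw [map_mul, map_sub, hσσ, hσθ]; ring)
  have hD0 : D ≠ 0 := hD.ne_zero
  obtain ⟨B, rfl⟩ : D ∣ g := by
    rw [← hD.dvd_pow_iff_dvd two_ne_zero]
    refine ⟨r, hinj ?_⟩
    rw [map_pow, map_mul, hg, hr, ← hθ]
    ring
  refine ⟨A, B, ?_⟩
  have hθ0 : θ ≠ 0 := by
    rintro rfl
    rw [zero_pow two_ne_zero, eq_comm, FaithfulSMul.algebraMap_eq_zero_iff] at hθ
    exact hD0 hθ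
  apply mul_right_cancel₀ hθ0
  rw [map_mul, ← hθ] at hg
  rw [hA]
  linear_combination -hg

theorem two_lt_finrank_of_gaussianInt [NumberField L] (hD : Squarefree D) (hD' : ¬ IsUnit D)
    (hθ : θ ^ 2 = algebraMap GaussianInt (RingOfIntegers L) D) : 2 < Module.finrank ℚ L := by
  let I : RingOfIntegers L := algebraMap GaussianInt _ ⟨0, 1⟩
  have hli : LinearIndependent ℤ ![(1 : L), I, θ] := by
    rw [Fintype.linearIndependent_iff]
    intro c hc
    have h1 : algebraMap GaussianInt (RingOfIntegers L) ⟨c 0, c 1⟩ +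
        algebraMap GaussianInt (RingOfIntegers L) (c 2 : ℤ) * θ = 0 := by
      have h2 : (⟨c 0, c 1⟩ : GaussianInt) = (c 0 : ℤ) + (c 1 : ℤ) * ⟨0, 1⟩ := by
        simp [Zsqrtd.ext_iff]
      apply RingOfIntegers.coe_injective
      rw [h2]
      simp only [Fin.sum_univ_three, zsmul_eq_mul, Matrix.cons_val_zero, Matrix.cons_val_one,
        Matrix.cons_val, mul_one, I] at hc
      simpa only [map_add, map_mul, map_intCast, map_zero] using hc
    have h2 := eq_zero_of_add_mul_eq_zero hD hD' hθ h1
    rw [h2, map_zero, zero_mul, add_zero, FaithfulSMul.algebraMap_eq_zero_iff] at h1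
    have h3 := congrArg Zsqrtd.re h1
    have h4 := congrArg Zsqrtd.im h1
    intro i
    fin_cases i
    exacts [h3, h4, by exact_mod_cast h2]
  have h1 := ((LinearIndependent.iff_fractionRing ℤ ℚ).1 hli).fintype_card_le_finrank
  simpa [Nat.lt_iff_add_one_le] using h1

end GaussianNumberField

theorem exists_toComplex_mul_eq_of_mem_adjoin {x θ : ℂ} {D : GaussianInt} (hxa : IsAlgebraic ℚ x)
    (hx : x = (1 + Complex.I) * θ) (hθ : θ ^ 2 = GaussianInt.toComplex D) {z : ℂ}
    (hz : z ∈ ℚ⟮x, Complex.I⟯) : ∃ n a b : GaussianInt, n ≠ 0 ∧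
      GaussianInt.toComplex n * z = GaussianInt.toComplex a + GaussianInt.toComplex b * θ := by
  have hI : IsAlgebraic ℚ Complex.I := by
    refine IsAlgebraic.of_pow (n := 2) two_pos ?_
    rw [Complex.I_sq]
    exact isAlgebraic_one.neg
  rw [← mem_toSubalgebra, adjoin_toSubalgebra_of_isAlgebraic (by
    rintro y (rfl | rfl)
    exacts [hxa, hI])] at hz
  induction hz using Algebra.adjoin_induction with
  | mem y hy =>
    rcases hy with rfl | rfl
    · exact ⟨1, 0, ⟨1, 1⟩, one_ne_zero, by simp [hx, GaussianInt.toComplex_def']⟩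
    · exact ⟨1, ⟨0, 1⟩, 0, one_ne_zero, by simp [GaussianInt.toComplex_def']⟩
  | algebraMap q =>
    refine ⟨q.den, q.num, 0, by simp, ?_⟩
    have := q.den_mul_eq_num
    simp
    exact_mod_cast congrArg (Rat.cast : ℚ → ℂ) this
  | add y z _ _ hy hz =>
    obtain ⟨n, a, b, hn, h⟩ := hy
    obtain ⟨n', a', b', hn', h'⟩ := hz
    refine ⟨n * n', a * n' + n * a', b * n' + n * b', mul_ne_zero hn hn', ?_⟩
    simp only [map_mul, map_add]
    linear_combination GaussianInt.toComplex n' * h + GaussianInt.toComplex n * h'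
  | mul y z _ _ hy hz =>
    obtain ⟨n, a, b, hn, h⟩ := hy
    obtain ⟨n', a', b', hn', h'⟩ := hz
    refine ⟨n * n', a * a' + b * b' * D, a * b' + b * a', mul_ne_zero hn hn', ?_⟩
    simp only [map_mul, map_add, ← hθ]
    linear_combination GaussianInt.toComplex n' * z * h +
      (GaussianInt.toComplex a + GaussianInt.toComplex b * θ) * h'

/-- `Cl₂(𝕜)` is isomorphic to `ℤ/2ℤ × ℤ/2ℤ × ℤ/2ℤ` and is generated by the
ideal classes of the prime ideals `H₀`, `H₁`, `H₂` of `𝓞_𝕜`, where `H₀` is the prime lying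
above `2` and `H₁`, `H₂` are the primes lying above the Gaussian primes `π₁ = e + 2if` and
`π₂ = e - 2if` (with `p₁ = e² + 4f²`). -/
theorem stmt_3 (p₁ p₂ : ℕ) (hp₁ : p₁.Prime) (hp₂ : p₂.Prime) (hne : p₁ ≠ p₂)
    (hm₁ : p₁ % 8 = 5) (hm₂ : p₂ % 8 = 5)
    (e f g h : ℤ) (hef : (p₁ : ℤ) = e ^ 2 + 4 * f ^ 2) (hgh : (p₂ : ℤ) = g ^ 2 + 4 * h ^ 2)
    (x : ℂ) (hx : x ^ 2 = ((2 * p₁ * p₂ : ℕ) : ℂ))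
    (𝕜 : IntermediateField ℚ ℂ) (h𝕜 : 𝕜 = ℚ⟮x, Complex.I⟯)
    [NumberField 𝕜]
    (H₀ H₁ H₂ : Ideal (RingOfIntegers 𝕜))
    (hH₀p : H₀.IsPrime) (hH₁p : H₁.IsPrime) (hH₂p : H₂.IsPrime)
    (hH₀ : (2 : RingOfIntegers 𝕜) ∈ H₀)
    (hH₁ : ∀ u : RingOfIntegers 𝕜,
      ((algebraMap (RingOfIntegers 𝕜) 𝕜 u : 𝕜) : ℂ) = (e : ℂ) + 2 * f * Complex.I → u ∈ H₁)
    (hH₂ : ∀ u : RingOfIntegers 𝕜,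
      ((algebraMap (RingOfIntegers 𝕜) 𝕜 u : 𝕜) : ℂ) = (e : ℂ) - 2 * f * Complex.I → u ∈ H₂)
    (h0 : H₀ ≠ 0) (h1 : H₁ ≠ 0) (h2 : H₂ ≠ 0) :
    ∀ P : Sylow 2 (ClassGroup (RingOfIntegers 𝕜)),
      Nonempty (Additive P ≃+ (ZMod 2 × ZMod 2 × ZMod 2)) ∧
      (P : Subgroup (ClassGroup (RingOfIntegers 𝕜))) = Subgroup.closure
        {ClassGroup.mk0 ⟨H₀, mem_nonZeroDivisors_of_ne_zero h0⟩,
         ClassGroup.mk0 ⟨H₁, mem_nonZeroDivisors_of_ne_zero h1⟩,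
         ClassGroup.mk0 ⟨H₂, mem_nonZeroDivisors_of_ne_zero h2⟩} := by
  subst h𝕜
  intro P
  have hxa : IsAlgebraic ℚ x := by
    refine IsAlgebraic.of_pow (n := 2) two_pos ?_
    rw [hx]
    exact isAlgebraic_natCast _
  have hI2 : (1 + Complex.I) ^ 2 = 2 * Complex.I := by
    linear_combination Complex.I_sq
  have hI0 : 1 + Complex.I ≠ 0 := fun h => by simpa using congrArg Complex.re h
  set D : GaussianInt := -(⟨0, 1⟩ * (p₁ * p₂ : ℕ)) with hD
  have hDc : GaussianInt.toComplex D = -(Complex.I * (p₁ * p₂)) := by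
    simp [D, GaussianInt.toComplex_def']
  have hθ2 : (x / (1 + Complex.I)) ^ 2 = GaussianInt.toComplex D := by
    rw [div_pow, hx, hI2, hDc, div_eq_iff (mul_ne_zero two_ne_zero Complex.I_ne_zero)]
    push_cast
    linear_combination 2 * p₁ * p₂ * Complex.I_sq
  let K := ℚ⟮x, Complex.I⟯
  have hIK : Complex.I ∈ K := subset_adjoin _ _ (by simp)
  have hxK : x ∈ K := subset_adjoin _ _ (by simp)
  let I : RingOfIntegers K := ⟨⟨Complex.I, hIK⟩, by
    refine IsIntegral.of_pow (n := 2) two_pos ?_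
    have : (⟨Complex.I, hIK⟩ : K) ^ 2 = -1 := Subtype.coe_injective Complex.I_sq
    rw [this]
    exact isIntegral_one.neg⟩
  have hI : I * I = ((-1 : ℤ) : RingOfIntegers K) := by
    apply RingOfIntegers.coe_injective
    apply Subtype.coe_injective
    refine Complex.I_mul_I.trans ?_
    simp
  let φ : GaussianInt →+* RingOfIntegers K := Zsqrtd.lift ⟨I, hI⟩
  have hφ : ∀ r, ((φ r : K) : ℂ) = GaussianInt.toComplex r := by
    intro r
    have hφr : φ r = (r.re : RingOfIntegers K) + (r.im : RingOfIntegers K) * I := rfl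
    change (algebraMap K ℂ).comp (algebraMap (RingOfIntegers K) K) (φ r) = _
    rw [hφr, GaussianInt.toComplex_def, map_add, map_mul, map_intCast, map_intCast]
    rfl
  let _ : Algebra GaussianInt (RingOfIntegers K) := φ.toAlgebra
  have hinj : Function.Injective φ := fun a b hab => GaussianInt.toComplex_injective <| by
    rw [← hφ, ← hφ, hab]
  have : FaithfulSMul GaussianInt (RingOfIntegers K) :=
    (faithfulSMul_iff_algebraMap_injective _ _).2 hinj
  let y : K := ⟨x / (1 + Complex.I), K.div_mem hxK (K.add_mem K.one_mem hIK)⟩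
  have hy : y ^ 2 = (φ D : K) := Subtype.coe_injective (hθ2.trans (hφ D).symm)
  let θ : RingOfIntegers K := ⟨y, by
    refine IsIntegral.of_pow (n := 2) two_pos ?_
    rw [hy]
    exact RingOfIntegers.isIntegral_coe _⟩
  have hθ : θ ^ 2 = algebraMap GaussianInt (RingOfIntegers K) D :=
    RingOfIntegers.coe_injective hy
  have hDP : Associated ((p₁ * p₂ : ℕ) : GaussianInt) D :=
    ⟨⟨-⟨0, 1⟩, ⟨0, 1⟩, rfl, rfl⟩, by simp only [D]; ring⟩
  have hDsq : Squarefree D := (hDP.squarefree_iff).1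
    (GaussianInt.squarefree_natCast_mul hp₁ hp₂ hne hm₁ hm₂ hef hgh)
  have hDu : ¬ IsUnit D := by
    rw [← hDP.isUnit_iff, ← Zsqrtd.norm_eq_one_iff, Zsqrtd.norm_natCast, ← Nat.cast_mul,
      Int.natAbs_natCast]
    simp [hp₁.ne_one]
  obtain ⟨σ, hσθ, hσσ, hσfix, hrep⟩ := exists_algEquiv_neg hDsq hDu hθ (fun z => by
    obtain ⟨n, a, b, hn, h⟩ := exists_toComplex_mul_eq_of_mem_adjoin hxa
      (mul_div_cancel₀ x hI0).symm hθ2 z.2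
    refine ⟨n, a, b, hn, Subtype.coe_injective ?_⟩
    rw [← hφ, ← hφ, ← hφ] at h
    exact h)
  obtain ⟨ω, hω, hω'⟩ := NumberField.exists_isUnit_ne_mul_sq K
    (two_lt_finrank_of_gaussianInt hDsq hDu hθ) 4 (by norm_num)
  refine ClassGroup.sylow_two_of_gaussianInt_involution hp₁ hp₂ hne hm₁ hm₂ hef hgh hσσ hσfix hσθ
    (hθ.trans (map_neg _ _)) hrep hω hω' hH₀p hH₁p hH₂p hH₀ (hH₁ _ ((hφ _).trans ?_))
    (hH₂ _ ((hφ _).trans ?_)) h0 h1 h2 P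
  · simp [GaussianInt.toComplex_def']
  · simp [GaussianInt.toComplex_def', sub_eq_add_neg]
end

section
/- The equation x² − 2p₁p₂·y² = −1 has a solution in integers x, y; equivalently, the fundamental unit ε_{2p₁p₂} of ℚ(√(2p₁p₂)) has norm −1. -/
open NumberField IntermediateField

/-- `ε` is the fundamental unit of the real quadratic field `ℚ(√D)` (for `D > 1` squarefree):
elements of the ring of integers of `ℚ(√D)` are exactly the numbers `(x + y√D)/2` with
`x ≡ y·D (mod 2)`, and units are those with `x² - Dy² = ±4`.  The fundamental unit is the
least unit `> 1`; equivalently, every unit is of the form `±ε^k` with `k ∈ ℤ`. -/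
def IsFundUnit (D : ℕ) (ε : ℝ) : Prop :=
  1 < ε ∧
  (∃ x y : ℤ, ε = ((x : ℝ) + (y : ℝ) * Real.sqrt D) / 2 ∧
    (x ^ 2 - (D : ℤ) * y ^ 2 = 4 ∨ x ^ 2 - (D : ℤ) * y ^ 2 = -4)) ∧
  ∀ x y : ℤ, (x ^ 2 - (D : ℤ) * y ^ 2 = 4 ∨ x ^ 2 - (D : ℤ) * y ^ 2 = -4) →
    1 < ((x : ℝ) + (y : ℝ) * Real.sqrt D) / 2 →
    ε ≤ ((x : ℝ) + (y : ℝ) * Real.sqrt D) / 2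

theorem legendreSym_eq_one_of_mul_sq {p : ℕ} [Fact p.Prime] (hp : p % 4 = 1) {c s : ℤ}
    (h : ((c * s ^ 2 : ℤ) : ZMod p) = 1 ∨ ((c * s ^ 2 : ℤ) : ZMod p) = -1) :
    legendreSym p c = 1 := by
  have h1 : legendreSym p (c * s ^ 2) = 1 := by
    rw [legendreSym.eq_one_iff p (by rcases h with h | h <;> rw [h] <;> simp)]
    rcases h with h | h <;> rw [h]
    · exact IsSquare.one
    · exact ZMod.exists_sq_eq_neg_one_iff.2 (by omega)
  rw [legendreSym.mul, pow_two, legendreSym.mul] at h1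
  rcases Int.eq_one_or_neg_one_of_mul_eq_one h1 with h2 | h2
  · exact h2
  · rw [h2] at h1
    nlinarith [mul_self_nonneg (legendreSym p s)]

theorem exists_eq_mul_sq_of_coprime {D u v z : ℕ} (hD : D ≠ 0) (huv : u.Coprime v)
    (h : u * v = D * z ^ 2) :
    ∃ a b r s : ℕ, a * b = D ∧ u = a * r ^ 2 ∧ v = b * s ^ 2 ∧ r * s = z := by
  have hab : D.gcd u * D.gcd v = D := by
    rw [← huv.gcd_mul, h, Nat.gcd_mul_right_right]
  obtain ⟨u', hu⟩ := Nat.gcd_dvd_right D u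
  obtain ⟨v', hv⟩ := Nat.gcd_dvd_right D v
  have hz : u' * v' = z ^ 2 := by
    apply Nat.eq_of_mul_eq_mul_left (Nat.pos_of_ne_zero hD)
    calc D * (u' * v') = D.gcd u * D.gcd v * (u' * v') := by rw [hab]
      _ = (D.gcd u * u') * (D.gcd v * v') := by ring
      _ = D * z ^ 2 := by rw [← hu, ← hv, h]
  have hc : u'.Coprime v' :=
    Nat.Coprime.of_dvd (Dvd.intro_left _ hu.symm) (Dvd.intro_left _ hv.symm) huv
  obtain ⟨r, hr⟩ := exists_eq_pow_of_mul_eq_pow (Nat.isUnit_iff.2 hc) hz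
  obtain ⟨s, hs⟩ := exists_eq_pow_of_mul_eq_pow (Nat.isUnit_iff.2 hc.symm)
    ((mul_comm _ _).trans hz)
  refine ⟨_, _, r, s, hab, by rw [← hr]; exact hu, by rw [← hs]; exact hv, ?_⟩
  apply Nat.pow_left_injective (n := 2) two_ne_zero
  simp only [mul_pow, ← hr, ← hs, hz]

theorem Nat.Prime.exists_of_mul_eq_mul {p m a b : ℕ} (hp : p.Prime) (h : a * b = p * m) :
    (∃ a', a = p * a' ∧ a' * b = m) ∨ ∃ b', b = p * b' ∧ a * b' = m := by
  rcases hp.dvd_mul.1 (Dvd.intro _ h.symm) with ⟨c, rfl⟩ | ⟨c, rfl⟩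
  · exact .inl ⟨c, rfl, Nat.eq_of_mul_eq_mul_left hp.pos (by rw [← h]; ring)⟩
  · exact .inr ⟨c, rfl, Nat.eq_of_mul_eq_mul_left hp.pos (by rw [← h]; ring)⟩

theorem eq_one_or_eq_one_of_mul_sq_add_one {p q a b r s : ℕ} (hp : p.Prime) (hq : q.Prime)
    (hp5 : p % 8 = 5) (hq5 : q % 8 = 5) (hab : a * b = 2 * p * q)
    (h : a * r ^ 2 + 1 = b * s ^ 2) : a = 1 ∨ b = 1 := by
  have key : ∀ {l : ℕ} [Fact l.Prime], l % 8 = 5 →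
      (l ∣ a → legendreSym l b = 1) ∧ (l ∣ b → legendreSym l a = 1) := by
    intro l _ hl
    have h' : (a * r ^ 2 + 1 : ZMod l) = b * s ^ 2 := by exact_mod_cast congrArg (Nat.cast) h
    constructor <;> intro hd <;> rw [← ZMod.natCast_eq_zero_iff] at hd <;> rw [hd] at h'
    · exact legendreSym_eq_one_of_mul_sq (s := s) (by omega) (.inl (by push_cast; rw [← h']; ring))
    · exact legendreSym_eq_one_of_mul_sq (s := r) (by omega)
        (.inr (by push_cast; linear_combination h'))
  have two : ∀ {l : ℕ} [Fact l.Prime], l % 8 = 5 → legendreSym l 2 = -1 := by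
    intro l _ hl
    have hsq := ZMod.exists_sq_eq_two_iff (p := l) (by omega)
    have := (legendreSym.eq_neg_one_iff l (a := 2)).2
    push_cast at this
    exact this (by rw [hsq]; omega)
  have := Fact.mk hp
  have := Fact.mk hq
  have hrec : legendreSym q p = legendreSym p q :=
    legendreSym.quadratic_reciprocity_one_mod_four (by omega) (by omega)
  have kp := key hp5
  have kq := key hq5
  have tp := two hp5
  have tq := two hq5
  clear key two
  rcases Nat.prime_two.exists_of_mul_eq_mul (hab.trans (mul_assoc _ _ _)) with
    ⟨a, rfl, h₁⟩ | ⟨b, rfl, h₁⟩ <;>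
  rcases hp.exists_of_mul_eq_mul h₁ with ⟨a, rfl, h₂⟩ | ⟨b, rfl, h₂⟩ <;>
  rcases hq.exists_of_mul_eq_mul (h₂.trans (mul_one q).symm) with
    ⟨a, rfl, h₃⟩ | ⟨b, rfl, h₃⟩ <;>
  obtain ⟨rfl, rfl⟩ := mul_eq_one.1 h₃ <;>
  clear h₁ h₂ h₃ hab h <;>
  simp_all [legendreSym.mul]

theorem pell_descent {p q X Y : ℕ} (hp : p.Prime) (hq : q.Prime)
    (hp5 : p % 8 = 5) (hq5 : q % 8 = 5) (hY : 0 < Y)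
    (h : X ^ 2 = 2 * p * q * Y ^ 2 + 1) :
    ∃ r s : ℕ, 0 < r ∧ 0 < s ∧ (r ^ 2 = 2 * p * q * s ^ 2 + 1 ∨ r ^ 2 + 1 = 2 * p * q * s ^ 2) ∧
      X = r ^ 2 + 2 * p * q * s ^ 2 ∧ Y = 2 * r * s := by
  have hD : 2 * p * q ≠ 0 := by simp [hp.ne_zero, hq.ne_zero]
  obtain ⟨u, rfl | rfl⟩ := Nat.even_or_odd' X
  · exfalso
    have := congrArg (· % 2) h
    simp [Nat.add_mod, Nat.mul_mod, Nat.pow_mod] at this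
  obtain ⟨z, rfl | rfl⟩ := Nat.even_or_odd' Y
  swap
  · exfalso
    obtain ⟨k, hk⟩ : ∃ k, p * q = 2 * k + 1 :=
      (Nat.odd_mul.2 ⟨Nat.odd_iff.2 (by omega), Nat.odd_iff.2 (by omega)⟩)
    rw [mul_assoc 2 p, hk] at h
    ring_nf at h
    omega
  have huv : u * (u + 1) = 2 * p * q * z ^ 2 := by nlinarith
  obtain ⟨a, b, r, s, hab, hu, hv, hz⟩ := exists_eq_mul_sq_of_coprime hD (by simp) huv
  have hr : 0 < r := Nat.pos_of_ne_zero (by rintro rfl; simp at hz; omega)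
  have hs : 0 < s := Nat.pos_of_ne_zero (by rintro rfl; simp at hz; omega)
  rcases eq_one_or_eq_one_of_mul_sq_add_one hp hq hp5 hq5 hab (by rw [← hu, hv]) with
    rfl | rfl
  · rw [one_mul] at hab hu
    subst hab
    exact ⟨r, s, hr, hs, .inr (by omega), by omega, by rw [← hz]; ring⟩
  · rw [mul_one] at hab
    rw [one_mul] at hv
    subst hab
    exact ⟨s, r, hs, hr, .inl (by omega), by omega, by rw [← hz]; ring⟩

theorem not_isSquare_two_mul_mul {p q : ℕ} (hp : Odd p) (hq : Odd q) :
    ¬ IsSquare (2 * p * q) := by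
  rintro ⟨n, hn⟩
  obtain ⟨k, hk⟩ := hp.mul hq
  rw [mul_assoc, hk] at hn
  obtain ⟨m, rfl | rfl⟩ := Nat.even_or_odd' n <;> ring_nf at hn <;> omega

theorem exists_sq_add_one_eq {p q : ℕ} (hp : p.Prime) (hq : q.Prime)
    (hp5 : p % 8 = 5) (hq5 : q % 8 = 5) :
    ∃ r s : ℕ, r ^ 2 + 1 = 2 * p * q * s ^ 2 := by
  have desc : ∀ Y X : ℕ, 0 < Y → X ^ 2 = 2 * p * q * Y ^ 2 + 1 →
      ∃ r s : ℕ, r ^ 2 + 1 = 2 * p * q * s ^ 2 := by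
    intro Y
    induction Y using Nat.strong_induction_on with
    | _ Y ih =>
      intro X hY h
      obtain ⟨r, s, hr, hs, h1 | h1, -, hYs⟩ := pell_descent hp hq hp5 hq5 hY h
      · exact ih s (by nlinarith) r hs h1
      · exact ⟨r, s, h1⟩
  have hns := not_isSquare_two_mul_mul (p := p) (q := q) (Nat.odd_iff.2 (by omega))
    (Nat.odd_iff.2 (by omega))
  have hpos : 0 < 2 * p * q := by have := hp.pos; have := hq.pos; positivity
  obtain ⟨x, y, hxy, hy⟩ := Pell.exists_of_not_isSquare (d := (2 * p * q : ℕ))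
    (by exact_mod_cast hpos) (by rwa [Int.isSquare_natCast_iff])
  refine desc y.natAbs x.natAbs (Int.natAbs_pos.2 hy) ?_
  zify
  rw [sq_abs, sq_abs]
  push_cast at hxy
  linarith

/-- If `(x + y√D) / 2` exceeds one and `x² - Dy² = 4`, then both coordinates are positive. -/
theorem pos_of_one_lt_add_mul_sqrt {D : ℕ} {x y : ℤ} (h : x ^ 2 - (D : ℤ) * y ^ 2 = 4)
    (h1 : 1 < ((x : ℝ) + y * √D) / 2) : 0 < x ∧ 0 < y := by
  have hd : (√D : ℝ) ^ 2 = D := Real.sq_sqrt (Nat.cast_nonneg D)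
  have h' : ((x : ℝ) + y * √D) * (x - y * √D) = 4 := by
    have : (x : ℝ) ^ 2 - D * y ^ 2 = 4 := by exact_mod_cast h
    linear_combination this - (y : ℝ) ^ 2 * hd
  have h2 : 0 < (x : ℝ) - y * √D := by
    by_contra hc
    nlinarith
  have h3 : (x : ℝ) - y * √D < 2 := by
    by_contra hc
    nlinarith
  have hx : (0 : ℝ) < x := by linarith
  have hy : (0 : ℝ) < y := pos_of_mul_pos_left (by linarith : 0 < (y : ℝ) * √D) (Real.sqrt_nonneg _)
  exact ⟨by exact_mod_cast hx, by exact_mod_cast hy⟩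

theorem Irrational.add_mul_injective {α : ℝ} (hα : Irrational α) {x y x' y' : ℤ}
    (h : (x : ℝ) + y * α = x' + y' * α) : x = x' ∧ y = y' := by
  have hy : y = y' := by
    by_contra hne
    refine (hα.intCast_mul (sub_ne_zero.2 hne)).ne_int (x' - x) ?_
    push_cast
    linear_combination h
  subst hy
  exact ⟨by exact_mod_cast add_right_cancel h, rfl⟩

theorem norm_ne_four_of_isFundUnit {p q : ℕ} (hp : p.Prime) (hq : q.Prime)
    (hp5 : p % 8 = 5) (hq5 : q % 8 = 5) {ε : ℝ} {x y : ℤ}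
    (hε : IsFundUnit (2 * p * q) ε) (hxy : ε = ((x : ℝ) + y * √((2 * p * q : ℕ) : ℝ)) / 2) :
    x ^ 2 - ((2 * p * q : ℕ) : ℤ) * y ^ 2 ≠ 4 := by
  intro h
  obtain ⟨h1, -, hmin⟩ := hε
  obtain ⟨hx0, hy0⟩ := pos_of_one_lt_add_mul_sqrt h (hxy ▸ h1)
  lift x to ℕ using hx0.le
  lift y to ℕ using hy0.le
  have hN : x ^ 2 = 2 * p * q * y ^ 2 + 4 := by zify; push_cast at h; linarith
  obtain ⟨k, hk⟩ : ∃ k, p * q = 2 * k + 1 :=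
    (Nat.odd_mul.2 ⟨Nat.odd_iff.2 (by omega), Nat.odd_iff.2 (by omega)⟩)
  have hx2 : Even x := by
    rw [← Nat.even_pow' two_ne_zero, hN]
    exact Even.add (by simp [mul_assoc]) (by decide)
  obtain ⟨X, rfl⟩ := even_iff_two_dvd.1 hx2
  obtain ⟨Y, rfl | rfl⟩ := Nat.even_or_odd' y
  swap
  · rw [mul_assoc 2 p, hk] at hN
    ring_nf at hN
    omega
  obtain ⟨r, s, hr, hs, hrs, hX, hY⟩ := pell_descent (X := X) (Y := Y) hp hq hp5 hq5
    (by simpa using hy0) (by nlinarith)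
  set D := 2 * p * q with hD
  have hd : (√(D : ℝ)) ^ 2 = D := Real.sq_sqrt (Nat.cast_nonneg D)
  have hDpos : 0 < D := by have := hp.pos; have := hq.pos; positivity
  have hdpos : 1 ≤ √(D : ℝ) := Real.one_le_sqrt.2 (by exact_mod_cast hDpos)
  have hr' : (1 : ℝ) ≤ r := by exact_mod_cast hr
  have hs' : (1 : ℝ) ≤ s := by exact_mod_cast hs
  have hsd : 1 ≤ (s : ℝ) * √D := one_le_mul_of_one_le_of_one_le hs' hdpos
  have hsq : ε = ((r : ℝ) + s * √D) ^ 2 := by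
    rw [hxy, hX, hY]
    push_cast
    linear_combination (-(s : ℝ) ^ 2) * hd
  have hle := hmin (2 * r) (2 * s) (by
    rcases hrs with hrs | hrs <;> zify at hrs
    · left; linear_combination 4 * hrs
    · right; linear_combination 4 * hrs) (by push_cast; linarith)
  push_cast at hle
  nlinarith

/-- For distinct primes `p₁ ≡ p₂ ≡ 5 (mod 8)`, the equation
`x² - 2p₁p₂·y² = -1` has an integer solution; equivalently, the fundamental unit
`ε_{2p₁p₂} = (x + y√(2p₁p₂))/2` of `ℚ(√(2p₁p₂))` has norm `-1`, i.e. `x² - 2p₁p₂·y² = -4`. -/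
theorem stmt_6 (p₁ p₂ : ℕ) (hp₁ : p₁.Prime) (hp₂ : p₂.Prime) (hne : p₁ ≠ p₂)
    (hm₁ : p₁ % 8 = 5) (hm₂ : p₂ % 8 = 5) :
    (∃ x y : ℤ, x ^ 2 - 2 * (p₁ : ℤ) * p₂ * y ^ 2 = -1) ∧
    (∀ (ε : ℝ) (x y : ℤ), IsFundUnit (2 * p₁ * p₂) ε →
      ε = ((x : ℝ) + (y : ℝ) * Real.sqrt ((2 * p₁ * p₂ : ℕ) : ℝ)) / 2 →
      x ^ 2 - (2 * p₁ * p₂ : ℕ) * y ^ 2 = -4) := by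
  obtain ⟨r, s, hrs⟩ := exists_sq_add_one_eq hp₁ hp₂ hm₁ hm₂
  refine ⟨⟨r, s, ?_⟩, fun ε x y hε hxy => ?_⟩
  · zify at hrs
    linear_combination hrs
  obtain ⟨x', y', hxy', hn⟩ := hε.2.1
  have hirr : Irrational √((2 * p₁ * p₂ : ℕ) : ℝ) :=
    irrational_sqrt_natCast_iff.2 (not_isSquare_two_mul_mul (Nat.odd_iff.2 (by omega))
      (Nat.odd_iff.2 (by omega)))
  obtain ⟨rfl, rfl⟩ := hirr.add_mul_injective (x := x) (y := y) (x' := x') (y' := y')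
    (by linarith)
  exact hn.resolve_left (norm_ne_four_of_isFundUnit hp₁ hp₂ hm₁ hm₂ hε hxy)
end

section
/- Suppose the fundamental unit of ℚ(√(p₁p₂)) is ε_{p₁p₂} = a + b√(p₁p₂) where a and b are positive integers satisfying a² − p₁p₂·b² = 1 (i.e. ε_{p₁p₂} has norm 1). Then 2p₁(a+1) is the square of an integer or 2p₁(a−1) is the square of an integer. -/
open NumberField IntermediateField

/-- A fundamental unit is not the square of a unit `x + y√D` with `x, y > 0`. -/
theorem IsFundUnit.ne_sq {D : ℕ} {ε : ℝ} (h : IsFundUnit D ε) (hD : 0 < D) {x y : ℤ}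
    (hx : 0 < x) (hy : 0 < y) (hxy : x ^ 2 - (D : ℤ) * y ^ 2 = 1 ∨ x ^ 2 - (D : ℤ) * y ^ 2 = -1) :
    ε ≠ ((x : ℝ) + (y : ℝ) * Real.sqrt D) ^ 2 := by
  intro hε
  have hx1 : (1 : ℝ) ≤ x := by exact_mod_cast hx
  have hy1 : (0 : ℝ) < y := by exact_mod_cast hy
  have hs : 0 < Real.sqrt D := Real.sqrt_pos.mpr (by exact_mod_cast hD)
  have hu : 1 < (x : ℝ) + (y : ℝ) * Real.sqrt D := by nlinarith [mul_pos hy1 hs]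
  have hhalf : (((2 * x : ℤ) : ℝ) + ((2 * y : ℤ) : ℝ) * Real.sqrt D) / 2
      = (x : ℝ) + (y : ℝ) * Real.sqrt D := by
    push_cast
    ring
  have hmin := h.2.2 (2 * x) (2 * y)
    (hxy.imp (fun e => by linear_combination 4 * e) (fun e => by linear_combination 4 * e))
    (by rwa [hhalf])
  rw [hhalf, hε] at hmin
  nlinarith

/-- If `a + b√D` is a fundamental unit of norm `1`, then `a` is not of the form `x² + Dy²` with
`x² - Dy² = ±1` and `x, y > 0`. -/
theorem IsFundUnit.ne_sq_add_mul_sq {D : ℕ} {a b : ℤ}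
    (h : IsFundUnit D ((a : ℝ) + (b : ℝ) * Real.sqrt D)) (hD : 0 < D) (hb : 0 < b)
    (hnorm : a ^ 2 - (D : ℤ) * b ^ 2 = 1) {x y : ℤ} (hx : 0 < x) (hy : 0 < y)
    (hxy : x ^ 2 - (D : ℤ) * y ^ 2 = 1 ∨ x ^ 2 - (D : ℤ) * y ^ 2 = -1) :
    a ≠ x ^ 2 + D * y ^ 2 := by
  intro ha
  have hD' : (D : ℤ) ≠ 0 := by exact_mod_cast hD.ne'
  have hsq : (x ^ 2 - (D : ℤ) * y ^ 2) ^ 2 = 1 := by rcases hxy with e | e <;> rw [e] <;> norm_num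
  have hb2 : b ^ 2 = (2 * x * y) ^ 2 := by
    apply mul_left_cancel₀ hD'
    rw [ha] at hnorm
    linear_combination hsq - hnorm
  have hbe : b = 2 * x * y := (sq_eq_sq₀ hb.le (by positivity)).mp hb2
  refine h.ne_sq hD hx hy hxy ?_
  have hs : Real.sqrt D ^ 2 = D := Real.sq_sqrt (Nat.cast_nonneg D)
  rw [ha, hbe]
  push_cast
  linear_combination -(y : ℝ) ^ 2 * hs

/-- Positive coprime integers whose product is a square are squares of positive integers. -/
theorem Int.exists_pos_sq_of_isCoprime {m k n : ℤ} (hm : 0 < m) (hk : 0 < k) (h : IsCoprime m k)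
    (hmk : m * k = n ^ 2) : ∃ s t : ℤ, 0 < s ∧ 0 < t ∧ m = s ^ 2 ∧ k = t ^ 2 := by
  have key : ∀ {u v : ℤ}, 0 < u → IsCoprime u v → u * v = n ^ 2 → ∃ s : ℤ, 0 < s ∧ u = s ^ 2 := by
    intro u v hu huv e
    obtain ⟨s, hs | hs⟩ := Int.sq_of_isCoprime huv e
    · refine ⟨|s|, abs_pos.mpr ?_, by rw [sq_abs, hs]⟩
      rintro rfl
      simp [hs] at hu
    · nlinarith [sq_nonneg s]
  obtain ⟨s, hs, hms⟩ := key hm h hmk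
  obtain ⟨t, ht, hkt⟩ := key hk h.symm (by rw [mul_comm, hmk])
  exact ⟨s, t, hs, ht, hms, hkt⟩

/-- If `m` and `k` are positive and coprime and `m * k` is `p * q` times a square, with `p`, `q`
distinct primes, then `m` and `k` are complementary divisors of `p * q` times squares. -/
theorem Int.exists_sq_of_mul_eq_prime_mul_prime_mul_sq {p q m k n : ℤ} (hp : Prime p)
    (hq : Prime q) (hp0 : 0 < p) (hq0 : 0 < q) (hpq : IsCoprime p q) (hm : 0 < m) (hk : 0 < k)
    (h : IsCoprime m k) (hmk : m * k = p * q * n ^ 2) :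
    ∃ s t : ℤ, 0 < s ∧ 0 < t ∧
      ((m = s ^ 2 ∧ k = p * q * t ^ 2) ∨ (m = p * q * s ^ 2 ∧ k = t ^ 2) ∨
        (m = p * s ^ 2 ∧ k = q * t ^ 2) ∨ (m = q * s ^ 2 ∧ k = p * t ^ 2)) := by
  have key : ∀ d e : ℤ, 0 < d → 0 < e → d * e = p * q → d ∣ m → e ∣ k →
      ∃ s t : ℤ, 0 < s ∧ 0 < t ∧ m = d * s ^ 2 ∧ k = e * t ^ 2 := by
    rintro d e hd he hde ⟨m', rfl⟩ ⟨k', rfl⟩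
    have hprod : m' * k' = n ^ 2 := by
      apply mul_left_cancel₀ (mul_pos hp0 hq0).ne'
      linear_combination hmk - m' * k' * hde
    obtain ⟨s, t, hs, ht, rfl, rfl⟩ := Int.exists_pos_sq_of_isCoprime
      (pos_of_mul_pos_right hm hd.le) (pos_of_mul_pos_right hk he.le)
      (h.of_mul_left_right.of_mul_right_right) hprod
    exact ⟨s, t, hs, ht, rfl, rfl⟩
  have hpd : p ∣ m * k := ⟨q * n ^ 2, by rw [hmk]; ring⟩
  have hqd : q ∣ m * k := ⟨p * n ^ 2, by rw [hmk]; ring⟩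
  rcases hp.dvd_or_dvd hpd with hp' | hp' <;> rcases hq.dvd_or_dvd hqd with hq' | hq'
  · obtain ⟨s, t, hs, ht, e₁, e₂⟩ := key (p * q) 1 (mul_pos hp0 hq0) one_pos (by ring)
      (hpq.mul_dvd hp' hq') (one_dvd k)
    exact ⟨s, t, hs, ht, .inr (.inl ⟨e₁, by rw [e₂, one_mul]⟩)⟩
  · obtain ⟨s, t, hs, ht, e₁, e₂⟩ := key p q hp0 hq0 rfl hp' hq'
    exact ⟨s, t, hs, ht, .inr (.inr (.inl ⟨e₁, e₂⟩))⟩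
  · obtain ⟨s, t, hs, ht, e₁, e₂⟩ := key q p hq0 hp0 (mul_comm q p) hq' hp'
    exact ⟨s, t, hs, ht, .inr (.inr (.inr ⟨e₁, e₂⟩))⟩
  · obtain ⟨s, t, hs, ht, e₁, e₂⟩ := key 1 (p * q) one_pos (mul_pos hp0 hq0) (by ring)
      (one_dvd m) (hpq.mul_dvd hp' hq')
    exact ⟨s, t, hs, ht, .inl ⟨by rw [e₁, one_mul], e₂⟩⟩

/-- If `D ≡ 1 (mod 4)`, then in a solution of `a² - Db² = 1` the integer `a` is odd and `b` is
even. -/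
theorem Int.odd_and_even_of_sq_sub_mul_sq_eq_one {D a b : ℤ} (hD : D % 4 = 1)
    (h : a ^ 2 - D * b ^ 2 = 1) : Odd a ∧ Even b := by
  have hDe : D = 4 * (D / 4) + 1 := by omega
  rcases Int.even_or_odd' a with ⟨r, rfl | rfl⟩ <;> rcases Int.even_or_odd' b with ⟨t, rfl | rfl⟩
  · rw [hDe] at h
    ring_nf at h
    omega
  · rw [hDe] at h
    ring_nf at h
    omega
  · exact ⟨⟨r, rfl⟩, ⟨t, by ring⟩⟩
  · rw [hDe] at h
    ring_nf at h
    omega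

/-- If the fundamental unit of `ℚ(√(p₁p₂))` is `ε_{p₁p₂} = a + b√(p₁p₂)`
with `a, b` positive integers and `a² - p₁p₂·b² = 1` (norm `1`), then `2p₁(a+1)` or
`2p₁(a-1)` is the square of an integer. -/
theorem stmt_7 (p₁ p₂ : ℕ) (hp₁ : p₁.Prime) (hp₂ : p₂.Prime) (hne : p₁ ≠ p₂)
    (hm₁ : p₁ % 8 = 5) (hm₂ : p₂ % 8 = 5)
    (a b : ℤ) (ha : 0 < a) (hb : 0 < b)
    (hnorm : a ^ 2 - (p₁ : ℤ) * p₂ * b ^ 2 = 1)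
    (hfund : IsFundUnit (p₁ * p₂) ((a : ℝ) + (b : ℝ) * Real.sqrt ((p₁ * p₂ : ℕ) : ℝ))) :
    (∃ c : ℤ, 2 * (p₁ : ℤ) * (a + 1) = c ^ 2) ∨ (∃ c : ℤ, 2 * (p₁ : ℤ) * (a - 1) = c ^ 2) := by
  have hD1 : ((p₁ : ℤ) * p₂) % 4 = 1 := by
    have h₁ : (p₁ : ℤ) % 4 = 1 := by omega
    have h₂ : (p₂ : ℤ) % 4 = 1 := by omega
    rw [Int.mul_emod, h₁, h₂]
    norm_num
  have hp0 : (0 : ℤ) < p₁ := by exact_mod_cast hp₁.pos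
  have hq0 : (0 : ℤ) < p₂ := by exact_mod_cast hp₂.pos
  have hnormD : a ^ 2 - ((p₁ * p₂ : ℕ) : ℤ) * b ^ 2 = 1 := by
    push_cast
    exact hnorm
  obtain ⟨⟨m, rfl⟩, n, rfl⟩ := Int.odd_and_even_of_sq_sub_mul_sq_eq_one hD1 hnorm
  have hprod : m * (m + 1) = (p₁ : ℤ) * p₂ * n ^ 2 := by linarith
  have hm : 0 < m := by
    have hn : 0 < n := by omega
    have hpos : 0 < m * (m + 1) := hprod ▸ by positivity
    exact pos_of_mul_pos_left hpos (by omega)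
  obtain ⟨s, t, hs, ht, ⟨e₁, e₂⟩ | ⟨e₁, e₂⟩ | ⟨e₁, -⟩ | ⟨-, e₂⟩⟩ :=
    Int.exists_sq_of_mul_eq_prime_mul_prime_mul_sq (Nat.prime_iff_prime_int.mp hp₁)
      (Nat.prime_iff_prime_int.mp hp₂) hp0 hq0
      (Nat.isCoprime_iff_coprime.mpr ((Nat.coprime_primes hp₁ hp₂).mpr hne)) hm
      (by omega : 0 < m + 1) ⟨-1, 1, by ring⟩ hprod
  · refine absurd ?_ (hfund.ne_sq_add_mul_sq (Nat.mul_pos hp₁.pos hp₂.pos) hb hnormD hs ht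
      (.inr ?_))
    · push_cast
      linarith
    · push_cast
      linarith
  · refine absurd ?_ (hfund.ne_sq_add_mul_sq (Nat.mul_pos hp₁.pos hp₂.pos) hb hnormD ht hs
      (.inl ?_))
    · push_cast
      linarith
    · push_cast
      linarith
  · exact .inr ⟨2 * p₁ * s, by rw [e₁]; ring⟩
  · exact .inl ⟨2 * p₁ * t, by linear_combination 4 * (p₁ : ℤ) * e₂⟩
end

section
/- Assume p₁ is a quadratic residue modulo p₂ (so that, by quadratic reciprocity, p₂ is also a quadratic residue modulo p₁ and the quartic symbols (p₁/p₂)₄ and (p₂/p₁)₄ are defined). Then (p₁/p₂)₄·(p₂/p₁)₄ = (π₁/π₃); that is, π₁ is a square in the residue field ℤ[i]/(π₃) if and only if the two quartic residue symbols (p₁/p₂)₄ and (p₂/p₁)₄ are equal. -/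
open NumberField IntermediateField

/-- Reduction modulo a Gaussian integer `g + k i` of prime norm `q`, as a map to `ZMod q`. -/
theorem exists_ringHom_isSquare_mk_iff {q : ℕ} (hq : q.Prime) {g k : ℤ}
    (hgk : (q : ℤ) = g ^ 2 + k ^ 2) :
    ∃ φ : GaussianInt →+* ZMod q, ∀ x : GaussianInt,
      IsSquare (Ideal.Quotient.mk (Ideal.span {(⟨g, k⟩ : GaussianInt)}) x) ↔ IsSquare (φ x) := by
  have := Fact.mk hq
  have hq0 : (g : ZMod q) ^ 2 + (k : ZMod q) ^ 2 = 0 := by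
    have := congrArg (Int.cast : ℤ → ZMod q) hgk
    push_cast at this
    simpa using this.symm
  have hk : (k : ZMod q) ≠ 0 := by
    intro h
    have hg : (g : ZMod q) = 0 := by simpa [h] using hq0
    rw [ZMod.intCast_zmod_eq_zero_iff_dvd] at h hg
    obtain ⟨u, rfl⟩ := h
    obtain ⟨v, rfl⟩ := hg
    have h1 : (q : ℤ) * (q * (u ^ 2 + v ^ 2)) = q * 1 := by linarith
    have h2 := mul_left_cancel₀ (by exact_mod_cast hq.ne_zero) h1
    have h3 : (q : ℤ) ∣ 1 := ⟨_, h2.symm⟩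
    exact hq.one_lt.ne' (by exact_mod_cast Int.eq_one_of_dvd_one (by positivity) h3)
  have hg : (g : ZMod q) ≠ 0 := by
    intro h
    simp [h, hk] at hq0
  let r : ZMod q := -g / k
  have hr : r * r = ((-1 : ℤ) : ZMod q) := by
    simp only [r]
    push_cast
    field_simp
    linear_combination hq0
  let φ : GaussianInt →+* ZMod q := Zsqrtd.lift ⟨r, hr⟩
  have hφ (x : GaussianInt) : φ x = x.re + x.im * r := rfl
  have hker (x : GaussianInt) : φ x = 0 → x ∈ Ideal.span {(⟨g, k⟩ : GaussianInt)} := by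
    intro hx
    have h1 : (k * x.re - g * x.im : ZMod q) = 0 := by
      have : (k * x.re - g * x.im : ZMod q) = k * φ x := by
        rw [hφ]
        simp only [r]
        field_simp
        ring
      rw [this, hx, mul_zero]
    have h2 : (g * x.re + k * x.im : ZMod q) = 0 := by
      apply mul_left_cancel₀ hg
      linear_combination (x.re : ZMod q) * hq0 - k * h1
    have h1' : ((k * x.re - g * x.im : ℤ) : ZMod q) = 0 := by push_cast; exact h1
    have h2' : ((g * x.re + k * x.im : ℤ) : ZMod q) = 0 := by push_cast; exact h2
    rw [ZMod.intCast_zmod_eq_zero_iff_dvd] at h1' h2'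
    obtain ⟨u, hu⟩ := h1'
    obtain ⟨v, hv⟩ := h2'
    have hq' : (q : ℤ) ≠ 0 := by exact_mod_cast hq.ne_zero
    rw [Ideal.mem_span_singleton]
    refine ⟨⟨v, -u⟩, ?_⟩
    apply Zsqrtd.ext
    · apply mul_left_cancel₀ hq'
      rw [Zsqrtd.re_mul]
      linear_combination x.re * hgk + g * hv + k * hu
    · apply mul_left_cancel₀ hq'
      rw [Zsqrtd.im_mul]
      linear_combination x.im * hgk + k * hv - g * hu
  have hgen : φ ⟨g, k⟩ = 0 := by
    rw [hφ]
    simp only [r]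
    field_simp
    ring
  refine ⟨φ, fun x => ⟨?_, ?_⟩⟩
  · rintro ⟨y, hy⟩
    obtain ⟨y, rfl⟩ := Ideal.Quotient.mk_surjective y
    rw [← map_mul, Ideal.Quotient.eq, Ideal.mem_span_singleton] at hy
    obtain ⟨w, hw⟩ := hy
    refine ⟨φ y, ?_⟩
    rw [← map_mul, ← sub_eq_zero, ← map_sub, hw, map_mul, hgen, zero_mul]
  · rintro ⟨c, hc⟩
    obtain ⟨n, rfl⟩ := ZMod.intCast_surjective c
    refine ⟨Ideal.Quotient.mk _ (n : GaussianInt), ?_⟩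
    rw [← map_mul, Ideal.Quotient.eq]
    apply hker
    rw [map_sub, hc, map_mul, map_intCast, sub_self]

theorem isPrimitiveRoot_gaussianInt_I : IsPrimitiveRoot (⟨0, 1⟩ : GaussianInt) 4 := by
  refine IsPrimitiveRoot.mk_of_lt _ (by norm_num) (by decide) ?_
  intro l h0 h4
  interval_cases l <;> decide

/-- For a prime `p ≡ 1 (mod 4)` there is a quartic character modulo `p` with values in `ℤ[i]`; its
square is the quadratic character. -/
theorem exists_quarticChar {p : ℕ} [Fact p.Prime] (hp : p % 4 = 1) :
    ∃ χ : MulChar (ZMod p) GaussianInt, χ ^ 2 ≠ 1 ∧ χ ^ 4 = 1 ∧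
      χ ^ 2 = (quadraticChar (ZMod p)).ringHomComp (Int.castRingHom GaussianInt) := by
  obtain ⟨χ, hχ⟩ := MulChar.exists_mulChar_orderOf (ZMod p) (n := 4)
    (by rw [ZMod.card]; omega) isPrimitiveRoot_gaussianInt_I
  have h4 : χ ^ 4 = 1 := hχ ▸ pow_orderOf_eq_one χ
  have h2 : χ ^ 2 ≠ 1 := fun h => by
    have := orderOf_dvd_of_pow_eq_one h
    rw [hχ] at this
    omega
  refine ⟨χ, h2, h4, ?_⟩
  have hsq (y : ZMod p) (hy : y ≠ 0) (hs : IsSquare y) : (χ ^ 2) y = 1 := by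
    obtain ⟨z, rfl⟩ := hs
    have hz : z ≠ 0 := by rintro rfl; simp at hy
    have := congrArg (fun ψ : MulChar (ZMod p) GaussianInt => ψ z) h4
    simp only [MulChar.one_apply hz.isUnit, MulChar.pow_apply' χ (by norm_num : 4 ≠ 0)] at this
    rw [MulChar.pow_apply' χ (by norm_num : 2 ≠ 0), map_mul, ← this]
    ring
  have hex : ∃ z : ZMod p, z ≠ 0 ∧ (χ ^ 2) z ≠ 1 := by
    by_contra! H
    apply h2
    refine MulChar.ext fun z => ?_
    rw [H z z.ne_zero, MulChar.one_apply_coe]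
  obtain ⟨z, hz0, hz⟩ := hex
  have hzn : ¬ IsSquare z := fun h => hz (hsq z hz0 h)
  have hm1 (y : ZMod p) (hy : y ≠ 0) : (χ ^ 2) y * (χ ^ 2) y = 1 := by
    rw [← map_mul]
    exact hsq _ (mul_ne_zero hy hy) ⟨y, rfl⟩
  refine MulChar.ext fun y => ?_
  by_cases hy : IsSquare (y : ZMod p)
  · rw [hsq _ y.ne_zero hy]
    simp [MulChar.ringHomComp_apply, (quadraticChar_one_iff_isSquare y.ne_zero).2 hy]
  · have hyz : IsSquare ((y : ZMod p) * z) := by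
      rw [← quadraticChar_one_iff_isSquare (mul_ne_zero y.ne_zero hz0), map_mul,
        quadraticChar_neg_one_iff_not_isSquare.2 hy, quadraticChar_neg_one_iff_not_isSquare.2 hzn]
      norm_num
    have h1 := hsq _ (mul_ne_zero y.ne_zero hz0) hyz
    have hz1 : (χ ^ 2) z = -1 := by
      rcases mul_self_eq_one_iff.1 (hm1 z hz0) with h | h
      · exact absurd h hz
      · exact h
    rw [map_mul, hz1] at h1
    have : (χ ^ 2) (y : ZMod p) = -1 := by linear_combination -h1
    rw [this]
    simp [MulChar.ringHomComp_apply, quadraticChar_neg_one_iff_not_isSquare.2 hy]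

/-- The Jacobi sum of a quartic character modulo `p` has norm `p`. -/
theorem norm_jacobiSum {p : ℕ} [Fact p.Prime] {χ : MulChar (ZMod p) GaussianInt}
    (h2 : χ ^ 2 ≠ 1) : (jacobiSum χ χ).norm = p := by
  have hinj : Function.Injective GaussianInt.toComplex := GaussianInt.toComplex_injective
  let ψ := χ.ringHomComp GaussianInt.toComplex
  have hψ1 : ψ ≠ 1 := (MulChar.ringHomComp_ne_one_iff hinj).2 fun h => h2 (by rw [h, one_pow])
  have hψ2 : ψ * ψ ≠ 1 := by
    rw [← sq, show ψ ^ 2 = _ from MulChar.ringHomComp_pow _ _ _]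
    exact (MulChar.ringHomComp_ne_one_iff hinj).2 h2
  have hJ := jacobiSum_mul_jacobiSum_inv (F := ZMod p) (F' := ℂ) (χ := ψ) (φ := ψ) (by
    rw [ZMod.ringChar_zmod_n, ringChar.eq_zero]
    exact (Fact.out : p.Prime).ne_zero.symm) hψ1 hψ1 hψ2
  have hinv : ψ⁻¹ = ψ.ringHomComp (starRingEnd ℂ) := by
    ext x
    rw [MulChar.ringHomComp_apply, starRingEnd_apply, MulChar.star_apply']
  have hψJ : jacobiSum ψ ψ = GaussianInt.toComplex (jacobiSum χ χ) := jacobiSum_ringHomComp _ _ _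
  rw [hinv, jacobiSum_ringHomComp ψ ψ (starRingEnd ℂ), hψJ, Complex.mul_conj, ZMod.card] at hJ
  have h3 : ((jacobiSum χ χ).norm : ℂ) = (p : ℂ) := by
    rw [← hJ]
    exact_mod_cast (GaussianInt.intCast_complex_norm _)
  exact_mod_cast h3

/-- The Jacobi sum of a quartic character is congruent to `1` modulo `2`. -/
theorem jacobiSum_parity {p : ℕ} [Fact p.Prime] (hp : p % 4 = 1)
    {χ : MulChar (ZMod p) GaussianInt} (h4 : χ ^ 4 = 1) :
    (jacobiSum χ χ).re % 2 = 1 ∧ (jacobiSum χ χ).im % 2 = 0 := by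
  obtain ⟨z, -, hz⟩ := exists_jacobiSum_eq_neg_one_add (F := ZMod p) (n := 4) (by norm_num) h4 h4
    (by rw [ZMod.card]; omega) isPrimitiveRoot_gaussianInt_I
  have h : ((⟨0, 1⟩ : GaussianInt) - 1) ^ 2 = ⟨0, -2⟩ := by decide
  rw [hz, h]
  simp

/-- The representation of a prime as a sum of an odd and an even square is unique up to signs. -/
theorem sq_add_sq_unique {p : ℕ} (hp : p.Prime) {x y e k : ℤ}
    (hxy : (p : ℤ) = x ^ 2 + y ^ 2) (hek : (p : ℤ) = e ^ 2 + k ^ 2)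
    (hx : x % 2 = 1) (hy : y % 2 = 0) (he : e % 2 = 1) (hk : k % 2 = 0) :
    (x = e ∨ x = -e) ∧ (y = k ∨ y = -k) := by
  wlog hd : (p : ℤ) ∣ x * k - y * e generalizing y
  · have hd' : (p : ℤ) ∣ (x * k - y * e) * (x * k + y * e) :=
      ⟨k ^ 2 - y ^ 2, by linear_combination y ^ 2 * hek - k ^ 2 * hxy⟩
    have h := ((Nat.prime_iff_prime_int.1 hp).dvd_or_dvd hd').resolve_left hd
    have := @this (-y) (by linarith [neg_sq y]) (by omega) (by rwa [neg_mul, sub_neg_eq_add])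
    exact ⟨this.1, by omega⟩
  have hp0 : (0 : ℤ) < p := by exact_mod_cast hp.pos
  obtain ⟨t, ht⟩ := hd
  have hsum : (x * e + y * k) ^ 2 + (p * t) ^ 2 = (p : ℤ) ^ 2 := by
    rw [← ht]
    linear_combination (-e ^ 2 - k ^ 2) * hxy - p * hek
  have hodd : (x * e + y * k) % 2 = 1 := by
    rw [Int.add_emod, Int.mul_emod x, Int.mul_emod y, hx, he, hy, hk]; rfl
  have ht0 : t = 0 := by
    by_contra h
    have h1 : 1 ≤ t ^ 2 := by have := sq_pos_of_ne_zero h; omega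
    have h2 : x * e + y * k ≠ 0 := by omega
    have h3 := sq_pos_of_ne_zero h2
    nlinarith [sq_nonneg (p : ℤ)]
  subst ht0
  have h1 : x * k = y * e := by linarith
  have h2 : (x * p) ^ 2 = (e * p) ^ 2 := by
    rw [show x * p = e * (x * e + y * k) by linear_combination x * hek + k * h1]
    linear_combination e ^ 2 * hsum
  have h3 : (y * p) ^ 2 = (k * p) ^ 2 := by
    rw [show y * p = k * (x * e + y * k) by linear_combination y * hek - e * h1]
    linear_combination k ^ 2 * hsum
  constructor
  · rcases sq_eq_sq_iff_eq_or_eq_neg.1 h2 with h | h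
    · exact Or.inl (mul_right_cancel₀ hp0.ne' h)
    · exact Or.inr (mul_right_cancel₀ hp0.ne' (by linarith))
  · rcases sq_eq_sq_iff_eq_or_eq_neg.1 h3 with h | h
    · exact Or.inl (mul_right_cancel₀ hp0.ne' h)
    · exact Or.inr (mul_right_cancel₀ hp0.ne' (by linarith))

/-- If the odd primes `p` and `q` are squares modulo each other, comparing the Gauss sum of a
quartic character `χ` modulo `p` with its Frobenius image in characteristic `q` evaluates the
quadratic character of `√p · J(χ, χ)` modulo `q` in terms of `√q` modulo `p`. -/
theorem jacobiSum_mul_pow_eq {p q : ℕ} [Fact p.Prime] [Fact q.Prime] (hq : q % 4 = 1)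
    (hne : p ≠ q) {χ : MulChar (ZMod p) GaussianInt} (h4 : χ ^ 4 = 1)
    (h2 : χ ^ 2 = (quadraticChar (ZMod p)).ringHomComp (Int.castRingHom GaussianInt))
    (hp2 : p ≠ 2) (φ : GaussianInt →+* ZMod q) {s : ZMod q} (hs : (p : ZMod q) = s ^ 2)
    {y : ZMod p} (hy : (q : ZMod p) = y ^ 2) :
    (s * φ (jacobiSum χ χ)) ^ (q / 2) = ((quadraticChar (ZMod p) y : ℤ) : ZMod q) := by
  have hch : ringChar (ZMod q) ≠ ringChar (ZMod p) := by
    rw [ZMod.ringChar_zmod_n, ZMod.ringChar_zmod_n]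
    exact hne.symm
  let Ψ := AddChar.FiniteField.primitiveChar (ZMod p) (ZMod q) hch
  let L := CyclotomicField Ψ.n (ZMod q)
  let ψ : AddChar (ZMod p) L := Ψ.char
  have hψ : ψ.IsPrimitive := Ψ.prim
  let ι : ZMod q →+* L := algebraMap (ZMod q) L
  have hι : Function.Injective ι := ι.injective
  have : CharP L q := charP_of_injective_ringHom hι q
  let X : MulChar (ZMod p) L := χ.ringHomComp (ι.comp φ)
  have hXpow (n : ℕ) : X ^ n = (χ ^ n).ringHomComp (ι.comp φ) := MulChar.ringHomComp_pow _ _ _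
  have hX2 : X * X = (quadraticChar (ZMod p)).ringHomComp (Int.castRingHom L) := by
    rw [← sq, hXpow, h2]
    refine MulChar.ext fun z => ?_
    simp [MulChar.ringHomComp_apply]
  have hXX : ∀ z, X z * X z = ((quadraticChar (ZMod p) z : ℤ) : L) := fun z => by
    rw [← MulChar.mul_apply, hX2]; rfl
  have hquad : (X * X).IsQuadratic := hX2 ▸ (quadraticChar_isQuadratic (ZMod p)).comp _
  have hq2 : q ≠ 2 := by omega
  have hXX1 : X * X ≠ 1 := by
    obtain ⟨z, hz⟩ := quadraticChar_exists_neg_one' (F := ZMod p)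
      (by rwa [ZMod.ringChar_zmod_n])
    intro h
    have h' := hXX z
    rw [← MulChar.mul_apply, h, MulChar.one_apply_coe, hz] at h'
    push_cast at h'
    exact Ring.neg_one_ne_one_of_char_ne_two (R := L) (by rwa [ringChar.eq L q]) h'.symm
  have hX1 : X ≠ 1 := fun h => hXX1 (by rw [h, mul_one])
  have hp0 : ((Fintype.card (ZMod p) : ℕ) : L) ≠ 0 := by
    rw [ZMod.card, Ne, CharP.cast_eq_zero_iff L q,
      Nat.prime_dvd_prime_iff_eq Fact.out Fact.out]
    exact hne.symm
  have hG0 := gaussSum_ne_zero_of_nontrivial hp0 hX1 hψ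
  have hGG := jacobiSum_mul_nontrivial hXX1 ψ
  have hT := gaussSum_sq hXX1 hquad hψ
  have hJ : jacobiSum X X = ι (φ (jacobiSum χ χ)) := jacobiSum_ringHomComp _ _ _
  rw [ZMod.card, MulChar.mul_apply, ← map_mul, neg_mul_neg, one_mul, map_one, one_mul] at hT
  have hps : (p : L) = (ι s) ^ 2 := by rw [← map_pow, ← hs, map_natCast]
  rw [hps] at hT
  have hunit : IsUnit (q : ZMod p) := by
    rw [isUnit_iff_ne_zero]
    exact ZMod.prime_ne_zero p q hne
  have hX4 : X ^ 4 = 1 := by rw [hXpow, h4, MulChar.ringHomComp_one]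
  have hXq : X ^ q = X := by
    obtain ⟨m, hm⟩ : ∃ m, q = 4 * m + 1 := ⟨q / 4, by omega⟩
    calc X ^ q = X ^ (4 * m + 1) := congrArg (X ^ ·) hm
      _ = X := by rw [pow_succ, pow_mul, hX4, one_pow, one_mul]
  have hfrob : X q * gaussSum X ψ ^ q = gaussSum X ψ := by
    rw [gaussSum_frob, hXq, AddChar.pow_mulShift]
    exact gaussSum_mulShift X ψ hunit.unit
  have hodd : q = 2 * (q / 2) + 1 := by omega
  have heven : Even (q / 2) := by rw [Nat.even_iff]; omega
  have hb : X q * X q = 1 := by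
    rw [hXX, hy, map_pow]
    have hy0 : y ≠ 0 := by rintro rfl; simp [hy] at hunit
    rw [quadraticChar_sq_one hy0, Int.cast_one]
  have hpow : (gaussSum X ψ * gaussSum X ψ) ^ (q / 2) = X q := by
    have h5 : X q * (gaussSum X ψ * gaussSum X ψ) ^ (q / 2) = 1 := by
      apply mul_right_cancel₀ hG0
      rw [one_mul, mul_assoc, ← sq, ← pow_mul, ← pow_succ, ← hodd, hfrob]
    calc _ = X q * (X q * (gaussSum X ψ * gaussSum X ψ) ^ (q / 2)) := by
            rw [← mul_assoc, hb, one_mul]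
      _ = X q := by rw [h5, mul_one]
  rw [← hGG, hJ, hy, map_pow, sq (X y), hXX, mul_pow] at hpow
  apply hι
  rw [map_intCast, map_pow, map_mul, mul_pow, ← hpow]
  congr 1
  rcases sq_eq_sq_iff_eq_or_eq_neg.1 hT with h | h
  · rw [h]
  · rw [h, heven.neg_pow]

/-- Let `p₁ ≡ p₂ ≡ 5 (mod 8)` be distinct primes, `p₁ = e² + 4f²`,
`p₂ = g² + 4h²`, and let `π₁ = e + 2if`, `π₃ = g + 2ih` be Gaussian primes.  Assume `p₁` is a
quadratic residue mod `p₂`.  Let `a = (p₁/p₂)₄` and `b = (p₂/p₁)₄` be the rational quartic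
residue symbols, i.e. `a, b ∈ {±1}` with `a ≡ p₁^((p₂-1)/4) (mod p₂)` and
`b ≡ p₂^((p₁-1)/4) (mod p₁)`.  Then `(p₁/p₂)₄·(p₂/p₁)₄ = (π₁/π₃)`: `π₁` is a square in the
residue field `ℤ[i]/(π₃)` if and only if `a = b`. -/
theorem stmt_8 (p₁ p₂ : ℕ) (hp₁ : p₁.Prime) (hp₂ : p₂.Prime) (hne : p₁ ≠ p₂)
    (hm₁ : p₁ % 8 = 5) (hm₂ : p₂ % 8 = 5)
    (e f g h : ℤ) (hef : (p₁ : ℤ) = e ^ 2 + 4 * f ^ 2) (hgh : (p₂ : ℤ) = g ^ 2 + 4 * h ^ 2)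
    (hQR : IsSquare ((p₁ : ZMod p₂)))
    (a b : ℤ) (ha : a = 1 ∨ a = -1) (hb : b = 1 ∨ b = -1)
    (hacong : (a : ZMod p₂) = (p₁ : ZMod p₂) ^ ((p₂ - 1) / 4))
    (hbcong : (b : ZMod p₁) = (p₂ : ZMod p₁) ^ ((p₁ - 1) / 4)) :
    IsSquare (Ideal.Quotient.mk (Ideal.span {(⟨g, 2 * h⟩ : GaussianInt)})
        (⟨e, 2 * f⟩ : GaussianInt)) ↔ a = b := by
  have := Fact.mk hp₁
  have := Fact.mk hp₂
  have hp2 : p₁ ≠ 2 := by omega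
  have hq2 : p₂ ≠ 2 := by omega
  have : Fact (2 < p₁) := ⟨by have := hp₁.two_le; omega⟩
  have : Fact (2 < p₂) := ⟨by have := hp₂.two_le; omega⟩
  obtain ⟨φ, hφ⟩ := exists_ringHom_isSquare_mk_iff (g := g) (k := 2 * h) hp₂ (by rw [hgh]; ring)
  rw [hφ]
  have hQR' : IsSquare (p₂ : ZMod p₁) :=
    (ZMod.exists_sq_eq_prime_iff_of_mod_four_eq_one (by omega) hq2).2 hQR
  obtain ⟨s, hs⟩ := isSquare_iff_exists_sq _ |>.1 hQR
  obtain ⟨y, hy⟩ := isSquare_iff_exists_sq _ |>.1 hQR'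
  have hp0 : (p₁ : ZMod p₂) ≠ 0 := ZMod.prime_ne_zero p₂ p₁ hne.symm
  have hs0 : s ≠ 0 := by rintro rfl; simp [hs] at hp0
  have has : (a : ZMod p₂) = s ^ (p₂ / 2) := by
    rw [hacong, hs, ← pow_mul]
    congr 1
    omega
  have hby : b = quadraticChar (ZMod p₁) y := by
    have hy0 : y ≠ 0 := by
      rintro rfl
      exact ZMod.prime_ne_zero p₁ p₂ hne (by simp [hy])
    have h1 : (b : ZMod p₁) = ((quadraticChar (ZMod p₁) y : ℤ) : ZMod p₁) := by
      rw [quadraticChar_eq_pow_of_char_ne_two' (by rwa [ZMod.ringChar_zmod_n]), hbcong, hy,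
        ← pow_mul, ZMod.card]
      congr 1
      omega
    have hne1 : (-1 : ZMod p₁) ≠ 1 := ZMod.neg_one_ne_one
    rcases hb with rfl | rfl <;> rcases quadraticChar_dichotomy hy0 with h | h <;>
      rw [h] at h1 ⊢ <;> push_cast at h1 <;> first | rfl | exact absurd h1 hne1 |
        exact absurd h1.symm hne1
  obtain ⟨χ, h2, h4, hχ⟩ := exists_quarticChar (p := p₁) (by omega)
  have key := jacobiSum_mul_pow_eq (by omega) hne h4 hχ hp2 φ hs hy
  rw [← hby, mul_pow, ← has] at key
  have hnorm := norm_jacobiSum h2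
  obtain ⟨hre, him⟩ := jacobiSum_parity (by omega) h4
  have he : e % 2 = 1 := by
    by_contra hc
    obtain ⟨t, rfl⟩ : (2 : ℤ) ∣ e := by omega
    have : (p₁ : ℤ) = 4 * (t ^ 2 + f ^ 2) := by rw [hef]; ring
    omega
  obtain ⟨hx, hy'⟩ := sq_add_sq_unique (k := 2 * f) hp₁
    (by rw [← hnorm, Zsqrtd.norm_def]; ring) (by rw [hef]; ring) hre him he (by omega)
  have heven : Even (p₂ / 2) := by rw [Nat.even_iff]; omega
  have hprod : φ ⟨e, 2 * f⟩ * φ ⟨e, -(2 * f)⟩ = s ^ 2 := by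
    rw [← hs, ← map_mul, ← map_natCast φ]
    congr 1
    apply Zsqrtd.ext
    · simp [hef]; ring
    · simp; ring
  have hπ0 : φ ⟨e, 2 * f⟩ ≠ 0 := by
    intro h0
    rw [h0, zero_mul] at hprod
    exact hs0 (by simpa using hprod.symm)
  have hconj : φ ⟨e, 2 * f⟩ ^ (p₂ / 2) = φ ⟨e, -(2 * f)⟩ ^ (p₂ / 2) := by
    have h5 : φ ⟨e, 2 * f⟩ ^ (p₂ / 2) * φ ⟨e, -(2 * f)⟩ ^ (p₂ / 2) = 1 := by
      rw [← mul_pow, hprod, ← pow_mul, show 2 * (p₂ / 2) = p₂ - 1 by omega]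
      exact ZMod.pow_card_sub_one_eq_one hs0
    rcases ZMod.pow_div_two_eq_neg_one_or_one p₂ hπ0 with h | h <;> rw [h] at h5 ⊢
    · linear_combination -h5
    · linear_combination h5
  have hJ : φ (jacobiSum χ χ) ^ (p₂ / 2) = φ ⟨e, 2 * f⟩ ^ (p₂ / 2) := by
    have hJeq : jacobiSum χ χ = ⟨(jacobiSum χ χ).re, (jacobiSum χ χ).im⟩ := rfl
    have hneg (u v : ℤ) : φ ⟨-u, -v⟩ = -φ ⟨u, v⟩ := map_neg φ ⟨u, v⟩
    rw [hJeq]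
    rcases hx with hx | hx <;> rcases hy' with hy' | hy' <;> rw [hx, hy']
    · exact hconj.symm
    · rw [← neg_neg (2 * f), hneg, heven.neg_pow, neg_neg, hconj]
    · rw [hneg, heven.neg_pow]
  rw [hJ] at key
  rw [ZMod.euler_criterion p₂ hπ0]
  have haa : (a : ZMod p₂) * a = 1 := by rcases ha with rfl | rfl <;> simp
  have hpab : φ ⟨e, 2 * f⟩ ^ (p₂ / 2) = a * b := by
    rw [← key, ← mul_assoc, haa, one_mul]
  rw [hpab]
  have hne1 : (-1 : ZMod p₂) ≠ 1 := ZMod.neg_one_ne_one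
  rcases ha with rfl | rfl <;> rcases hb with rfl | rfl <;> simp [hne1]
end
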